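/- arXiv:2401.14689 — 3 statements merged into one kernel-verified Lean document; each statement's English description precedes it below -/
import Mathlib

section
/- Let δ₀, ε₀ > 0 and let r₁, r₂, r₃ be real-valued real analytic functions on (−δ₀,δ₀) × (−ε₀,ε₀) for which there is C > 0 with |r₁(δ,ε)| ≤ C(|ε|³ + |δ|ε² + δ²), |r₃(δ,ε)| ≤ C(|ε|³ + |δ|ε² + δ²), and |r₂(δ,ε)| ≤ C(|ε|⁵ + |δ|ε⁴ + δ²ε² + δ⁴|ε|). For μ = 1/4 + δ define the complex 2×2 matrix L(μ,ε) with entries L₁₁ = i(3/4 + (2/3)δ − (9/8)ε² + r₁(δ,ε)), L₁₂ = L₂₁ = −(√3/6)δε² − (39√3/512)ε⁴ + r₂(δ,ε), L₂₂ = i(3/4 + 2δ + (1/16)ε² + r₃(δ,ε)); write L = J·B with J = [[−i,0],[0,i]], B = [[α, iβ],[−iβ, γ]] (α, β, γ real), and set D(μ,ε) := 4β(μ,ε)² − (α(μ,ε)+γ(μ,ε))². Then there exist ε₁ ∈ (0,ε₀), δ₀' ∈ (0,δ₀] and real analytic functions μ₀, μ₊, μ₋ : [0,ε₁) → (1/4−δ₀',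 1/4+δ₀') with μ₊(ε) ≤ μ₀(ε) ≤ μ₋(ε), μ₀(ε) = 1/4 − (57/64)ε² + O(ε³) and μ±(ε) = μ₀(ε) ∓ (111√3/1024)ε⁴ + O(ε⁵), such that, writing ν±(ε) := μ±(ε) − μ₀(ε): (1) there are C', ν̄ > 0 with |D(μ₀(ε)+ν,ε) − (4107/65536)ε⁸ + (16/9)ν² + (37/128)νε⁶| ≤ C'(|ε|⁹ + |ν||ε|⁷ + ν²ε² + |ν|³) for all 0 ≤ ε < ε₁, |ν| < ν̄; (2) the two eigenvalues of L(μ₀(ε)+ν,ε) are i(3/4 + (4/3)ν − (55/32)ε² + ρ(ν,ε)) ± (1/2)√(D(μ₀(ε)+ν,ε)) when ν₊(ε) < ν < ν₋(ε), and these have opposite nonzero real parts, while for ν outside (ν₊(ε),ν₋(ε)) the two eigenvalues are i(3/4 + (4/3)ν − (55/32)ε² + ρ(ν,ε)) ± (i/2)√|D(μ₀(ε)+ν,ε)|, both purely imaginary, where ρ is real-valued with |ρ(ν,ε)| ≤ C'(|ε|³ + |ν|ε² + ν²); (3) for every fixed ε ∈ (0,ε₁) the set {(Re λ, Im λ) :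 λ an eigenvalue of L(μ,ε) for some μ ∈ [μ₊(ε), μ₋(ε)]} is the boundary of a compact convex subset of ℝ² with nonempty interior. -/
open Matrix Set

noncomputable def Jmat : Matrix (Fin 2) (Fin 2) ℂ := !![-Complex.I, 0; 0, Complex.I]

noncomputable def Bmat (a b c : ℝ) : Matrix (Fin 2) (Fin 2) ℂ :=
  !![(a : ℂ), Complex.I * (b : ℂ); -Complex.I * (b : ℂ), (c : ℂ)]

/-- The 2×2 Hamiltonian and reversible matrix `L = J ⬝ B`; its entries are
`L₁₁ = -iα`, `L₁₂ = L₂₁ = β`, `L₂₂ = iγ`. -/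
noncomputable def Lmat (a b c : ℝ) : Matrix (Fin 2) (Fin 2) ℂ := Jmat * Bmat a b c

/-- `l` is an eigenvalue of `M`, i.e. a root of its characteristic polynomial. -/
def IsEig (M : Matrix (Fin 2) (Fin 2) ℂ) (l : ℂ) : Prop := (Matrix.charpoly M).IsRoot l

open Filter Topology

/-- The partial derivative in the first variable of a function on the plane. -/
noncomputable def partialFst (F : ℝ × ℝ → ℝ) (p : ℝ × ℝ) : ℝ := fderiv ℝ F p (1, 0)

lemma hasDerivAt_partialFst {F : ℝ × ℝ → ℝ} {p : ℝ × ℝ} (hF : AnalyticAt ℝ F p) :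
    HasDerivAt (fun x => F (x, p.2)) (partialFst F p) p.1 := by
  have h1 : HasFDerivAt F (fderiv ℝ F p) (p.1, p.2) := hF.differentiableAt.hasFDerivAt
  have h2 : HasDerivAt (fun x : ℝ => (x, p.2)) ((1 : ℝ), (0 : ℝ)) p.1 :=
    (hasDerivAt_id p.1).prodMk (hasDerivAt_const _ _)
  exact h1.comp_hasDerivAt p.1 h2

lemma AnalyticAt.partialFst {F : ℝ × ℝ → ℝ} {p : ℝ × ℝ} (hF : AnalyticAt ℝ F p) :
    AnalyticAt ℝ (partialFst F) p := by
  have h : AnalyticAt ℝ (fun q => (ContinuousLinearMap.apply ℝ ℝ ((1 : ℝ), (0 : ℝ)))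
      (fderiv ℝ F q)) p :=
    (ContinuousLinearMap.analyticAt _ _).comp hF.fderiv
  exact h

/-- The analytic implicit function theorem in the plane, solving for the first variable. -/
lemma exists_analytic_implicit {F : ℝ × ℝ → ℝ} (hF : AnalyticAt ℝ F (0, 0)) (h0 : F (0, 0) = 0)
    (h1 : partialFst F (0, 0) ≠ 0) :
    ∃ φ : ℝ → ℝ, AnalyticAt ℝ φ 0 ∧ φ 0 = 0 ∧ ∀ᶠ e in 𝓝 (0 : ℝ), F (φ e, e) = 0 := by
  let S : ℝ × ℝ →L[ℝ] ℝ × ℝ :=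
    (ContinuousLinearMap.snd ℝ ℝ ℝ).prod (ContinuousLinearMap.fst ℝ ℝ ℝ)
  have hS : ∀ q, S q = (q.2, q.1) := fun q => rfl
  have hF' : AnalyticAt ℝ F (S (0, 0)) := hF
  have hG : AnalyticAt ℝ (F ∘ S) (0, 0) := hF'.comp (S.analyticAt _)
  have cdf : ContDiffAt ℝ ⊤ (F ∘ S) (0, 0) := hG.contDiffAt
  have hfd : fderiv ℝ (F ∘ S) (0, 0) = (fderiv ℝ F (0, 0)).comp S := by
    rw [fderiv_comp _ hF'.differentiableAt S.differentiableAt, S.fderiv]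
    rfl
  have hinv : (fderiv ℝ (F ∘ S) (0, 0) ∘L .inr ℝ ℝ ℝ).IsInvertible := by
    refine ⟨ContinuousLinearEquiv.unitsEquivAut ℝ (Units.mk0 _ h1), ?_⟩
    ext
    rw [hfd]
    simp [hS, _root_.partialFst]
  refine ⟨cdf.implicitFunction (by simp) hinv, ?_, ?_, ?_⟩
  · exact (cdf.contDiffAt_implicitFunction (by simp) hinv).analyticAt
  · exact cdf.implicitFunction_apply_self (by simp) hinv
  · filter_upwards [cdf.eventually_apply_implicitFunction (by simp) hinv] with e he
    simpa [hS, h0] using he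

lemma AnalyticAt.exists_abs_sub_le {F : ℝ × ℝ → ℝ} (hF : AnalyticAt ℝ F (0, 0)) :
    ∃ K > 0, ∀ᶠ p in 𝓝 ((0 : ℝ), (0 : ℝ)), |F p - F (0, p.2)| ≤ K * |p.1| := by
  obtain ⟨K, t, ht, hK⟩ := (hF.contDiffAt (n := 1)).exists_lipschitzOnWith
  have hc : Tendsto (fun p : ℝ × ℝ => ((0 : ℝ), p.2)) (𝓝 (0, 0)) (𝓝 (0, 0)) := by
    have : Continuous (fun p : ℝ × ℝ => ((0 : ℝ), p.2)) := by fun_prop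
    simpa using this.tendsto (0, 0)
  refine ⟨K + 1, by positivity, ?_⟩
  filter_upwards [ht, hc ht] with p hp hp'
  have h := hK.dist_le_mul p hp _ hp'
  have e : dist p (0, p.2) = |p.1| := by simp [Prod.dist_eq]
  rw [e, Real.dist_eq] at h
  nlinarith [abs_nonneg p.1]

lemma exists_box_of_eventually {P : ℝ × ℝ → Prop} (h : ∀ᶠ p in 𝓝 ((0 : ℝ), (0 : ℝ)), P p) :
    ∃ η > 0, ∀ x e : ℝ, |x| < η → |e| < η → P (x, e) := by
  obtain ⟨η, hη, hP⟩ := Metric.eventually_nhds_iff.1 h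
  refine ⟨η, hη, fun x e hx he => hP ?_⟩
  simpa [Prod.dist_eq] using ⟨hx, he⟩

/-- A function of one variable, analytic at `0`, is quadratically small as soon as it is
`O(s ^ 3)` along `s ^ 2`. -/
lemma AnalyticAt.exists_abs_le_sq {q : ℝ → ℝ} (hq : AnalyticAt ℝ q 0) {M : ℝ}
    (h : ∀ᶠ s in 𝓝[>] (0 : ℝ), |q (s ^ 2)| ≤ M * s ^ 3) :
    ∃ K > 0, ∀ᶠ e in 𝓝 (0 : ℝ), |q e| ≤ K * e ^ 2 := by
  obtain ⟨c₀, c₁, K, hK0, hK⟩ : ∃ c₀ c₁ K : ℝ, 0 < K ∧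
      ∀ᶠ e in 𝓝 (0 : ℝ), |q e - (c₀ + c₁ * e)| ≤ K * e ^ 2 := by
    obtain ⟨p, hp⟩ := hq
    obtain ⟨K, hK0, hK⟩ := (hp.isBigO_sub_partialSum_pow 2).exists_pos
    refine ⟨p.coeff 0, p.coeff 1, K, hK0, ?_⟩
    filter_upwards [hK.bound] with e he
    simpa [FormalMultilinearSeries.partialSum, Finset.sum_range_succ, mul_comm] using he
  have hsq : Tendsto (fun s : ℝ => s ^ 2) (𝓝[>] 0) (𝓝 0) := by
    have : Continuous (fun s : ℝ => s ^ 2) := by fun_prop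
    simpa using (this.tendsto 0).mono_left nhdsWithin_le_nhds
  have key : ∀ᶠ s in 𝓝[>] (0 : ℝ), |c₀ + c₁ * s ^ 2| ≤ M * s ^ 3 + K * s ^ 4 := by
    filter_upwards [h, hsq.eventually hK] with s h1 h2
    rw [abs_le] at *
    constructor <;> nlinarith
  have hc₀ : c₀ = 0 := by
    have l1 : Tendsto (fun s : ℝ => |c₀ + c₁ * s ^ 2|) (𝓝[>] 0) (𝓝 |c₀|) := by
      have : Continuous (fun s : ℝ => |c₀ + c₁ * s ^ 2|) := by fun_prop
      simpa using (this.tendsto 0).mono_left nhdsWithin_le_nhds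
    have l2 : Tendsto (fun s : ℝ => M * s ^ 3 + K * s ^ 4) (𝓝[>] 0) (𝓝 0) := by
      have : Continuous (fun s : ℝ => M * s ^ 3 + K * s ^ 4) := by fun_prop
      simpa using (this.tendsto 0).mono_left nhdsWithin_le_nhds
    exact abs_nonpos_iff.1 (le_of_tendsto_of_tendsto l1 l2 key)
  have hc₁ : c₁ = 0 := by
    have l2 : Tendsto (fun s : ℝ => M * s + K * s ^ 2) (𝓝[>] 0) (𝓝 0) := by
      have : Continuous (fun s : ℝ => M * s + K * s ^ 2) := by fun_prop
      simpa using (this.tendsto 0).mono_left nhdsWithin_le_nhds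
    refine abs_nonpos_iff.1 (ge_of_tendsto l2 ?_)
    filter_upwards [key, self_mem_nhdsWithin] with s hs (hs0 : 0 < s)
    rw [hc₀, zero_add, abs_mul, abs_of_pos (by positivity : 0 < s ^ 2)] at hs
    refine le_of_mul_le_mul_right ?_ (by positivity : 0 < s ^ 2)
    linarith
  refine ⟨K, hK0, ?_⟩
  filter_upwards [hK] with e he
  simpa [hc₀, hc₁] using he

/-- If `r` is analytic and `O(|e| ^ 3 + |x| * e ^ 2 + x ^ 2)`, its derivative in `x` is
`O(|x| + e ^ 2)`. -/
lemma exists_partialFst_le {r : ℝ × ℝ → ℝ} (hr : AnalyticAt ℝ r (0, 0)) {C : ℝ}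
    (hb : ∀ᶠ p in 𝓝 ((0 : ℝ), (0 : ℝ)), |r p| ≤ C * (|p.2| ^ 3 + |p.1| * p.2 ^ 2 + p.1 ^ 2)) :
    ∃ K > 0, ∀ᶠ p in 𝓝 ((0 : ℝ), (0 : ℝ)), |partialFst r p| ≤ K * (|p.1| + p.2 ^ 2) := by
  obtain ⟨K₁, hK₁, h1⟩ := hr.partialFst.exists_abs_sub_le
  obtain ⟨η, hη, H⟩ := exists_box_of_eventually (hb.and (h1.and hr.eventually_analyticAt))
  have hq : AnalyticAt ℝ (fun e : ℝ => partialFst r (0, e)) 0 := by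
    have h2 : AnalyticAt ℝ (fun e : ℝ => ((0 : ℝ), e)) 0 := by fun_prop
    exact AnalyticAt.comp (g := partialFst r) (f := fun e : ℝ => ((0 : ℝ), e)) hr.partialFst h2
  have hs : ∀ᶠ s in 𝓝[>] (0 : ℝ), |partialFst r (0, s ^ 2)| ≤ (4 * |C| + K₁) * s ^ 3 := by
    have hmem : Ioo (0 : ℝ) (min η 1) ∈ 𝓝[>] (0 : ℝ) := Ioo_mem_nhdsGT (by positivity)
    filter_upwards [hmem] with s hs
    obtain ⟨hs0, hs1⟩ := hs
    obtain ⟨hsη, hs1⟩ := lt_min_iff.1 hs1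
    have hs2 : s ^ 2 < η := by nlinarith
    have hs3 : s ^ 3 < η := by nlinarith [pow_pos hs0 2]
    have hs2' : |s ^ 2| < η := by rwa [abs_of_pos (by positivity)]
    have hbox : ∀ x ∈ Icc 0 (s ^ 3), |x| < η := fun x hx => by
      rw [abs_of_nonneg hx.1]; linarith [hx.2]
    have hder : ∀ x ∈ Icc 0 (s ^ 3),
        HasDerivAt (fun x => r (x, s ^ 2)) (partialFst r (x, s ^ 2)) x := fun x hx =>
      hasDerivAt_partialFst (H x _ (hbox x hx) hs2').2.2
    have hpos : 0 < s ^ 3 := by positivity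
    obtain ⟨ξ, hξ, hslope⟩ := exists_hasDerivAt_eq_slope (fun x => r (x, s ^ 2))
      (fun x => partialFst r (x, s ^ 2)) hpos
      (fun x hx => (hder x hx).continuousAt.continuousWithinAt)
      (fun x hx => hder x ⟨hx.1.le, hx.2.le⟩)
    rw [eq_div_iff (by simpa using hs0.ne')] at hslope
    have b1 := (H (s ^ 3) (s ^ 2) (hbox _ ⟨hpos.le, le_rfl⟩) hs2').1
    have b0 := (H 0 (s ^ 2) (by simpa using hη) hs2').1
    have bξ := (H ξ (s ^ 2) (hbox _ ⟨hξ.1.le, hξ.2.le⟩) hs2').2.1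
    simp only [abs_of_pos hpos, abs_of_pos (by positivity : 0 < s ^ 2), abs_zero,
      abs_of_pos hξ.1] at b1 b0 bξ
    have c1 : |r (s ^ 3, s ^ 2)| ≤ 3 * |C| * s ^ 6 := by
      have h7 : s ^ 7 ≤ s ^ 6 := pow_le_pow_of_le_one hs0.le hs1.le (by norm_num)
      have hle := mul_le_mul_of_nonneg_right (le_abs_self C) (by positivity :
        0 ≤ (s ^ 2) ^ 3 + s ^ 3 * (s ^ 2) ^ 2 + (s ^ 3) ^ 2)
      have hmul := mul_le_mul_of_nonneg_left h7 (abs_nonneg C)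
      nlinarith
    have c0 : |r (0, s ^ 2)| ≤ |C| * s ^ 6 := by
      have hle := mul_le_mul_of_nonneg_right (le_abs_self C) (by positivity : 0 ≤ (s ^ 2) ^ 3)
      nlinarith
    have c2 : |partialFst r (ξ, s ^ 2)| ≤ 4 * |C| * s ^ 3 := by
      refine le_of_mul_le_mul_right ?_ hpos
      rw [← abs_of_pos hpos, ← abs_mul, abs_of_pos hpos]
      rw [sub_zero] at hslope
      rw [hslope]
      calc |r (s ^ 3, s ^ 2) - r (0, s ^ 2)| ≤ |r (s ^ 3, s ^ 2)| + |r (0, s ^ 2)| := abs_sub _ _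
        _ ≤ 4 * |C| * s ^ 3 * s ^ 3 := by nlinarith
    have c3 := abs_sub_abs_le_abs_sub (partialFst r (0, s ^ 2)) (partialFst r (ξ, s ^ 2))
    rw [abs_sub_comm] at c3
    have c4 := mul_le_mul_of_nonneg_left hξ.2.le hK₁.le
    linarith
  obtain ⟨K₂, hK₂, h2⟩ := hq.exists_abs_le_sq hs
  refine ⟨K₁ + K₂, by positivity, ?_⟩
  have hsnd : Tendsto (fun p : ℝ × ℝ => p.2) (𝓝 (0, 0)) (𝓝 0) := by
    simpa using (continuous_snd (X := ℝ) (Y := ℝ)).tendsto (0, 0)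
  filter_upwards [h1, hsnd.eventually h2] with p hp1 hp2
  have := abs_sub_abs_le_abs_sub (partialFst r p) (partialFst r (0, p.2))
  nlinarith [abs_nonneg p.1, sq_nonneg p.2]

/-- The region enclosed by the graphs of `± √f`, for `f` concave and vanishing at the endpoints. -/
lemma frontier_region_of_concaveOn {a b : ℝ} (hab : a < b) {f : ℝ → ℝ}
    (hf : ConcaveOn ℝ (Icc a b) f) (ha : f a = 0) (hb : f b = 0)
    (hpos : ∀ y ∈ Ioo a b, 0 < f y) {K : Set (ℝ × ℝ)}
    (hK : K = {p : ℝ × ℝ | p.2 ∈ Icc a b ∧ p.1 ^ 2 ≤ f p.2}) (hcomp : IsCompact K) :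
    Convex ℝ K ∧ (interior K).Nonempty ∧
      frontier K = {p : ℝ × ℝ | p.2 ∈ Icc a b ∧ p.1 ^ 2 = f p.2} := by
  have hcont : ContinuousOn f (Ioo a b) :=
    (hf.subset Ioo_subset_Icc_self (convex_Ioo a b)).continuousOn isOpen_Ioo
  have hopen : IsOpen {p : ℝ × ℝ | p.2 ∈ Ioo a b ∧ p.1 ^ 2 < f p.2} := by
    have hs : IsOpen {p : ℝ × ℝ | p.2 ∈ Ioo a b} := isOpen_Ioo.preimage continuous_snd
    have hg : ContinuousOn (fun p : ℝ × ℝ => p.1 ^ 2 - f p.2) {p : ℝ × ℝ | p.2 ∈ Ioo a b} :=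
      ContinuousOn.sub (by fun_prop) (hcont.comp continuousOn_snd fun p hp => hp)
    convert hg.isOpen_inter_preimage hs (isOpen_Iio (a := (0 : ℝ))) using 1
    ext p
    simp
  have hsub : {p : ℝ × ℝ | p.2 ∈ Ioo a b ∧ p.1 ^ 2 < f p.2} ⊆ interior K := by
    refine interior_maximal (fun p hp => ?_) hopen
    rw [hK]
    exact ⟨Ioo_subset_Icc_self hp.1, hp.2.le⟩
  refine ⟨?_, ?_, ?_⟩
  · rw [hK]
    rintro p ⟨hp, hp'⟩ q ⟨hq, hq'⟩ s t hs ht hst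
    refine ⟨convex_Icc a b hp hq hs ht hst, ?_⟩
    have h1 := hf.2 hp hq hs ht hst
    simp only [Prod.fst_add, Prod.smul_fst, Prod.snd_add, Prod.smul_snd, smul_eq_mul] at h1 ⊢
    have h2 : (s * p.1 + t * q.1) ^ 2 ≤ s * p.1 ^ 2 + t * q.1 ^ 2 := by
      obtain rfl : t = 1 - s := by linarith
      nlinarith [mul_nonneg (mul_nonneg hs ht) (sq_nonneg (p.1 - q.1))]
    nlinarith [mul_le_mul_of_nonneg_left hp' hs, mul_le_mul_of_nonneg_left hq' ht]
  · refine ⟨(0, (a + b) / 2), hsub ?_⟩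
    have hm : (a + b) / 2 ∈ Ioo a b := ⟨by linarith, by linarith⟩
    exact ⟨hm, by simpa using hpos _ hm⟩
  · rw [hcomp.isClosed.frontier_eq]
    ext p
    constructor
    · rintro ⟨hp, hpi⟩
      rw [hK] at hp
      refine ⟨hp.1, le_antisymm hp.2 (not_lt.1 fun hlt => hpi (hsub ⟨?_, hlt⟩))⟩
      have h0 : 0 < f p.2 := lt_of_le_of_lt (sq_nonneg _) hlt
      refine ⟨lt_of_le_of_ne hp.1.1 ?_, lt_of_le_of_ne hp.1.2 ?_⟩
      · intro h; rw [← h, ha] at h0; exact h0.false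
      · intro h; rw [h, hb] at h0; exact h0.false
    · rintro ⟨hp, hpe⟩
      refine ⟨by rw [hK]; exact ⟨hp, hpe.le⟩, fun hpi => ?_⟩
      have hcurve : ∀ σ : ℝ, ∀ᶠ t in 𝓝[>] (0 : ℝ), (p.1 + σ * t, p.2) ∈ K := fun σ => by
        have hc : Continuous fun t : ℝ => (p.1 + σ * t, p.2) := by fun_prop
        have ht : Tendsto (fun t : ℝ => (p.1 + σ * t, p.2)) (𝓝[>] 0) (𝓝 p) := by
          simpa using (hc.tendsto 0).mono_left nhdsWithin_le_nhds
        exact ht.eventually (mem_interior_iff_mem_nhds.1 hpi)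
      rcases le_total 0 p.1 with h0 | h0
      · obtain ⟨t, ht, ht0⟩ := ((hcurve 1).and self_mem_nhdsWithin).exists
        rw [hK] at ht
        have := ht.2
        have ht0 : 0 < t := ht0
        simp only [← hpe] at this
        nlinarith
      · obtain ⟨t, ht, ht0⟩ := ((hcurve (-1)).and self_mem_nhdsWithin).exists
        rw [hK] at ht
        have := ht.2
        have ht0 : 0 < t := ht0
        simp only [← hpe] at this
        nlinarith

/-- A closed curve `x ↦ (± √(D x), Y x)` bounds a compact convex set when `Y` is increasing, `D` is
positive between its two zeros, and the slope of `D` with respect to `Y` is nonincreasing. -/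
lemma exists_convex_frontier_eq {a b : ℝ} (hab : a < b) {D Y h Y' : ℝ → ℝ}
    (hY : ∀ x ∈ Icc a b, HasDerivAt Y (Y' x) x) (hY' : ∀ x ∈ Icc a b, 0 < Y' x)
    (hD : ∀ x ∈ Icc a b, HasDerivAt D (h x * Y' x) x) (hh : AntitoneOn h (Icc a b))
    (ha : D a = 0) (hb : D b = 0) (hpos : ∀ x ∈ Ioo a b, 0 < D x) :
    ∃ K : Set (ℝ × ℝ), IsCompact K ∧ Convex ℝ K ∧ (interior K).Nonempty ∧
      frontier K = {p : ℝ × ℝ | ∃ x ∈ Icc a b, p.1 ^ 2 = D x ∧ p.2 = Y x} := by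
  have hYc : ContinuousOn Y (Icc a b) := fun x hx => (hY x hx).continuousAt.continuousWithinAt
  have hDc : ContinuousOn D (Icc a b) := fun x hx => (hD x hx).continuousAt.continuousWithinAt
  have hmono : StrictMonoOn Y (Icc a b) := by
    refine strictMonoOn_of_deriv_pos (convex_Icc a b) hYc fun x hx => ?_
    rw [interior_Icc] at hx
    rw [(hY x (Ioo_subset_Icc_self hx)).deriv]
    exact hY' x (Ioo_subset_Icc_self hx)
  have hleft : a ∈ Icc a b := left_mem_Icc.2 hab.le
  have hright : b ∈ Icc a b := right_mem_Icc.2 hab.le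
  have himg : Y '' Icc a b = Icc (Y a) (Y b) := by
    refine Subset.antisymm ?_ (intermediate_value_Icc hab.le hYc)
    rintro _ ⟨x, hx, rfl⟩
    exact ⟨hmono.monotoneOn hleft hx hx.1, hmono.monotoneOn hx hright hx.2⟩
  let g := Function.invFunOn Y (Icc a b)
  have hg : ∀ x ∈ Icc a b, g (Y x) = x := fun x hx =>
    hmono.injOn.leftInvOn_invFunOn hx
  have htan : ∀ z ∈ Icc a b, ∀ x ∈ Icc a b, D x ≤ D z + h z * (Y x - Y z) := by
    intro z hz x hx
    have hder : ∀ x ∈ Icc a b, HasDerivAt (fun x => D x - h z * Y x) ((h x - h z) * Y' x) x :=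
      fun x hx => ((hD x hx).sub ((hY x hx).const_mul (h z))).congr_deriv (by ring)
    rcases le_total x z with hxz | hxz
    · have hsub : Icc a z ⊆ Icc a b := Icc_subset_Icc_right hz.2
      have hm : MonotoneOn (fun x => D x - h z * Y x) (Icc a z) := by
        refine monotoneOn_of_deriv_nonneg (convex_Icc a z)
          (fun w hw => (hder w (hsub hw)).continuousAt.continuousWithinAt)
          (fun w hw => (hder w (hsub (interior_subset hw))).differentiableAt.differentiableWithinAt)
          fun w hw => ?_
        have hw' := interior_subset hw
        rw [(hder w (hsub hw')).deriv]
        exact mul_nonneg (sub_nonneg.2 (hh (hsub hw') hz hw'.2)) (hY' w (hsub hw')).le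
      have := hm ⟨hx.1, hxz⟩ ⟨hz.1, le_rfl⟩ hxz
      simp only at this
      linarith
    · have hsub : Icc z b ⊆ Icc a b := Icc_subset_Icc_left hz.1
      have hm : AntitoneOn (fun x => D x - h z * Y x) (Icc z b) := by
        refine antitoneOn_of_deriv_nonpos (convex_Icc z b)
          (fun w hw => (hder w (hsub hw)).continuousAt.continuousWithinAt)
          (fun w hw => (hder w (hsub (interior_subset hw))).differentiableAt.differentiableWithinAt)
          fun w hw => ?_
        have hw' := interior_subset hw
        rw [(hder w (hsub hw')).deriv]
        exact mul_nonpos_of_nonpos_of_nonneg (sub_nonpos.2 (hh hz (hsub hw') hw'.1))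
          (hY' w (hsub hw')).le
      have := hm ⟨le_rfl, hz.2⟩ ⟨hxz, hx.2⟩ hxz
      simp only at this
      linarith
  have hpar : ∀ y ∈ Icc (Y a) (Y b), ∃ x ∈ Icc a b, Y x = y := fun y hy => by
    rw [← himg] at hy
    exact hy
  have hconc : ConcaveOn ℝ (Icc (Y a) (Y b)) (D ∘ g) := by
    refine ⟨convex_Icc _ _, fun y hy z hz s t hs ht hst => ?_⟩
    obtain ⟨w, hw, hwe⟩ := hpar _ (convex_Icc _ _ hy hz hs ht hst)
    obtain ⟨y', hy', rfl⟩ := hpar y hy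
    obtain ⟨z', hz', rfl⟩ := hpar z hz
    simp only [Function.comp_apply, hg y' hy', hg z' hz', ← hwe, hg w hw]
    simp only [smul_eq_mul] at hwe ⊢
    have h1 := mul_le_mul_of_nonneg_left (htan w hw y' hy') hs
    have h2 := mul_le_mul_of_nonneg_left (htan w hw z' hz') ht
    rw [hwe] at h1 h2
    obtain rfl : t = 1 - s := by linarith
    nlinarith
  have hset : ∀ R : ℝ → ℝ → Prop, {p : ℝ × ℝ | p.2 ∈ Icc (Y a) (Y b) ∧ R p.1 ((D ∘ g) p.2)} =
      {p : ℝ × ℝ | ∃ x ∈ Icc a b, R p.1 (D x) ∧ p.2 = Y x} := fun R => by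
    ext ⟨s, y⟩
    constructor
    · rintro ⟨hy, hR⟩
      obtain ⟨x, hx, rfl⟩ := hpar _ hy
      exact ⟨x, hx, by simpa [hg x hx] using hR, rfl⟩
    · rintro ⟨x, hx, hR, rfl⟩
      exact ⟨himg ▸ mem_image_of_mem _ hx, by simpa [hg x hx] using hR⟩
  have hcomp : IsCompact {p : ℝ × ℝ | ∃ x ∈ Icc a b, p.1 ^ 2 ≤ D x ∧ p.2 = Y x} := by
    obtain ⟨M, hM⟩ := (isCompact_Icc.image_of_continuousOn hDc).bddAbove
    have hQ : IsCompact (Icc (-(|M| + 1)) (|M| + 1) ×ˢ Icc a b ∩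
        (fun p : ℝ × ℝ => p.1 ^ 2 - D p.2) ⁻¹' Iic 0) := by
      have hc : ContinuousOn (fun p : ℝ × ℝ => p.1 ^ 2 - D p.2)
          (Icc (-(|M| + 1)) (|M| + 1) ×ˢ Icc a b) :=
        ContinuousOn.sub (by fun_prop) (hDc.comp continuousOn_snd fun p hp => hp.2)
      have hcl := hc.preimage_isClosed_of_isClosed (isClosed_Icc.prod isClosed_Icc)
        (isClosed_Iic (a := (0 : ℝ)))
      exact (isCompact_Icc.prod isCompact_Icc).of_isClosed_subset hcl inter_subset_left
    have hc : ContinuousOn (fun p : ℝ × ℝ => (p.1, Y p.2))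
        (Icc (-(|M| + 1)) (|M| + 1) ×ˢ Icc a b ∩
          (fun p : ℝ × ℝ => p.1 ^ 2 - D p.2) ⁻¹' Iic 0) :=
      continuousOn_fst.prodMk (hYc.comp continuousOn_snd fun p hp => hp.1.2)
    convert hQ.image_of_continuousOn hc using 1
    ext ⟨s, y⟩
    constructor
    · rintro ⟨x, hx, hs, rfl⟩
      have hDM : D x ≤ |M| := (hM (mem_image_of_mem _ hx)).trans (le_abs_self M)
      have hs' : s ^ 2 ≤ D x := hs
      have habs := abs_nonneg M
      refine ⟨(s, x), ⟨⟨⟨?_, ?_⟩, hx⟩, ?_⟩, rfl⟩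
      · show -(|M| + 1) ≤ s
        nlinarith
      · show s ≤ |M| + 1
        nlinarith
      · simpa using hs'
    · rintro ⟨⟨s', x⟩, ⟨⟨_, hx⟩, hs⟩, heq⟩
      obtain ⟨rfl, rfl⟩ := Prod.mk.inj heq
      exact ⟨x, hx, by simpa using hs, rfl⟩
  have hYab : Y a < Y b := hmono hleft hright hab
  obtain ⟨h1, h2, h3⟩ := frontier_region_of_concaveOn hYab hconc
    (by simp [hg a hleft, ha]) (by simp [hg b hright, hb])
    (fun y hy => by
      obtain ⟨x, hx, rfl⟩ := hpar y (Ioo_subset_Icc_self hy)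
      have hxa : a < x := (hmono.lt_iff_lt hleft hx).1 hy.1
      have hxb : x < b := (hmono.lt_iff_lt hx hright).1 hy.2
      simpa [hg x hx] using hpos x ⟨hxa, hxb⟩)
    (hset fun s d => s ^ 2 ≤ d).symm hcomp
  exact ⟨_, hcomp, h1, h2, h3.trans (hset fun s d => s ^ 2 = d)⟩

lemma isEig_Lmat_iff (a b c : ℝ) (l : ℂ) :
    IsEig (Lmat a b c) l ↔
      (l - Complex.I * (((c - a) / 2 : ℝ) : ℂ)) ^ 2 = ((4 * b ^ 2 - (a + c) ^ 2 : ℝ) : ℂ) / 4 := by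
  have h : (Lmat a b c).charpoly.eval l =
      (l - Complex.I * (((c - a) / 2 : ℝ) : ℂ)) ^ 2 -
        ((4 * b ^ 2 - (a + c) ^ 2 : ℝ) : ℂ) / 4 := by
    rw [Matrix.charpoly_fin_two]
    simp [Lmat, Jmat, Bmat, Matrix.trace_fin_two, Matrix.det_fin_two]
    ring_nf
    simp only [Complex.I_sq, show Complex.I ^ 4 = 1 from Complex.I_pow_four]
    ring
  rw [IsEig, Polynomial.IsRoot.def, h, sub_eq_zero]

lemma setOf_sq_sub_eq (w s : ℂ) : {l : ℂ | (l - w) ^ 2 = s ^ 2} = {w + s, w - s} := by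
  ext l
  simp only [mem_ofPred_eq, sq_eq_sq_iff_eq_or_eq_neg, mem_insert_iff, mem_singleton_iff]
  constructor
  · rintro (h | h)
    · exact Or.inl (by linear_combination h)
    · exact Or.inr (by linear_combination h)
  · rintro (h | h)
    · exact Or.inl (by linear_combination h)
    · exact Or.inr (by linear_combination h)

lemma setOf_isEig_of_nonneg {a b c : ℝ} (h : 0 ≤ 4 * b ^ 2 - (a + c) ^ 2) :
    {l : ℂ | IsEig (Lmat a b c) l} =
      {Complex.I * (((c - a) / 2 : ℝ) : ℂ) + ((√(4 * b ^ 2 - (a + c) ^ 2) : ℝ) : ℂ) / 2,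
        Complex.I * (((c - a) / 2 : ℝ) : ℂ) - ((√(4 * b ^ 2 - (a + c) ^ 2) : ℝ) : ℂ) / 2} := by
  rw [← setOf_sq_sub_eq]
  ext l
  rw [mem_ofPred_eq, mem_ofPred_eq, isEig_Lmat_iff, div_pow, ← Complex.ofReal_pow, Real.sq_sqrt h]
  norm_num

lemma setOf_isEig_of_nonpos {a b c : ℝ} (h : 4 * b ^ 2 - (a + c) ^ 2 ≤ 0) :
    {l : ℂ | IsEig (Lmat a b c) l} =
      {Complex.I * (((c - a) / 2 : ℝ) : ℂ) +
          Complex.I * ((√|4 * b ^ 2 - (a + c) ^ 2| : ℝ) : ℂ) / 2,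
        Complex.I * (((c - a) / 2 : ℝ) : ℂ) -
          Complex.I * ((√|4 * b ^ 2 - (a + c) ^ 2| : ℝ) : ℂ) / 2} := by
  rw [← setOf_sq_sub_eq]
  ext l
  rw [mem_ofPred_eq, mem_ofPred_eq, isEig_Lmat_iff, div_pow, mul_pow, ← Complex.ofReal_pow,
    Real.sq_sqrt (abs_nonneg _), Complex.I_sq, abs_of_nonpos h, Complex.ofReal_neg]
  norm_num

lemma re_eq_zero_of_isEig {a b c : ℝ} (h : 4 * b ^ 2 - (a + c) ^ 2 ≤ 0) {l : ℂ}
    (hl : IsEig (Lmat a b c) l) : l.re = 0 := by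
  have h1 : l ∈ {l : ℂ | IsEig (Lmat a b c) l} := hl
  rw [setOf_isEig_of_nonpos h] at h1
  rcases h1 with rfl | rfl <;> simp [mul_div_assoc]

lemma exists_isEig_iff {a b c : ℝ} (h : 0 ≤ 4 * b ^ 2 - (a + c) ^ 2) (p : ℝ × ℝ) :
    (∃ l : ℂ, IsEig (Lmat a b c) l ∧ p = (l.re, l.im)) ↔
      p.1 ^ 2 = (4 * b ^ 2 - (a + c) ^ 2) / 4 ∧ p.2 = (c - a) / 2 := by
  have hs := Real.sq_sqrt h
  have hl : ∀ l : ℂ, IsEig (Lmat a b c) l ↔ _ := fun l =>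
    Set.ext_iff.1 (setOf_isEig_of_nonneg h) l
  simp only [hl]
  set s := √(4 * b ^ 2 - (a + c) ^ 2)
  have hre : ∀ x : ℝ, ((x : ℂ) / 2) = ((x / 2 : ℝ) : ℂ) := fun x => by push_cast; rfl
  constructor
  · rintro ⟨l, rfl | rfl, rfl⟩ <;> rw [hre] <;> simp <;> nlinarith
  · rintro ⟨h1, h2⟩
    have h3 : p.1 ^ 2 = (s / 2) ^ 2 := by rw [h1, ← hs]; ring
    rcases sq_eq_sq_iff_eq_or_eq_neg.1 h3 with h4 | h4
    · exact ⟨_, Or.inl rfl, by rw [hre]; ext <;> simp [h4, h2]⟩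
    · exact ⟨_, Or.inr rfl, by rw [hre]; ext <;> simp [h4, h2]⟩

lemma abs_root_add_le {C x e r : ℝ} (hC : 0 < C) (he : 0 ≤ e) (he1 : e ≤ 1)
    (hr : |r| ≤ C * (e ^ 3 + |x| * e ^ 2 + x ^ 2)) (h0 : 4 / 3 * x + 19 / 16 * e ^ 2 + r = 0)
    (hx : C * |x| ≤ 1 / 6) (hCe : C * e ≤ 1 / 6) :
    |x + 57 / 64 * e ^ 2| ≤ C * (1 + (2 + C) + (2 + C) ^ 2) * e ^ 3 := by
  have e3 : e ^ 3 ≤ e ^ 2 := pow_le_pow_of_le_one he he1 (by norm_num)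
  have e4 : e ^ 4 ≤ e ^ 3 := pow_le_pow_of_le_one he he1 (by norm_num)
  have ee : e ^ 2 ≤ e := by nlinarith
  have hxn := abs_nonneg x
  have hx2 : x ^ 2 = |x| * |x| := by rw [← sq, sq_abs]
  have hxe : |x| ≤ (2 + C) * e ^ 2 := by
    have h1 : |x| ≤ 3 / 4 * (19 / 16 * e ^ 2 + |r|) := by
      have h2 := neg_abs_le r
      have h3 := le_abs_self r
      rw [abs_le]
      constructor <;> nlinarith
    have h4 : C * (|x| * e ^ 2) ≤ 1 / 6 * |x| := by
      have : |x| * e ^ 2 ≤ |x| * e := mul_le_mul_of_nonneg_left ee hxn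
      nlinarith
    have h5 : C * x ^ 2 ≤ 1 / 6 * |x| := by rw [hx2]; nlinarith
    have h6 : C * e ^ 3 ≤ C * e ^ 2 := mul_le_mul_of_nonneg_left e3 hC.le
    nlinarith [sq_nonneg e]
  have hr' : |r| ≤ C * (1 + (2 + C) + (2 + C) ^ 2) * e ^ 3 := by
    have h1 : |x| * e ^ 2 ≤ (2 + C) * e ^ 3 := by
      calc |x| * e ^ 2 ≤ (2 + C) * e ^ 2 * e ^ 2 := by gcongr
        _ = (2 + C) * e ^ 4 := by ring
        _ ≤ (2 + C) * e ^ 3 := by gcongr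
    have h2 : x ^ 2 ≤ (2 + C) ^ 2 * e ^ 3 := by
      calc x ^ 2 = |x| * |x| := hx2
        _ ≤ ((2 + C) * e ^ 2) * ((2 + C) * e ^ 2) := by gcongr
        _ = (2 + C) ^ 2 * e ^ 4 := by ring
        _ ≤ (2 + C) ^ 2 * e ^ 3 := by gcongr
    calc |r| ≤ C * (e ^ 3 + |x| * e ^ 2 + x ^ 2) := hr
      _ ≤ C * (e ^ 3 + (2 + C) * e ^ 3 + (2 + C) ^ 2 * e ^ 3) := by gcongr
      _ = _ := by ring
  have h7 : x + 57 / 64 * e ^ 2 = -(3 / 4) * r := by linarith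
  rw [h7, abs_mul]
  norm_num
  nlinarith [abs_nonneg r]

/-- Expansion of the off-diagonal entry at a distance `ν` from the point `x`. -/
lemma abs_offDiag_sub_le {C K x e ν r : ℝ} (hC : 0 < C) (hK : 0 < K) (he : 0 ≤ e) (he1 : e ≤ 1)
    (hx : |x + 57 / 64 * e ^ 2| ≤ K * e ^ 3)
    (hr : |r| ≤ C * (e ^ 5 + |x + ν| * e ^ 4 + (x + ν) ^ 2 * e ^ 2 + (x + ν) ^ 4 * e)) :
    |(-(√3 / 6) * (x + ν) * e ^ 2 - 39 * √3 / 512 * e ^ 4 + r) -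
        (37 * √3 / 512 * e ^ 4 - √3 / 6 * ν * e ^ 2)| ≤
      (K + C * (1 + (1 + K) + 2 * (1 + K) ^ 2 + 8 * (1 + K) ^ 4) + 8 * C) *
        (e ^ 5 + |ν| * e ^ 4 + ν ^ 2 * e ^ 2 + ν ^ 4 * e) := by
  have e3 : e ^ 3 ≤ e ^ 2 := pow_le_pow_of_le_one he he1 (by norm_num)
  have e6 : e ^ 6 ≤ e ^ 5 := pow_le_pow_of_le_one he he1 (by norm_num)
  have e9 : e ^ 9 ≤ e ^ 5 := pow_le_pow_of_le_one he he1 (by norm_num)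
  set M := 1 + K with hM
  have hMpos : 0 < M := by positivity
  have hxM : |x| ≤ M * e ^ 2 := by
    have h1 : |x| ≤ |x + 57 / 64 * e ^ 2| + 57 / 64 * e ^ 2 := by
      have := abs_sub (x + 57 / 64 * e ^ 2) (57 / 64 * e ^ 2)
      rwa [add_sub_cancel_right, abs_of_nonneg (by positivity : 0 ≤ 57 / 64 * e ^ 2)] at this
    nlinarith [mul_le_mul_of_nonneg_left e3 hK.le, sq_nonneg e]
  have hν := abs_nonneg ν
  have hd : |x + ν| ≤ M * e ^ 2 + |ν| := (abs_add_le _ _).trans (by linarith)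
  have hd2 : (x + ν) ^ 2 ≤ 2 * M ^ 2 * e ^ 4 + 2 * ν ^ 2 := by
    have h1 : (x + ν) ^ 2 ≤ (M * e ^ 2 + |ν|) ^ 2 := by
      rw [← sq_abs]
      gcongr
    nlinarith [sq_nonneg (M * e ^ 2 - |ν|), sq_abs ν]
  have hd4 : (x + ν) ^ 4 ≤ 8 * M ^ 4 * e ^ 8 + 8 * ν ^ 4 := by
    have h1 : ((x + ν) ^ 2) ^ 2 ≤ (2 * M ^ 2 * e ^ 4 + 2 * ν ^ 2) ^ 2 := by gcongr
    nlinarith [sq_nonneg (2 * M ^ 2 * e ^ 4 - 2 * ν ^ 2)]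
  have hr' : |r| ≤ C * (1 + M + 2 * M ^ 2 + 8 * M ^ 4) * e ^ 5 +
      8 * C * (|ν| * e ^ 4 + ν ^ 2 * e ^ 2 + ν ^ 4 * e) := by
    calc |r| ≤ C * (e ^ 5 + |x + ν| * e ^ 4 + (x + ν) ^ 2 * e ^ 2 + (x + ν) ^ 4 * e) := hr
      _ ≤ C * (e ^ 5 + (M * e ^ 2 + |ν|) * e ^ 4 + (2 * M ^ 2 * e ^ 4 + 2 * ν ^ 2) * e ^ 2 +
          (8 * M ^ 4 * e ^ 8 + 8 * ν ^ 4) * e) := by gcongr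
      _ = C * (e ^ 5 + M * e ^ 6 + 2 * M ^ 2 * e ^ 6 + 8 * M ^ 4 * e ^ 9) +
          C * (|ν| * e ^ 4 + 2 * (ν ^ 2 * e ^ 2) + 8 * (ν ^ 4 * e)) := by ring
      _ ≤ C * (e ^ 5 + M * e ^ 5 + 2 * M ^ 2 * e ^ 5 + 8 * M ^ 4 * e ^ 5) +
          C * (8 * (|ν| * e ^ 4) + 8 * (ν ^ 2 * e ^ 2) + 8 * (ν ^ 4 * e)) := by
        have p1 : 0 ≤ |ν| * e ^ 4 := by positivity
        have p2 : 0 ≤ ν ^ 2 * e ^ 2 := by positivity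
        gcongr ?_ + C * ?_
        · gcongr
        · linarith
      _ = _ := by ring
  have h3 : √3 / 6 ≤ 1 := by
    have : √3 ≤ 6 := by rw [Real.sqrt_le_left (by norm_num)]; norm_num
    linarith
  have h3' : |√3 / 6 * (x + 57 / 64 * e ^ 2) * e ^ 2| ≤ K * e ^ 5 := by
    rw [abs_mul, abs_mul, abs_of_nonneg (by positivity : 0 ≤ √3 / 6), abs_of_nonneg (sq_nonneg e)]
    calc √3 / 6 * |x + 57 / 64 * e ^ 2| * e ^ 2 ≤ 1 * (K * e ^ 3) * e ^ 2 := by gcongr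
      _ = K * e ^ 5 := by ring
  have heq : (-(√3 / 6) * (x + ν) * e ^ 2 - 39 * √3 / 512 * e ^ 4 + r) -
      (37 * √3 / 512 * e ^ 4 - √3 / 6 * ν * e ^ 2) =
      r - √3 / 6 * (x + 57 / 64 * e ^ 2) * e ^ 2 := by ring
  rw [heq]
  refine (abs_sub _ _).trans ((add_le_add hr' h3').trans ?_)
  have p1 : 0 ≤ |ν| * e ^ 4 + ν ^ 2 * e ^ 2 + ν ^ 4 * e := by positivity
  have p2 : 0 ≤ e ^ 5 := by positivity
  have p3 : 0 ≤ (K + C * (1 + M + 2 * M ^ 2 + 8 * M ^ 4)) *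
    (|ν| * e ^ 4 + ν ^ 2 * e ^ 2 + ν ^ 4 * e) := by positivity
  nlinarith [mul_nonneg hC.le p2]

/-- The products arising from the remainder terms when the discriminant is expanded. -/
lemma remainder_products_le {n e : ℝ} (hn : 0 ≤ n) (hn1 : n ≤ 1) (he : 0 ≤ e) (he1 : e ≤ 1) :
    e ^ 4 * (e ^ 5 + n * e ^ 4 + n ^ 2 * e ^ 2 + n ^ 4 * e) ≤
        2 * (e ^ 9 + n * e ^ 7 + n ^ 2 * e ^ 2 + n ^ 3) ∧
      n * e ^ 2 * (e ^ 5 + n * e ^ 4 + n ^ 2 * e ^ 2 + n ^ 4 * e) ≤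
        3 * (e ^ 9 + n * e ^ 7 + n ^ 2 * e ^ 2 + n ^ 3) ∧
      (e ^ 5 + n * e ^ 4 + n ^ 2 * e ^ 2 + n ^ 4 * e) ^ 2 ≤
        12 * (e ^ 9 + n * e ^ 7 + n ^ 2 * e ^ 2 + n ^ 3) ∧
      n ^ 2 * e ^ 4 ≤ e ^ 9 + n * e ^ 7 + n ^ 2 * e ^ 2 + n ^ 3 ∧
      n * (n * (n + e ^ 2)) ≤ e ^ 9 + n * e ^ 7 + n ^ 2 * e ^ 2 + n ^ 3 ∧
      (n * (n + e ^ 2)) ^ 2 ≤ 4 * (e ^ 9 + n * e ^ 7 + n ^ 2 * e ^ 2 + n ^ 3) := by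
  have hmono : ∀ i j k l : ℕ, i ≤ j → k ≤ l → n ^ j * e ^ l ≤ n ^ i * e ^ k :=
    fun i j k l hij hkl => mul_le_mul (pow_le_pow_of_le_one hn hn1 hij)
      (pow_le_pow_of_le_one he he1 hkl) (by positivity) (by positivity)
  have z09 : 0 ≤ e ^ 9 := by positivity
  have z17 : 0 ≤ n * e ^ 7 := by positivity
  have z22 : 0 ≤ n ^ 2 * e ^ 2 := by positivity
  have z30 : 0 ≤ n ^ 3 := by positivity
  refine ⟨?_, ?_, ?_, ?_, ?_, ?_⟩
  · have m1 := hmono 1 1 7 8 (by norm_num) (by norm_num)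
    have m2 := hmono 2 2 2 6 (by norm_num) (by norm_num)
    have m3 := hmono 2 4 2 5 (by norm_num) (by norm_num)
    linarith
  · have m1 := hmono 2 2 2 6 (by norm_num) (by norm_num)
    have m2 := hmono 2 3 2 4 (by norm_num) (by norm_num)
    have m3 := hmono 2 5 2 3 (by norm_num) (by norm_num)
    linarith
  · have m0 := hmono 0 0 9 10 (by norm_num) (by norm_num)
    have m1 := hmono 2 2 2 8 (by norm_num) (by norm_num)
    have m2 := hmono 2 4 2 4 (by norm_num) (by norm_num)
    have m3 := hmono 2 8 2 2 (by norm_num) (by norm_num)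
    have hsq : (e ^ 5 + n * e ^ 4 + n ^ 2 * e ^ 2 + n ^ 4 * e) ^ 2 ≤
        4 * ((e ^ 5) ^ 2 + (n * e ^ 4) ^ 2 + (n ^ 2 * e ^ 2) ^ 2 + (n ^ 4 * e) ^ 2) := by
      generalize e ^ 5 = a
      generalize n * e ^ 4 = b
      generalize n ^ 2 * e ^ 2 = c
      generalize n ^ 4 * e = d
      linarith [sq_nonneg (a - b), sq_nonneg (a - c), sq_nonneg (a - d), sq_nonneg (b - c),
        sq_nonneg (b - d), sq_nonneg (c - d)]
    linarith
  · have m1 := hmono 2 2 2 4 (by norm_num) (by norm_num)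
    linarith
  · linarith
  · have m1 := hmono 3 4 0 0 (by norm_num) (by norm_num)
    have m2 := hmono 2 2 2 4 (by norm_num) (by norm_num)
    have m3 := hmono 2 3 2 2 (by norm_num) (by norm_num)
    linarith

/-- Expansion of the discriminant, given those of the off-diagonal entry and of the trace. -/
lemma abs_discriminant_sub_le {K e ν b T : ℝ} (hK : 0 < K) (he : 0 ≤ e) (he1 : e ≤ 1)
    (hν1 : |ν| ≤ 1)
    (hb : |b - (37 * √3 / 512 * e ^ 4 - √3 / 6 * ν * e ^ 2)| ≤
      K * (e ^ 5 + |ν| * e ^ 4 + ν ^ 2 * e ^ 2 + ν ^ 4 * e))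
    (hT : |T - 4 / 3 * ν| ≤ K * |ν| * (|ν| + e ^ 2)) :
    |(4 * b ^ 2 - T ^ 2) -
        (4107 / 65536 * e ^ 8 - 16 / 9 * ν ^ 2 - 37 / 128 * ν * e ^ 6)| ≤
      (100 + 100 * K + 100 * K ^ 2) * (e ^ 9 + |ν| * e ^ 7 + ν ^ 2 * e ^ 2 + |ν| ^ 3) := by
  obtain ⟨E, rfl⟩ : ∃ E, b = 37 * √3 / 512 * e ^ 4 - √3 / 6 * ν * e ^ 2 + E :=
    ⟨_, (add_sub_cancel _ _).symm⟩
  obtain ⟨R, rfl⟩ : ∃ R, T = 4 / 3 * ν + R := ⟨_, (add_sub_cancel _ _).symm⟩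
  rw [add_sub_cancel_left] at hb hT
  have h3 : √3 ^ 2 = 3 := Real.sq_sqrt (by norm_num)
  have h3' : √3 ≤ 2 := by rw [Real.sqrt_le_left (by norm_num)]; norm_num
  have hs : 0 ≤ √3 := Real.sqrt_nonneg 3
  have hν2 : ν ^ 2 = |ν| ^ 2 := (sq_abs ν).symm
  have hν4 : ν ^ 4 = |ν| ^ 4 := by rw [show ν ^ 4 = (ν ^ 2) ^ 2 by ring, hν2]; ring
  have hn := abs_nonneg ν
  rw [hν4, hν2] at hb
  have heq : (4 * (37 * √3 / 512 * e ^ 4 - √3 / 6 * ν * e ^ 2 + E) ^ 2 - (4 / 3 * ν + R) ^ 2) -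
        (4107 / 65536 * e ^ 8 - 16 / 9 * ν ^ 2 - 37 / 128 * ν * e ^ 6) =
      8 * (37 * √3 / 512 * e ^ 4 * E) + (-(8 * (√3 / 6 * ν * e ^ 2 * E))) + 4 * E ^ 2
        + 1 / 3 * (ν ^ 2 * e ^ 4) + (-(8 / 3 * ν * R)) + (-R ^ 2) := by
    linear_combination (37 ^ 2 * e ^ 8 / 65536 - 37 * e ^ 6 * ν / 384 + ν ^ 2 * e ^ 4 / 9) * h3
  rw [heq]
  conv_rhs => rw [hν2]
  obtain ⟨q1, q2, q3, q4, q5, q6⟩ := remainder_products_le hn hν1 he he1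
  have hQ : 0 ≤ e ^ 9 + |ν| * e ^ 7 + |ν| ^ 2 * e ^ 2 + |ν| ^ 3 := by positivity
  have hP : 0 ≤ e ^ 5 + |ν| * e ^ 4 + |ν| ^ 2 * e ^ 2 + |ν| ^ 4 * e := by positivity
  generalize e ^ 9 + |ν| * e ^ 7 + |ν| ^ 2 * e ^ 2 + |ν| ^ 3 = Q at *
  generalize e ^ 5 + |ν| * e ^ 4 + |ν| ^ 2 * e ^ 2 + |ν| ^ 4 * e = P at *
  have t1 : |8 * (37 * √3 / 512 * e ^ 4 * E)| ≤ 4 * K * Q := by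
    rw [abs_mul, abs_mul, abs_of_nonneg (by norm_num : (0 : ℝ) ≤ 8),
      abs_of_nonneg (by positivity : 0 ≤ 37 * √3 / 512 * e ^ 4)]
    calc 8 * (37 * √3 / 512 * e ^ 4 * |E|) ≤ 8 * (37 * 2 / 512 * e ^ 4 * (K * P)) := by gcongr
      _ = 8 * 37 * 2 / 512 * K * (e ^ 4 * P) := by ring
      _ ≤ 8 * 37 * 2 / 512 * K * (2 * Q) := by gcongr
      _ ≤ 4 * K * Q := by nlinarith [mul_nonneg hK.le hQ]
  have t2 : |-(8 * (√3 / 6 * ν * e ^ 2 * E))| ≤ 24 * K * Q := by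
    rw [abs_neg, abs_mul, abs_mul, abs_mul, abs_mul, abs_of_nonneg (by norm_num : (0 : ℝ) ≤ 8),
      abs_of_nonneg (by positivity : 0 ≤ √3 / 6), abs_of_nonneg (sq_nonneg e)]
    calc 8 * (√3 / 6 * |ν| * e ^ 2 * |E|) ≤ 8 * (2 / 6 * |ν| * e ^ 2 * (K * P)) := by gcongr
      _ = 8 * 2 / 6 * K * (|ν| * e ^ 2 * P) := by ring
      _ ≤ 8 * 2 / 6 * K * (3 * Q) := by gcongr
      _ ≤ 24 * K * Q := by nlinarith [mul_nonneg hK.le hQ]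
  have t3 : |4 * E ^ 2| ≤ 48 * K ^ 2 * Q := by
    rw [abs_of_nonneg (by positivity), ← sq_abs E]
    calc 4 * |E| ^ 2 ≤ 4 * (K * P) ^ 2 := by gcongr
      _ = 4 * K ^ 2 * P ^ 2 := by ring
      _ ≤ 4 * K ^ 2 * (12 * Q) := by gcongr
      _ = 48 * K ^ 2 * Q := by ring
  have t4 : |1 / 3 * (ν ^ 2 * e ^ 4)| ≤ Q := by
    rw [abs_of_nonneg (by positivity), hν2]
    have : 0 ≤ |ν| ^ 2 * e ^ 4 := by positivity
    linarith
  have t5 : |-(8 / 3 * ν * R)| ≤ 3 * K * Q := by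
    rw [abs_neg, abs_mul, abs_mul, abs_of_nonneg (by norm_num : (0 : ℝ) ≤ 8 / 3)]
    calc 8 / 3 * |ν| * |R| ≤ 8 / 3 * |ν| * (K * |ν| * (|ν| + e ^ 2)) := by gcongr
      _ = 8 / 3 * K * (|ν| * (|ν| * (|ν| + e ^ 2))) := by ring
      _ ≤ 8 / 3 * K * Q := by gcongr
      _ ≤ 3 * K * Q := by nlinarith [mul_nonneg hK.le hQ]
  have t6 : |-R ^ 2| ≤ 4 * K ^ 2 * Q := by
    rw [abs_neg, abs_of_nonneg (by positivity), ← sq_abs R]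
    calc |R| ^ 2 ≤ (K * |ν| * (|ν| + e ^ 2)) ^ 2 := by gcongr
      _ = K ^ 2 * (|ν| * (|ν| + e ^ 2)) ^ 2 := by ring
      _ ≤ K ^ 2 * (4 * Q) := by gcongr
      _ = 4 * K ^ 2 * Q := by ring
  have a1 := abs_add_le (8 * (37 * √3 / 512 * e ^ 4 * E) + (-(8 * (√3 / 6 * ν * e ^ 2 * E))) +
    4 * E ^ 2 + 1 / 3 * (ν ^ 2 * e ^ 4) + (-(8 / 3 * ν * R))) (-R ^ 2)
  have a2 := abs_add_le (8 * (37 * √3 / 512 * e ^ 4 * E) + (-(8 * (√3 / 6 * ν * e ^ 2 * E))) +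
    4 * E ^ 2 + 1 / 3 * (ν ^ 2 * e ^ 4)) (-(8 / 3 * ν * R))
  have a3 := abs_add_le (8 * (37 * √3 / 512 * e ^ 4 * E) + (-(8 * (√3 / 6 * ν * e ^ 2 * E))) +
    4 * E ^ 2) (1 / 3 * (ν ^ 2 * e ^ 4))
  have a4 := abs_add_three (8 * (37 * √3 / 512 * e ^ 4 * E)) (-(8 * (√3 / 6 * ν * e ^ 2 * E)))
    (4 * E ^ 2)
  have := mul_nonneg hK.le hQ
  have := mul_nonneg (sq_nonneg K) hQ
  linarith

/-- Location of the two zeros of the discriminant. -/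
lemma abs_crossing_sub_le {K e ν b T σ : ℝ} (hK : 0 < K) (he : 0 ≤ e) (he1 : e ≤ 1 / 10)
    (hKe : K * e ≤ 1 / 100) (hν1 : |ν| ≤ 1) (hKν : K * |ν| ≤ 1 / 100) (hσ : σ = 1 ∨ σ = -1)
    (hb : |b - (37 * √3 / 512 * e ^ 4 - √3 / 6 * ν * e ^ 2)| ≤
      K * (e ^ 5 + |ν| * e ^ 4 + ν ^ 2 * e ^ 2 + ν ^ 4 * e))
    (hT : |T - 4 / 3 * ν| ≤ K * |ν| * (|ν| + e ^ 2)) (h0 : T = 2 * σ * b) :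
    |ν - σ * (111 * √3 / 1024 * e ^ 4)| ≤ (1 + 20 * K) * e ^ 5 := by
  obtain ⟨E, rfl⟩ : ∃ E, b = 37 * √3 / 512 * e ^ 4 - √3 / 6 * ν * e ^ 2 + E :=
    ⟨_, (add_sub_cancel _ _).symm⟩
  obtain ⟨R, rfl⟩ : ∃ R, T = 4 / 3 * ν + R := ⟨_, (add_sub_cancel _ _).symm⟩
  rw [add_sub_cancel_left] at hb hT
  have h3' : √3 ≤ 2 := by rw [Real.sqrt_le_left (by norm_num)]; norm_num
  have hs : 0 ≤ √3 := Real.sqrt_nonneg 3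
  have hν2 : ν ^ 2 = |ν| ^ 2 := (sq_abs ν).symm
  have hν4 : ν ^ 4 = |ν| ^ 4 := by rw [show ν ^ 4 = (ν ^ 2) ^ 2 by ring, hν2]; ring
  rw [hν4, hν2] at hb
  have hn := abs_nonneg ν
  have hσa : |σ| = 1 := by rcases hσ with rfl | rfl <;> simp
  have heq : ν - σ * (111 * √3 / 1024 * e ^ 4) =
      3 / 4 * (2 * (σ * E) - 2 * (σ * (√3 / 6 * ν * e ^ 2)) - R) := by linarith
  have hbound : |2 * (σ * E) - 2 * (σ * (√3 / 6 * ν * e ^ 2)) - R| ≤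
      2 * |E| + 2 / 3 * |ν| * e ^ 2 + |R| := by
    refine (abs_sub _ _).trans (add_le_add ((abs_sub _ _).trans (add_le_add ?_ ?_)) le_rfl)
    · rw [abs_mul, abs_mul, hσa, abs_two, one_mul]
    · rw [abs_mul, abs_mul, hσa, abs_two, one_mul, abs_mul, abs_mul,
        abs_of_nonneg (by positivity : 0 ≤ √3 / 6), abs_of_nonneg (sq_nonneg e)]
      have : √3 / 6 * |ν| * e ^ 2 ≤ 2 / 6 * |ν| * e ^ 2 := by gcongr
      linarith
  have hdist : |ν - σ * (111 * √3 / 1024 * e ^ 4)| ≤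
      3 / 4 * (2 * |E| + 2 / 3 * |ν| * e ^ 2 + |R|) := by
    rw [heq, abs_mul, abs_of_nonneg (by norm_num : (0 : ℝ) ≤ 3 / 4)]
    gcongr
  have e2 : e ^ 2 ≤ 1 / 100 := by nlinarith
  have e1 : e ≤ 1 := by linarith
  have hmono : ∀ k l : ℕ, k ≤ l → e ^ l ≤ e ^ k := fun k l hkl =>
    pow_le_pow_of_le_one he e1 hkl
  have hsmall : |ν| ≤ e ^ 4 := by
    have hν : |ν| ≤ |ν - σ * (111 * √3 / 1024 * e ^ 4)| + 1 / 4 * e ^ 4 := by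
      have h1 := abs_add_le (ν - σ * (111 * √3 / 1024 * e ^ 4)) (σ * (111 * √3 / 1024 * e ^ 4))
      rw [sub_add_cancel, abs_mul σ, hσa, one_mul,
        abs_of_nonneg (by positivity : 0 ≤ 111 * √3 / 1024 * e ^ 4)] at h1
      have h2 : 111 * √3 / 1024 * e ^ 4 ≤ 1 / 4 * e ^ 4 :=
        mul_le_mul_of_nonneg_right (by linarith) (by positivity)
      linarith
    have f1 : K * e ^ 5 ≤ 1 / 100 * e ^ 4 := by
      calc K * e ^ 5 = K * e * e ^ 4 := by ring
        _ ≤ 1 / 100 * e ^ 4 := by gcongr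
    have hKν' : ∀ k l : ℕ, 1 ≤ k → 1 ≤ l → K * (|ν| ^ k * e ^ l) ≤ 1 / 100 * |ν| :=
      fun k l hk hl => by
        have g1 : |ν| ^ k ≤ |ν| := pow_le_of_le_one hn hν1 (by lia)
        have g2 : e ^ l ≤ e := pow_le_of_le_one he e1 (by lia)
        calc K * (|ν| ^ k * e ^ l) ≤ K * (|ν| * e) := by gcongr
          _ = K * e * |ν| := by ring
          _ ≤ 1 / 100 * |ν| := by gcongr
    have f2 := hKν' 1 4 le_rfl (by norm_num)
    have f3 := hKν' 2 2 (by norm_num) (by norm_num)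
    have f4 := hKν' 4 1 (by norm_num) le_rfl
    have f5 := hKν' 1 2 le_rfl (by norm_num)
    have f6 : K * |ν| * |ν| ≤ 1 / 100 * |ν| := by gcongr
    have f7 : |ν| * e ^ 2 ≤ |ν| * (1 / 100) := by gcongr
    rw [pow_one] at f2 f4 f5
    have hE : |E| ≤ 1 / 100 * e ^ 4 + 3 / 100 * |ν| := by linarith
    have hR : |R| ≤ 2 / 100 * |ν| := by linarith
    have := pow_nonneg he 4
    linarith
  have hE : |E| ≤ K * (4 * e ^ 5) := by
    refine hb.trans (mul_le_mul_of_nonneg_left ?_ hK.le)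
    have g1 : |ν| * e ^ 4 ≤ e ^ 5 := by
      calc |ν| * e ^ 4 ≤ e ^ 4 * e ^ 4 := by gcongr
        _ = e ^ 8 := by ring
        _ ≤ e ^ 5 := hmono 5 8 (by norm_num)
    have g2 : |ν| ^ 2 * e ^ 2 ≤ e ^ 5 := by
      calc |ν| ^ 2 * e ^ 2 ≤ (e ^ 4) ^ 2 * e ^ 2 := by gcongr
        _ = e ^ 10 := by ring
        _ ≤ e ^ 5 := hmono 5 10 (by norm_num)
    have g3 : |ν| ^ 4 * e ≤ e ^ 5 := by
      calc |ν| ^ 4 * e ≤ (e ^ 4) ^ 4 * e := by gcongr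
        _ = e ^ 17 := by ring
        _ ≤ e ^ 5 := hmono 5 17 (by norm_num)
    linarith
  have hνe : |ν| * e ^ 2 ≤ e ^ 5 := by
    calc |ν| * e ^ 2 ≤ e ^ 4 * e ^ 2 := by gcongr
      _ = e ^ 6 := by ring
      _ ≤ e ^ 5 := hmono 5 6 (by norm_num)
  have hR : |R| ≤ K * (2 * e ^ 5) := by
    have g1 : |ν| * |ν| ≤ e ^ 5 := by
      calc |ν| * |ν| ≤ e ^ 4 * e ^ 4 := by gcongr
        _ = e ^ 8 := by ring
        _ ≤ e ^ 5 := hmono 5 8 (by norm_num)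
    calc |R| ≤ K * |ν| * (|ν| + e ^ 2) := hT
      _ = K * (|ν| * |ν| + |ν| * e ^ 2) := by ring
      _ ≤ K * (2 * e ^ 5) := mul_le_mul_of_nonneg_left (by linarith) hK.le
  have := mul_nonneg hK.le (pow_nonneg he 5)
  have := pow_nonneg he 5
  linarith

lemma exists_box_estimates {T b Y : ℝ × ℝ → ℝ} (hT : AnalyticAt ℝ T (0, 0))
    (hb : AnalyticAt ℝ b (0, 0)) (hY : AnalyticAt ℝ Y (0, 0)) (hT0 : T (0, 0) = 0)
    (hb0 : b (0, 0) = 0) (hT1 : partialFst T (0, 0) = 4 / 3) (hb1 : partialFst b (0, 0) = 0)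
    (hY1 : partialFst Y (0, 0) = 4 / 3) :
    ∃ h : ℝ × ℝ → ℝ, ∀ᶠ p in 𝓝 ((0 : ℝ), (0 : ℝ)),
      AnalyticAt ℝ T p ∧ AnalyticAt ℝ b p ∧ AnalyticAt ℝ Y p ∧ AnalyticAt ℝ h p ∧
      5 / 4 ≤ partialFst T p ∧ |partialFst b p| ≤ 1 / 8 ∧ 1 ≤ partialFst Y p ∧
      h p * partialFst Y p = 8 * b p * partialFst b p - 2 * T p * partialFst T p ∧
      partialFst h p ≤ 0 := by
  set h : ℝ × ℝ → ℝ := fun p =>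
    (8 * b p * partialFst b p - 2 * T p * partialFst T p) / partialFst Y p with hh
  have hha : AnalyticAt ℝ h (0, 0) :=
    AnalyticAt.div (((analyticAt_const.mul hb).mul hb.partialFst).sub
      ((analyticAt_const.mul hT).mul hT.partialFst)) hY.partialFst (by rw [hY1]; norm_num)
  have hh1 : partialFst h (0, 0) = -8 / 3 := by
    have hd := ((((hasDerivAt_partialFst hb).const_mul 8).mul
      (hasDerivAt_partialFst hb.partialFst)).sub
      (((hasDerivAt_partialFst hT).const_mul 2).mul
      (hasDerivAt_partialFst hT.partialFst))).div (hasDerivAt_partialFst hY.partialFst)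
      (by rw [hY1]; norm_num)
    refine ((hasDerivAt_partialFst hha).unique hd).trans ?_
    simp only [hT0, hb0, hT1, hb1, hY1, Pi.mul_apply, Pi.sub_apply]
    norm_num
  refine ⟨h, ?_⟩
  have cT := hT.partialFst.continuousAt.eventually_const_lt
    (show 5 / 4 < partialFst T (0, 0) by rw [hT1]; norm_num)
  have cb := hb.partialFst.continuousAt.abs.eventually_lt_const
    (show |partialFst b (0, 0)| < 1 / 8 by rw [hb1]; norm_num)
  have cY := hY.partialFst.continuousAt.eventually_const_lt
    (show 1 < partialFst Y (0, 0) by rw [hY1]; norm_num)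
  have ch := hha.partialFst.continuousAt.eventually_lt_const
    (show partialFst h (0, 0) < 0 by rw [hh1]; norm_num)
  filter_upwards [hT.eventually_analyticAt, hb.eventually_analyticAt, hY.eventually_analyticAt,
    hha.eventually_analyticAt, cT, cb, cY, ch] with p h1 h2 h3 h4 h5 h6 h7 h8
  refine ⟨h1, h2, h3, h4, h5.le, h6.le, h7.le, ?_, h8.le⟩
  rw [hh]
  exact div_mul_cancel₀ _ (by linarith)

lemma sub_le_image_sub_of_one_le_deriv {η : ℝ} {f f' : ℝ → ℝ}
    (hf : ∀ x, |x| < η → HasDerivAt f (f' x) x) (hf' : ∀ x, |x| < η → 1 ≤ f' x) {x y : ℝ}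
    (hx : |x| < η) (hy : |y| < η) (hxy : x ≤ y) : y - x ≤ f y - f x := by
  have hI : ∀ z ∈ interior (Ioo (-η) η), |z| < η := fun z hz => by
    have hz' : z ∈ Ioo (-η) η := interior_subset hz
    exact abs_lt.2 hz'
  have h := (convex_Ioo (-η) η).mul_sub_le_image_sub_of_le_deriv (f := f) (C := 1)
    (fun z hz => (hf z (abs_lt.2 hz)).continuousAt.continuousWithinAt)
    (fun z hz => (hf z (hI z hz)).differentiableAt.differentiableWithinAt)
    (fun z hz => by
      rw [(hf z (hI z hz)).deriv]
      exact hf' z (hI z hz)) x (abs_lt.1 hx) y (abs_lt.1 hy) hxy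
  linarith

lemma abs_image_sub_le_of_partial_le {η K e : ℝ} (hK : 0 < K) {r r' : ℝ → ℝ}
    (hr : ∀ x, |x| < η → HasDerivAt r (r' x) x)
    (hr' : ∀ x, |x| < η → |r' x| ≤ K * (|x| + e ^ 2)) {x ν : ℝ} (hx : |x| < η)
    (hxν : |x + ν| < η) : |r (x + ν) - r x| ≤ K * (|x| + |ν| + e ^ 2) * |ν| := by
  have hw : ∀ w ∈ uIcc x (x + ν), |w| < η ∧ |w| ≤ |x| + |ν| := fun w hw => by
    constructor
    · exact abs_lt.2 ((convex_Ioo (-η) η).ordConnected.uIcc_subset (abs_lt.1 hx) (abs_lt.1 hxν) hw)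
    · have h1 := abs_sub_left_of_mem_uIcc hw
      rw [add_sub_cancel_left] at h1
      have h2 := abs_sub_abs_le_abs_sub w x
      linarith
  have h := (convex_uIcc x (x + ν)).norm_image_sub_le_of_norm_hasDerivWithin_le
    (f := r) (f' := r') (C := K * (|x| + |ν| + e ^ 2))
    (fun w hw' => (hr w (hw w hw').1).hasDerivWithinAt)
    (fun w hw' => (hr' w (hw w hw').1).trans (by
      have := (hw w hw').2
      gcongr)) left_mem_uIcc right_mem_uIcc
  simpa using h

lemma discriminant_sign {η : ℝ} {T b T' b' : ℝ → ℝ}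
    (hT : ∀ x, |x| < η → HasDerivAt T (T' x) x) (hb : ∀ x, |x| < η → HasDerivAt b (b' x) x)
    (hT' : ∀ x, |x| < η → 5 / 4 ≤ T' x) (hb' : ∀ x, |x| < η → |b' x| ≤ 1 / 8)
    {x₀ xp xm : ℝ} (hx₀ : |x₀| < η) (hxp : |xp| < η) (hxm : |xm| < η) (h₀ : T x₀ = 0)
    (hp : T xp + 2 * b xp = 0) (hm : T xm - 2 * b xm = 0) (hb₀ : 0 ≤ b x₀) :
    xp ≤ x₀ ∧ x₀ ≤ xm ∧ (0 < b x₀ → xp < xm) ∧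
      (∀ x, |x| < η → xp < x → x < xm → 0 < 4 * b x ^ 2 - T x ^ 2) ∧
      ∀ x, |x| < η → x ≤ xp ∨ xm ≤ x → 4 * b x ^ 2 - T x ^ 2 ≤ 0 := by
  have hP : ∀ x y, |x| < η → |y| < η → x ≤ y →
      y - x ≤ (T y + 2 * b y) - (T x + 2 * b x) := fun x y hx hy hxy =>
    sub_le_image_sub_of_one_le_deriv (f := fun z => T z + 2 * b z)
      (f' := fun z => T' z + 2 * b' z)
      (fun z hz => (hT z hz).add ((hb z hz).const_mul 2))
      (fun z hz => by linarith [hT' z hz, (abs_le.1 (hb' z hz)).1]) hx hy hxy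
  have hM : ∀ x y, |x| < η → |y| < η → x ≤ y →
      y - x ≤ (T y - 2 * b y) - (T x - 2 * b x) := fun x y hx hy hxy =>
    sub_le_image_sub_of_one_le_deriv (f := fun z => T z - 2 * b z)
      (f' := fun z => T' z - 2 * b' z)
      (fun z hz => (hT z hz).sub ((hb z hz).const_mul 2))
      (fun z hz => by linarith [hT' z hz, (abs_le.1 (hb' z hz)).2]) hx hy hxy
  have hfac : ∀ x, 4 * b x ^ 2 - T x ^ 2 = (T x + 2 * b x) * -(T x - 2 * b x) :=
    fun x => by ring
  have h1 : xp ≤ x₀ := by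
    by_contra! h
    linarith [hP _ _ hx₀ hxp h.le]
  have h2 : x₀ ≤ xm := by
    by_contra! h
    linarith [hM _ _ hxm hx₀ h.le]
  refine ⟨h1, h2, fun h => ?_, fun x hx hpx hxm' => ?_, fun x hx hx' => ?_⟩
  · refine lt_of_le_of_ne (h1.trans h2) fun heq => ?_
    have h3 : x₀ = xp := le_antisymm (heq ▸ h2) h1
    rw [← h3] at hp
    linarith
  · rw [hfac]
    exact mul_pos (by linarith [hP _ _ hxp hx hpx.le]) (by linarith [hM _ _ hx hxm hxm'.le])
  · rw [hfac]
    rcases hx' with h | h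
    · exact mul_nonpos_of_nonpos_of_nonneg (by linarith [hP _ _ hx hxp h])
        (by linarith [hM _ _ hx hxm (h.trans (h1.trans h2))])
    · exact mul_nonpos_of_nonneg_of_nonpos
        (by linarith [hP _ _ hxp hx ((h1.trans h2).trans h)])
        (by linarith [hM _ _ hxm hx h])

/-- If the zeros of `T + 2 b` and `T - 2 b` bound an interval on which `4 b² - T²` is positive and
the derivative of `4 b² - T²` with respect to `Y` is decreasing, then the curve
`(± √(4 b² - T²) / 2, Y)` is the boundary of a convex body. -/
lemma exists_convex_frontier_of_discriminant {η : ℝ} {T b Y h T' b' Y' h' : ℝ → ℝ}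
    (hT : ∀ x, |x| < η → HasDerivAt T (T' x) x) (hb : ∀ x, |x| < η → HasDerivAt b (b' x) x)
    (hY : ∀ x, |x| < η → HasDerivAt Y (Y' x) x) (hh : ∀ x, |x| < η → HasDerivAt h (h' x) x)
    (hY' : ∀ x, |x| < η → 1 ≤ Y' x) (hh' : ∀ x, |x| < η → h' x ≤ 0)
    (heq : ∀ x, |x| < η → h x * Y' x = 8 * b x * b' x - 2 * T x * T' x)
    {xp xm : ℝ} (hxp : |xp| < η) (hxm : |xm| < η) (hlt : xp < xm)
    (hp : T xp + 2 * b xp = 0) (hm : T xm - 2 * b xm = 0)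
    (hpos : ∀ x, |x| < η → xp < x → x < xm → 0 < 4 * b x ^ 2 - T x ^ 2) :
    ∃ K : Set (ℝ × ℝ), IsCompact K ∧ Convex ℝ K ∧ (interior K).Nonempty ∧
      frontier K = {p : ℝ × ℝ | ∃ x ∈ Icc xp xm,
        p.1 ^ 2 = (4 * b x ^ 2 - T x ^ 2) / 4 ∧ p.2 = Y x} := by
  have hI : ∀ x ∈ Icc xp xm, |x| < η := fun x hx =>
    abs_lt.2 ⟨(abs_lt.1 hxp).1.trans_le hx.1, hx.2.trans_lt (abs_lt.1 hxm).2⟩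
  refine exists_convex_frontier_eq (h := fun x => h x / 4) (Y' := Y')
    (D := fun x => (4 * b x ^ 2 - T x ^ 2) / 4) hlt (fun x hx => hY x (hI x hx))
    (fun x hx => by linarith [hY' x (hI x hx)]) (fun x hx => ?_) ?_ ?_ ?_ (fun x hx => ?_)
  · have hd := ((((hb x (hI x hx)).pow 2).const_mul 4).sub ((hT x (hI x hx)).pow 2)).div_const 4
    refine hd.congr_deriv ?_
    have := heq x (hI x hx)
    push_cast
    linarith
  · have ha : AntitoneOn h (Icc xp xm) :=
      antitoneOn_of_deriv_nonpos (convex_Icc xp xm)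
        (fun x hx => (hh x (hI x hx)).continuousAt.continuousWithinAt)
        (fun x hx =>
          (hh x (hI x (interior_subset hx))).differentiableAt.differentiableWithinAt)
        (fun x hx => by
          rw [(hh x (hI x (interior_subset hx))).deriv]
          exact hh' x (hI x (interior_subset hx)))
    exact fun x hx y hy hxy => div_le_div_of_nonneg_right (ha hx hy hxy) (by norm_num)
  · rw [show T xp = -(2 * b xp) by linarith]
    ring
  · rw [show T xm = 2 * b xm by linarith]
    ring
  · exact div_pos (hpos x (hI x (Ioo_subset_Icc_self hx)) hx.1 hx.2) (by norm_num)

/-- Uniform estimates, on a line `e = const`, for the trace-type, off-diagonal and mean entries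
recentred at the zero `x₀` of the trace. -/
lemma exists_recentred_estimates {C L : ℝ} (hC : 0 < C) (hL : 0 < L) :
    ∃ K > 0, ∀ (η e x₀ : ℝ) (r₁ r₂ r₃ : ℝ → ℝ), 0 ≤ e → e ≤ 1 → 12 * (C * |x₀|) ≤ 1 →
      12 * (C * e) ≤ 1 → |x₀| < η →
      (∀ x, |x| < η → |r₁ x| ≤ C * (e ^ 3 + |x| * e ^ 2 + x ^ 2)) →
      (∀ x, |x| < η → |r₃ x| ≤ C * (e ^ 3 + |x| * e ^ 2 + x ^ 2)) →
      (∀ x, |x| < η → |r₂ x| ≤ C * (e ^ 5 + |x| * e ^ 4 + x ^ 2 * e ^ 2 + x ^ 4 * e)) →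
      (∀ ν, |x₀ + ν| < η → |(r₃ (x₀ + ν) - r₁ (x₀ + ν)) - (r₃ x₀ - r₁ x₀)| ≤
        L * (|x₀| + |ν| + e ^ 2) * |ν|) →
      4 / 3 * x₀ + 19 / 16 * e ^ 2 + (r₃ x₀ - r₁ x₀) = 0 →
      |x₀ + 57 / 64 * e ^ 2| ≤ K * e ^ 3 ∧ ∀ ν, |x₀ + ν| < η →
        |(-(√3 / 6) * (x₀ + ν) * e ^ 2 - 39 * √3 / 512 * e ^ 4 + r₂ (x₀ + ν)) -
          (37 * √3 / 512 * e ^ 4 - √3 / 6 * ν * e ^ 2)| ≤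
            K * (e ^ 5 + |ν| * e ^ 4 + ν ^ 2 * e ^ 2 + ν ^ 4 * e) ∧
        |(4 / 3 * (x₀ + ν) + 19 / 16 * e ^ 2 + (r₃ (x₀ + ν) - r₁ (x₀ + ν))) - 4 / 3 * ν| ≤
          K * |ν| * (|ν| + e ^ 2) ∧
        |(3 / 4 + 4 / 3 * (x₀ + ν) - 17 / 32 * e ^ 2 + (r₁ (x₀ + ν) + r₃ (x₀ + ν)) / 2) -
          (3 / 4 + 4 / 3 * ν - 55 / 32 * e ^ 2)| ≤ K * (e ^ 3 + |ν| * e ^ 2 + ν ^ 2) := by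
  obtain ⟨M, hM, hMdef⟩ : ∃ M > 0, M = 2 * C * (1 + (2 + 2 * C) + (2 + 2 * C) ^ 2) :=
    ⟨_, by positivity, rfl⟩
  obtain ⟨N, hN, hNdef⟩ : ∃ N > 0,
      N = M + C * (1 + (1 + M) + 2 * (1 + M) ^ 2 + 8 * (1 + M) ^ 4) + 8 * C :=
    ⟨_, by positivity, rfl⟩
  obtain ⟨P, hP, hPdef⟩ : ∃ P > 0, P = L * (2 + M) := ⟨_, by positivity, rfl⟩
  obtain ⟨Q, hQ, hQdef⟩ : ∃ Q > 0,
      Q = 4 / 3 * M + C * (1 + (1 + M) + 2 * (1 + M) ^ 2) + 2 * C :=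
    ⟨_, by positivity, rfl⟩
  refine ⟨M + N + P + Q, by positivity, ?_⟩
  intro η e x₀ r₁ r₂ r₃ he he1 hCx hCe hx₀ hr₁ hr₃ hr₂ hlip h0
  have e3 : e ^ 3 ≤ e ^ 2 := pow_le_pow_of_le_one he he1 (by norm_num)
  have e4 : e ^ 4 ≤ e ^ 3 := pow_le_pow_of_le_one he he1 (by norm_num)
  have hx : |x₀ + 57 / 64 * e ^ 2| ≤ M * e ^ 3 := by
    rw [hMdef]
    refine abs_root_add_le (r := r₃ x₀ - r₁ x₀) (by positivity) he he1 ?_ h0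
      (by linarith) (by linarith)
    have h1 := hr₁ x₀ hx₀
    have h3 := hr₃ x₀ hx₀
    linarith [abs_sub (r₃ x₀) (r₁ x₀)]
  have hxM : |x₀| ≤ (1 + M) * e ^ 2 := by
    have h1 := abs_sub (x₀ + 57 / 64 * e ^ 2) (57 / 64 * e ^ 2)
    rw [add_sub_cancel_right, abs_of_nonneg (by positivity : 0 ≤ 57 / 64 * e ^ 2)] at h1
    have h2 : M * e ^ 3 ≤ M * e ^ 2 := by gcongr
    have := sq_nonneg e
    linarith
  have hmono : ∀ {a K' s : ℝ}, a ≤ K' * s → K' ≤ M + N + P + Q → 0 ≤ s →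
      a ≤ (M + N + P + Q) * s := fun h hK hs =>
    h.trans (mul_le_mul_of_nonneg_right hK hs)
  refine ⟨hmono hx (by linarith) (by positivity), fun ν hν => ⟨?_, ?_, ?_⟩⟩
  · refine hmono (K' := N) ?_ (by linarith) (by positivity)
    rw [hNdef]
    exact abs_offDiag_sub_le hC hM he he1 hx (hr₂ _ hν)
  · rw [mul_assoc]
    refine hmono (K' := P) ?_ (by linarith) (by positivity)
    have h1 : (4 / 3 * (x₀ + ν) + 19 / 16 * e ^ 2 + (r₃ (x₀ + ν) - r₁ (x₀ + ν))) - 4 / 3 * ν =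
        (r₃ (x₀ + ν) - r₁ (x₀ + ν)) - (r₃ x₀ - r₁ x₀) := by linarith
    rw [h1]
    refine (hlip ν hν).trans ?_
    have h2 : |x₀| + |ν| + e ^ 2 ≤ (2 + M) * (|ν| + e ^ 2) := by
      have h4 : 0 ≤ (1 + M) * |ν| := by positivity
      linarith
    calc L * (|x₀| + |ν| + e ^ 2) * |ν| ≤ L * ((2 + M) * (|ν| + e ^ 2)) * |ν| := by gcongr
      _ = P * (|ν| * (|ν| + e ^ 2)) := by rw [hPdef]; ring
  · refine hmono (K' := Q) ?_ (by linarith) (by positivity)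
    have h1 : (3 / 4 + 4 / 3 * (x₀ + ν) - 17 / 32 * e ^ 2 + (r₁ (x₀ + ν) + r₃ (x₀ + ν)) / 2) -
        (3 / 4 + 4 / 3 * ν - 55 / 32 * e ^ 2) =
          4 / 3 * (x₀ + 57 / 64 * e ^ 2) + (r₁ (x₀ + ν) + r₃ (x₀ + ν)) / 2 := by ring
    have h2 : |(r₁ (x₀ + ν) + r₃ (x₀ + ν)) / 2| ≤
        C * (e ^ 3 + |x₀ + ν| * e ^ 2 + (x₀ + ν) ^ 2) := by
      rw [abs_div, abs_two]
      linarith [abs_add_le (r₁ (x₀ + ν)) (r₃ (x₀ + ν)), hr₁ _ hν, hr₃ _ hν]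
    have h3 : |4 / 3 * (x₀ + 57 / 64 * e ^ 2)| ≤ 4 / 3 * (M * e ^ 3) := by
      rw [abs_mul, abs_of_nonneg (by norm_num : (0 : ℝ) ≤ 4 / 3)]
      gcongr
    have h4 : |x₀ + ν| * e ^ 2 ≤ (1 + M) * e ^ 3 + |ν| * e ^ 2 := by
      have h5 : |x₀ + ν| ≤ (1 + M) * e ^ 2 + |ν| := (abs_add_le _ _).trans (by gcongr)
      calc |x₀ + ν| * e ^ 2 ≤ ((1 + M) * e ^ 2 + |ν|) * e ^ 2 := by gcongr
        _ = (1 + M) * e ^ 4 + |ν| * e ^ 2 := by ring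
        _ ≤ (1 + M) * e ^ 3 + |ν| * e ^ 2 := by gcongr
    have h5 : (x₀ + ν) ^ 2 ≤ 2 * (1 + M) ^ 2 * e ^ 3 + 2 * ν ^ 2 := by
      have h6 : x₀ ^ 2 ≤ (1 + M) ^ 2 * e ^ 3 := by
        calc x₀ ^ 2 = |x₀| ^ 2 := (sq_abs _).symm
          _ ≤ ((1 + M) * e ^ 2) ^ 2 := by gcongr
          _ = (1 + M) ^ 2 * e ^ 4 := by ring
          _ ≤ (1 + M) ^ 2 * e ^ 3 := by gcongr
      linarith [sq_nonneg (x₀ - ν)]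
    rw [h1]
    refine ((abs_add_le _ _).trans (add_le_add h3 h2)).trans ?_
    have h6 : C * (e ^ 3 + |x₀ + ν| * e ^ 2 + (x₀ + ν) ^ 2) ≤
        C * (e ^ 3 + ((1 + M) * e ^ 3 + |ν| * e ^ 2) +
          (2 * (1 + M) ^ 2 * e ^ 3 + 2 * ν ^ 2)) := by gcongr
    have h7 : C * (|ν| * e ^ 2) ≤ Q * (|ν| * e ^ 2) := by
      have : C ≤ Q := by
        have : 0 ≤ 4 / 3 * M + C * (1 + (1 + M) + 2 * (1 + M) ^ 2) := by positivity
        linarith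
      gcongr
    have h8 : 2 * C * ν ^ 2 ≤ Q * ν ^ 2 := by
      have : 2 * C ≤ Q := by
        have : 0 ≤ 4 / 3 * M + C * (1 + (1 + M) + 2 * (1 + M) ^ 2) := by positivity
        linarith
      gcongr
    have h9 : 4 / 3 * (M * e ^ 3) + C * (e ^ 3 + (1 + M) * e ^ 3 + 2 * (1 + M) ^ 2 * e ^ 3) ≤
        Q * e ^ 3 := by
      rw [hQdef]
      have : 0 ≤ 2 * C * e ^ 3 := by positivity
      linarith
    linarith

lemma eq_zero_of_abs_le_cubic {r : ℝ × ℝ → ℝ} (hr : AnalyticAt ℝ r (0, 0)) {C : ℝ}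
    (hb : ∀ᶠ p in 𝓝 ((0 : ℝ), (0 : ℝ)), |r p| ≤ C * (|p.2| ^ 3 + |p.1| * p.2 ^ 2 + p.1 ^ 2)) :
    r (0, 0) = 0 ∧ partialFst r (0, 0) = 0 := by
  obtain ⟨K, -, h⟩ := exists_partialFst_le hr hb
  exact ⟨by simpa using hb.self_of_nhds, by simpa using h.self_of_nhds⟩

lemma abs_le_cubic_of_abs_le_quintic {C x e r : ℝ} (hC : 0 < C) (hx : |x| ≤ 1) (he : |e| ≤ 1)
    (hr : |r| ≤ C * (|e| ^ 5 + |x| * e ^ 4 + x ^ 2 * e ^ 2 + x ^ 4 * |e|)) :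
    |r| ≤ 2 * C * (|e| ^ 3 + |x| * e ^ 2 + x ^ 2) := by
  have he2 : e ^ 2 ≤ 1 := by rw [← sq_abs]; exact pow_le_one₀ (abs_nonneg e) he
  have hx2 : x ^ 2 ≤ 1 := by rw [← sq_abs]; exact pow_le_one₀ (abs_nonneg x) hx
  have h1 : |e| ^ 5 ≤ |e| ^ 3 := pow_le_pow_of_le_one (abs_nonneg e) he (by norm_num)
  have h2 : |x| * e ^ 4 ≤ |x| * e ^ 2 := by
    have : e ^ 4 ≤ e ^ 2 := by nlinarith [sq_nonneg e]
    gcongr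
  have h3 : x ^ 2 * e ^ 2 ≤ x ^ 2 := mul_le_of_le_one_right (sq_nonneg x) he2
  have h4 : x ^ 4 * |e| ≤ x ^ 2 := by
    have h5 : x ^ 4 ≤ x ^ 2 := by nlinarith [sq_nonneg x]
    exact (mul_le_of_le_one_right (by positivity) he).trans h5
  have h6 : |e| ^ 5 + |x| * e ^ 4 + x ^ 2 * e ^ 2 + x ^ 4 * |e| ≤
      2 * (|e| ^ 3 + |x| * e ^ 2 + x ^ 2) := by
    have : 0 ≤ |e| ^ 3 := by positivity
    have : 0 ≤ |x| * e ^ 2 := by positivity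
    linarith
  calc |r| ≤ C * (|e| ^ 5 + |x| * e ^ 4 + x ^ 2 * e ^ 2 + x ^ 4 * |e|) := hr
    _ ≤ C * (2 * (|e| ^ 3 + |x| * e ^ 2 + x ^ 2)) := by gcongr
    _ = _ := by ring

lemma AnalyticAt.eventually_abs_lt {φ : ℝ → ℝ} (hφ : AnalyticAt ℝ φ 0) (h0 : φ 0 = 0) {c : ℝ}
    (hc : 0 < c) : ∀ᶠ e in 𝓝 (0 : ℝ), |φ e| < c :=
  hφ.continuousAt.abs.eventually_lt_const (by simpa [h0] using hc)

lemma eventually_abs_lt_prod {c : ℝ} (hc : 0 < c) :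
    ∀ᶠ p in 𝓝 ((0 : ℝ), (0 : ℝ)), |p.1| < c ∧ |p.2| < c :=
  ((continuous_fst.abs.tendsto ((0 : ℝ), (0 : ℝ))).eventually_lt_const (by simpa using hc)).and
    ((continuous_snd.abs.tendsto ((0 : ℝ), (0 : ℝ))).eventually_lt_const (by simpa using hc))

lemma analyticAt_entries {C η₀ : ℝ} (hC : 0 < C) (hη₀ : 0 < η₀) {r₁ r₂ r₃ : ℝ × ℝ → ℝ}
    (h1 : AnalyticAt ℝ r₁ (0, 0)) (h2 : AnalyticAt ℝ r₂ (0, 0)) (h3 : AnalyticAt ℝ r₃ (0, 0))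
    (hb1 : ∀ x e, |x| < η₀ → |e| < η₀ → |r₁ (x, e)| ≤ C * (|e| ^ 3 + |x| * e ^ 2 + x ^ 2))
    (hb3 : ∀ x e, |x| < η₀ → |e| < η₀ → |r₃ (x, e)| ≤ C * (|e| ^ 3 + |x| * e ^ 2 + x ^ 2))
    (hb2 : ∀ x e, |x| < η₀ → |e| < η₀ →
      |r₂ (x, e)| ≤ C * (|e| ^ 5 + |x| * e ^ 4 + x ^ 2 * e ^ 2 + x ^ 4 * |e|))
    {T b Y : ℝ × ℝ → ℝ}
    (hT : T = fun p => 4 / 3 * p.1 + 19 / 16 * p.2 ^ 2 + (r₃ p - r₁ p))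
    (hb : b = fun p => -(√3 / 6) * p.1 * p.2 ^ 2 - 39 * √3 / 512 * p.2 ^ 4 + r₂ p)
    (hY : Y = fun p => 3 / 4 + 4 / 3 * p.1 - 17 / 32 * p.2 ^ 2 + (r₁ p + r₃ p) / 2) :
    (∃ L > 0, ∀ᶠ p in 𝓝 ((0 : ℝ), (0 : ℝ)),
      |partialFst (fun q => r₃ q - r₁ q) p| ≤ L * (|p.1| + p.2 ^ 2)) ∧
      (AnalyticAt ℝ T (0, 0) ∧ AnalyticAt ℝ b (0, 0) ∧ AnalyticAt ℝ Y (0, 0)) ∧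
      (T (0, 0) = 0 ∧ b (0, 0) = 0) ∧
      partialFst T (0, 0) = 4 / 3 ∧ partialFst b (0, 0) = 0 ∧ partialFst Y (0, 0) = 4 / 3 := by
  have e1 : ∀ᶠ p in 𝓝 ((0 : ℝ), (0 : ℝ)),
      |r₁ p| ≤ 2 * C * (|p.2| ^ 3 + |p.1| * p.2 ^ 2 + p.1 ^ 2) := by
    filter_upwards [eventually_abs_lt_prod hη₀] with p hp
    have := hb1 p.1 p.2 hp.1 hp.2
    have := (abs_nonneg _).trans this
    linarith
  have e3 : ∀ᶠ p in 𝓝 ((0 : ℝ), (0 : ℝ)),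
      |r₃ p| ≤ 2 * C * (|p.2| ^ 3 + |p.1| * p.2 ^ 2 + p.1 ^ 2) := by
    filter_upwards [eventually_abs_lt_prod hη₀] with p hp
    have := hb3 p.1 p.2 hp.1 hp.2
    have := (abs_nonneg _).trans this
    linarith
  have e2 : ∀ᶠ p in 𝓝 ((0 : ℝ), (0 : ℝ)),
      |r₂ p| ≤ 2 * C * (|p.2| ^ 3 + |p.1| * p.2 ^ 2 + p.1 ^ 2) := by
    filter_upwards [eventually_abs_lt_prod hη₀, eventually_abs_lt_prod one_pos] with p hp hp1
    exact abs_le_cubic_of_abs_le_quintic hC hp1.1.le hp1.2.le (hb2 p.1 p.2 hp.1 hp.2)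
  have e13 : ∀ᶠ p in 𝓝 ((0 : ℝ), (0 : ℝ)),
      |(fun q => r₃ q - r₁ q) p| ≤ 4 * C * (|p.2| ^ 3 + |p.1| * p.2 ^ 2 + p.1 ^ 2) := by
    filter_upwards [e1, e3] with p hp1 hp3
    exact (abs_sub (r₃ p) (r₁ p)).trans (by linarith)
  have h31 : AnalyticAt ℝ (fun q => r₃ q - r₁ q) (0, 0) := h3.sub h1
  obtain ⟨z1, d1⟩ := eq_zero_of_abs_le_cubic h1 e1
  obtain ⟨z2, d2⟩ := eq_zero_of_abs_le_cubic h2 e2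
  obtain ⟨z3, d3⟩ := eq_zero_of_abs_le_cubic h3 e3
  have k1 := hasDerivAt_partialFst h1
  have k2 := hasDerivAt_partialFst h2
  have k3 := hasDerivAt_partialFst h3
  rw [d1] at k1
  rw [d2] at k2
  rw [d3] at k3
  have kx := (hasDerivAt_id (0 : ℝ)).const_mul (4 / 3)
  have hx : AnalyticAt ℝ (fun p : ℝ × ℝ => p.1) (0, 0) := analyticAt_fst
  have he : AnalyticAt ℝ (fun p : ℝ × ℝ => p.2) (0, 0) := analyticAt_snd
  have hTa : AnalyticAt ℝ T (0, 0) := by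
    rw [hT]
    fun_prop
  have hba : AnalyticAt ℝ b (0, 0) := by
    rw [hb]
    fun_prop
  have hYa : AnalyticAt ℝ Y (0, 0) := by
    rw [hY]
    fun_prop
  have hT0 : T (0, 0) = 0 := by simp [hT, z1, z3]
  have hb0 : b (0, 0) = 0 := by simp [hb, z2]
  have hT1 : partialFst T (0, 0) = 4 / 3 := by
    refine (hasDerivAt_partialFst hTa).unique ?_
    rw [hT]
    exact ((kx.add_const (19 / 16 * (0 : ℝ) ^ 2)).add (k3.sub k1)).congr_deriv (by norm_num)
  have hY1 : partialFst Y (0, 0) = 4 / 3 := by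
    refine (hasDerivAt_partialFst hYa).unique ?_
    rw [hY]
    exact (((kx.const_add (3 / 4)).sub_const (17 / 32 * (0 : ℝ) ^ 2)).add
      ((k1.add k3).div_const 2)).congr_deriv (by norm_num)
  have hb1' : partialFst b (0, 0) = 0 := by
    refine (hasDerivAt_partialFst hba).unique ?_
    rw [hb]
    exact (((((hasDerivAt_id (0 : ℝ)).const_mul (-(√3 / 6))).mul_const ((0 : ℝ) ^ 2)).sub_const
      (39 * √3 / 512 * (0 : ℝ) ^ 4)).add k2).congr_deriv (by norm_num)
  exact ⟨exists_partialFst_le h31 e13, ⟨hTa, hba, hYa⟩, ⟨hT0, hb0⟩, hT1, hb1', hY1⟩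

lemma exists_analytic_branches {T b : ℝ × ℝ → ℝ} (hTa : AnalyticAt ℝ T (0, 0))
    (hba : AnalyticAt ℝ b (0, 0)) (hT0 : T (0, 0) = 0) (hb0 : b (0, 0) = 0)
    (hT1 : partialFst T (0, 0) = 4 / 3) (hb1 : partialFst b (0, 0) = 0) :
    ∃ φ₀ φp φm : ℝ → ℝ, (AnalyticAt ℝ φ₀ 0 ∧ AnalyticAt ℝ φp 0 ∧ AnalyticAt ℝ φm 0) ∧
      (φ₀ 0 = 0 ∧ φp 0 = 0 ∧ φm 0 = 0) ∧ ∀ᶠ e in 𝓝 (0 : ℝ), T (φ₀ e, e) = 0 ∧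
        T (φp e, e) + 2 * b (φp e, e) = 0 ∧ T (φm e, e) - 2 * b (φm e, e) = 0 := by
  obtain ⟨φ₀, hφ₀, hφ₀0, hφ₀T⟩ := exists_analytic_implicit hTa hT0 (by rw [hT1]; norm_num)
  have hPa : AnalyticAt ℝ (fun p => T p + 2 * b p) (0, 0) := by fun_prop
  have hMa : AnalyticAt ℝ (fun p => T p - 2 * b p) (0, 0) := by fun_prop
  have hP1 : partialFst (fun p => T p + 2 * b p) (0, 0) = 4 / 3 := by
    refine ((hasDerivAt_partialFst hPa).unique ((hasDerivAt_partialFst hTa).add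
      ((hasDerivAt_partialFst hba).const_mul 2))).trans ?_
    rw [hT1, hb1]
    norm_num
  have hM1 : partialFst (fun p => T p - 2 * b p) (0, 0) = 4 / 3 := by
    refine ((hasDerivAt_partialFst hMa).unique ((hasDerivAt_partialFst hTa).sub
      ((hasDerivAt_partialFst hba).const_mul 2))).trans ?_
    rw [hT1, hb1]
    norm_num
  obtain ⟨φp, hφp, hφp0, hφpT⟩ := exists_analytic_implicit hPa (by simp [hT0, hb0])
    (by rw [hP1]; norm_num)
  obtain ⟨φm, hφm, hφm0, hφmT⟩ := exists_analytic_implicit hMa (by simp [hT0, hb0])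
    (by rw [hM1]; norm_num)
  exact ⟨φ₀, φp, φm, ⟨hφ₀, hφp, hφm⟩, ⟨hφ₀0, hφp0, hφm0⟩, hφ₀T.and (hφpT.and hφmT)⟩

lemma isola_estimates {η K K' c e x₀ xp xm : ℝ} {T b Y h T' b' Y' h' : ℝ → ℝ} (hη : η ≤ 1)
    (hK : 0 < K)
    (hK' : K' = K + (100 + 100 * K + 100 * K ^ 2) + (1 + 20 * K)) (hc1 : c ≤ 1 / 10)
    (hcK : K * c ≤ 1 / 200) (hpos : 0 ≤ e) (hce : e < c)
    (s0 : |x₀| < η / 2) (sp : |xp| < η / 2) (sm : |xm| < η / 2)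
    (c0 : |x₀| < c) (cp : |xp| < c) (cm : |xm| < c) (t0 : T x₀ = 0)
    (tp : T xp + 2 * b xp = 0) (tm : T xm - 2 * b xm = 0)
    (hTd : ∀ x, |x| < η → HasDerivAt T (T' x) x) (hbd : ∀ x, |x| < η → HasDerivAt b (b' x) x)
    (hYd : ∀ x, |x| < η → HasDerivAt Y (Y' x) x) (hhd : ∀ x, |x| < η → HasDerivAt h (h' x) x)
    (hT' : ∀ x, |x| < η → 5 / 4 ≤ T' x) (hb' : ∀ x, |x| < η → |b' x| ≤ 1 / 8)
    (hY' : ∀ x, |x| < η → 1 ≤ Y' x) (hh' : ∀ x, |x| < η → h' x ≤ 0)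
    (heq : ∀ x, |x| < η → h x * Y' x = 8 * b x * b' x - 2 * T x * T' x)
    (hroot : |x₀ + 57 / 64 * e ^ 2| ≤ K * e ^ 3)
    (hrecb : ∀ ν, |x₀ + ν| < η →
      |b (x₀ + ν) - (37 * √3 / 512 * e ^ 4 - √3 / 6 * ν * e ^ 2)| ≤
        K * (e ^ 5 + |ν| * e ^ 4 + ν ^ 2 * e ^ 2 + ν ^ 4 * e))
    (hrecT : ∀ ν, |x₀ + ν| < η → |T (x₀ + ν) - 4 / 3 * ν| ≤ K * |ν| * (|ν| + e ^ 2))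
    (hrecY : ∀ ν, |x₀ + ν| < η →
      |Y (x₀ + ν) - (3 / 4 + 4 / 3 * ν - 55 / 32 * e ^ 2)| ≤
        K * (e ^ 3 + |ν| * e ^ 2 + ν ^ 2)) :
    (xp ≤ x₀ ∧ x₀ ≤ xm) ∧
        (|x₀ + 57 / 64 * e ^ 2| ≤ K' * e ^ 3 ∧
          |xp - (x₀ - 111 * √3 / 1024 * e ^ 4)| ≤ K' * e ^ 5 ∧
          |xm - (x₀ + 111 * √3 / 1024 * e ^ 4)| ≤ K' * e ^ 5) ∧
        (∀ ν, |ν| < η / 2 →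
          |(4 * b (x₀ + ν) ^ 2 - T (x₀ + ν) ^ 2) -
            (4107 / 65536 * e ^ 8 - 16 / 9 * ν ^ 2 - 37 / 128 * ν * e ^ 6)| ≤
              K' * (e ^ 9 + |ν| * e ^ 7 + ν ^ 2 * e ^ 2 + |ν| ^ 3) ∧
          |Y (x₀ + ν) - (3 / 4 + 4 / 3 * ν - 55 / 32 * e ^ 2)| ≤
            K' * (e ^ 3 + |ν| * e ^ 2 + ν ^ 2) ∧
          (xp - x₀ < ν → ν < xm - x₀ →
            0 < 4 * b (x₀ + ν) ^ 2 - T (x₀ + ν) ^ 2) ∧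
          (ν ≤ xp - x₀ ∨ xm - x₀ ≤ ν →
            4 * b (x₀ + ν) ^ 2 - T (x₀ + ν) ^ 2 ≤ 0)) ∧
        (∀ x ∈ Icc xp xm, 0 ≤ 4 * b x ^ 2 - T x ^ 2) ∧
        (0 < e → ∃ S : Set (ℝ × ℝ), IsCompact S ∧ Convex ℝ S ∧ (interior S).Nonempty ∧
          frontier S = {p : ℝ × ℝ | ∃ x ∈ Icc xp xm,
            p.1 ^ 2 = (4 * b x ^ 2 - T x ^ 2) / 4 ∧ p.2 = Y x}) := by
  have hs0 : |x₀| < η := by linarith [abs_nonneg x₀]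
  have hsp : |xp| < η := by linarith [abs_nonneg xp]
  have hsm : |xm| < η := by linarith [abs_nonneg xm]
  have hK2 := sq_nonneg K
  have hmono : ∀ {a k s : ℝ}, a ≤ k * s → k ≤ K' → 0 ≤ s → a ≤ K' * s := fun h hk hs =>
    h.trans (mul_le_mul_of_nonneg_right hk hs)
  have hKe : K * e ≤ 1 / 200 := le_trans (by gcongr) hcK
  have h3' : 1 ≤ √3 := Real.one_le_sqrt.2 (by norm_num)
  have hblow : 1 / 100 * e ^ 4 ≤ b x₀ := by
    have hb00 := hrecb 0 (by simpa using hs0)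
    simp only [add_zero, abs_zero, mul_zero, zero_mul, sub_zero, ne_eq, OfNat.ofNat_ne_zero,
      not_false_eq_true, zero_pow] at hb00
    have k1 : K * e ^ 5 ≤ 1 / 200 * e ^ 4 := by
      calc K * e ^ 5 = K * e * e ^ 4 := by ring
        _ ≤ 1 / 200 * e ^ 4 := by gcongr
    have k2 : 1 * e ^ 4 ≤ √3 * e ^ 4 := by gcongr
    have k3 := (abs_le.1 hb00).1
    have : 0 ≤ e ^ 4 := by positivity
    linarith
  have he4 : 0 ≤ e ^ 4 := by positivity
  obtain ⟨o1, o2, o3, o4, o5⟩ := discriminant_sign hTd hbd hT' hb' hs0 hsp hsm t0 tp tm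
    (by linarith)
  have hcross : ∀ (φ : ℝ) (σ : ℝ), |φ| < c → |φ| < η → (σ = 1 ∨ σ = -1) →
      T φ = 2 * σ * b φ →
      |φ - x₀ - σ * (111 * √3 / 1024 * e ^ 4)| ≤ (1 + 20 * K) * e ^ 5 := by
    intro φ σ hφc hφη hσ h0
    have hφ : x₀ + (φ - x₀) = φ := add_sub_cancel _ _
    have hd : |φ - x₀| ≤ 2 * c := (abs_sub _ _).trans (by linarith)
    have hKd : K * |φ - x₀| ≤ 1 / 100 := by
      calc K * |φ - x₀| ≤ K * (2 * c) := by gcongr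
        _ ≤ 1 / 100 := by linarith
    have hbν := hrecb (φ - x₀) (by rwa [hφ])
    have hTν := hrecT (φ - x₀) (by rwa [hφ])
    rw [hφ] at hbν hTν
    exact abs_crossing_sub_le hK hpos (by linarith) (by linarith) (by linarith) hKd hσ hbν hTν h0
  refine ⟨⟨o1, o2⟩, ⟨hmono hroot (by linarith) (by positivity), ?_, ?_⟩, fun ν hν => ?_,
    fun x hx => ?_, fun hepos => ?_⟩
  · have := hcross (xp) (-1) cp hsp (Or.inr rfl) (by linarith)
    rw [show xp - (x₀ - 111 * √3 / 1024 * e ^ 4) =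
      xp - x₀ - -1 * (111 * √3 / 1024 * e ^ 4) by ring]
    exact hmono this (by linarith) (by positivity)
  · have := hcross (xm) 1 cm hsm (Or.inl rfl) (by linarith)
    rw [show xm - (x₀ + 111 * √3 / 1024 * e ^ 4) =
      xm - x₀ - 1 * (111 * √3 / 1024 * e ^ 4) by ring]
    exact hmono this (by linarith) (by positivity)
  · have hν' : |x₀ + ν| < η := (abs_add_le _ _).trans_lt (by linarith)
    refine ⟨hmono (abs_discriminant_sub_le hK hpos (by linarith) (by linarith)
      (hrecb ν hν') (hrecT ν hν')) (by linarith) (by positivity), ?_,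
      fun h1 h2 => o4 _ hν' (by linarith) (by linarith),
      fun h => o5 _ hν' (h.imp (fun _ => by linarith) (fun _ => by linarith))⟩
    exact hmono (hrecY ν hν') (by linarith) (by positivity)
  · rcases eq_or_lt_of_le hx.1 with hx1 | hx1
    · rw [← hx1, show T xp = -(2 * b xp) by linarith]
      exact le_of_eq (by ring)
    · rcases eq_or_lt_of_le hx.2 with hx2 | hx2
      · rw [hx2, show T xm = 2 * b xm by linarith]
        exact le_of_eq (by ring)
      · exact (o4 x (abs_lt.2 ⟨(abs_lt.1 hsp).1.trans hx1, hx2.trans (abs_lt.1 hsm).2⟩)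
          hx1 hx2).le
  · refine exists_convex_frontier_of_discriminant hTd hbd hYd hhd hY' hh' heq hsp hsm (o3 ?_)
      tp tm o4
    have : 0 < e ^ 4 := by positivity
    linarith

/-- The branches on which `T`, `T + 2 b` and `T - 2 b` vanish, in the shifted variable
`x = μ - 1 / 4`, together with the discriminant `4 b² - T²` near them. -/
theorem exists_isola_branches {C η₀ : ℝ} (hC : 0 < C) (hη₀ : 0 < η₀) {r₁ r₂ r₃ : ℝ × ℝ → ℝ}
    (h1 : AnalyticAt ℝ r₁ (0, 0)) (h2 : AnalyticAt ℝ r₂ (0, 0)) (h3 : AnalyticAt ℝ r₃ (0, 0))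
    (hb1 : ∀ x e, |x| < η₀ → |e| < η₀ → |r₁ (x, e)| ≤ C * (|e| ^ 3 + |x| * e ^ 2 + x ^ 2))
    (hb3 : ∀ x e, |x| < η₀ → |e| < η₀ → |r₃ (x, e)| ≤ C * (|e| ^ 3 + |x| * e ^ 2 + x ^ 2))
    (hb2 : ∀ x e, |x| < η₀ → |e| < η₀ →
      |r₂ (x, e)| ≤ C * (|e| ^ 5 + |x| * e ^ 4 + x ^ 2 * e ^ 2 + x ^ 4 * |e|))
    {T b Y : ℝ × ℝ → ℝ}
    (hT : T = fun p => 4 / 3 * p.1 + 19 / 16 * p.2 ^ 2 + (r₃ p - r₁ p))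
    (hb : b = fun p => -(√3 / 6) * p.1 * p.2 ^ 2 - 39 * √3 / 512 * p.2 ^ 4 + r₂ p)
    (hY : Y = fun p => 3 / 4 + 4 / 3 * p.1 - 17 / 32 * p.2 ^ 2 + (r₁ p + r₃ p) / 2) :
    ∃ η ∈ Ioc 0 η₀, ∃ K > 0, ∃ φ₀ φp φm : ℝ → ℝ, ∀ᶠ e in 𝓝 (0 : ℝ),
      (AnalyticAt ℝ φ₀ e ∧ AnalyticAt ℝ φp e ∧ AnalyticAt ℝ φm e) ∧
      (|φ₀ e| < η / 2 ∧ |φp e| < η / 2 ∧ |φm e| < η / 2) ∧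
      (0 ≤ e → (φp e ≤ φ₀ e ∧ φ₀ e ≤ φm e) ∧
        (|φ₀ e + 57 / 64 * e ^ 2| ≤ K * e ^ 3 ∧
          |φp e - (φ₀ e - 111 * √3 / 1024 * e ^ 4)| ≤ K * e ^ 5 ∧
          |φm e - (φ₀ e + 111 * √3 / 1024 * e ^ 4)| ≤ K * e ^ 5) ∧
        (∀ ν, |ν| < η / 2 →
          |(4 * b (φ₀ e + ν, e) ^ 2 - T (φ₀ e + ν, e) ^ 2) -
            (4107 / 65536 * e ^ 8 - 16 / 9 * ν ^ 2 - 37 / 128 * ν * e ^ 6)| ≤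
              K * (e ^ 9 + |ν| * e ^ 7 + ν ^ 2 * e ^ 2 + |ν| ^ 3) ∧
          |Y (φ₀ e + ν, e) - (3 / 4 + 4 / 3 * ν - 55 / 32 * e ^ 2)| ≤
            K * (e ^ 3 + |ν| * e ^ 2 + ν ^ 2) ∧
          (φp e - φ₀ e < ν → ν < φm e - φ₀ e →
            0 < 4 * b (φ₀ e + ν, e) ^ 2 - T (φ₀ e + ν, e) ^ 2) ∧
          (ν ≤ φp e - φ₀ e ∨ φm e - φ₀ e ≤ ν →
            4 * b (φ₀ e + ν, e) ^ 2 - T (φ₀ e + ν, e) ^ 2 ≤ 0)) ∧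
        (∀ x ∈ Icc (φp e) (φm e), 0 ≤ 4 * b (x, e) ^ 2 - T (x, e) ^ 2) ∧
        (0 < e → ∃ S : Set (ℝ × ℝ), IsCompact S ∧ Convex ℝ S ∧ (interior S).Nonempty ∧
          frontier S = {p : ℝ × ℝ | ∃ x ∈ Icc (φp e) (φm e),
            p.1 ^ 2 = (4 * b (x, e) ^ 2 - T (x, e) ^ 2) / 4 ∧ p.2 = Y (x, e)})) := by
  obtain ⟨⟨L, hL, hrL⟩, ⟨hTa, hba, hYa⟩, ⟨hT0, hb0⟩, hT1, hb1z, hY1⟩ :=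
    analyticAt_entries hC hη₀ h1 h2 h3 hb1 hb3 hb2 hT hb hY
  obtain ⟨φ₀, φp, φm, ⟨hφ₀, hφp, hφm⟩, ⟨hφ₀0, hφp0, hφm0⟩, hφT⟩ :=
    exists_analytic_branches hTa hba hT0 hb0 hT1 hb1z
  obtain ⟨h, hbox⟩ := exists_box_estimates hTa hba hYa hT0 hb0 hT1 hb1z hY1
  have h31 : AnalyticAt ℝ (fun q => r₃ q - r₁ q) (0, 0) := h3.sub h1
  obtain ⟨η₁, hη₁, hB⟩ := exists_box_of_eventually
    (hbox.and (hrL.and h31.eventually_analyticAt))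
  obtain ⟨K, hK, hest⟩ := exists_recentred_estimates hC hL
  obtain ⟨η, hη, hηle⟩ : ∃ η > 0, η ≤ η₀ ∧ η ≤ η₁ ∧ η ≤ 1 :=
    ⟨min η₀ (min η₁ 1), by positivity, min_le_left _ _,
      (min_le_right _ _).trans (min_le_left _ _), (min_le_right _ _).trans (min_le_right _ _)⟩
  obtain ⟨hη0, hη1, hη2⟩ := hηle
  obtain ⟨c, hc, hc1, hcC, hcK⟩ : ∃ c > 0, c ≤ 1 / 10 ∧ 12 * (C * c) ≤ 1 ∧ K * c ≤ 1 / 200 := by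
    refine ⟨min (1 / 10) (min (1 / (12 * C)) (1 / (200 * K))), by positivity, min_le_left _ _,
      ?_, ?_⟩
    · calc 12 * (C * min (1 / 10) (min (1 / (12 * C)) (1 / (200 * K))))
          ≤ 12 * (C * (1 / (12 * C))) := by
            gcongr
            exact (min_le_right _ _).trans (min_le_left _ _)
        _ = 1 := by field_simp
    · calc K * min (1 / 10) (min (1 / (12 * C)) (1 / (200 * K)))
          ≤ K * (1 / (200 * K)) := by
            gcongr
            exact (min_le_right _ _).trans (min_le_right _ _)
        _ = 1 / 200 := by field_simp
  refine ⟨η, ⟨hη, hη0⟩, K + (100 + 100 * K + 100 * K ^ 2) + (1 + 20 * K), by positivity,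
    φ₀, φp, φm, ?_⟩
  filter_upwards [hφ₀.eventually_analyticAt, hφp.eventually_analyticAt,
    hφm.eventually_analyticAt, hφT,
    hφ₀.eventually_abs_lt hφ₀0 (half_pos hη), hφp.eventually_abs_lt hφp0 (half_pos hη),
    hφm.eventually_abs_lt hφm0 (half_pos hη), hφ₀.eventually_abs_lt hφ₀0 hc,
    hφp.eventually_abs_lt hφp0 hc, hφm.eventually_abs_lt hφm0 hc,
    (analyticAt_id (𝕜 := ℝ) (z := (0 : ℝ))).eventually_abs_lt rfl hc,
    (analyticAt_id (𝕜 := ℝ) (z := (0 : ℝ))).eventually_abs_lt rfl hη]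
    with e a0 ap am t s0 sp sm c0 cp cm ce he
  refine ⟨⟨a0, ap, am⟩, ⟨s0, sp, sm⟩, fun hpos => ?_⟩
  simp only [id_eq] at ce he
  have hea : |e| = e := abs_of_nonneg hpos
  have hce : e < c := hea ▸ ce
  have he0 : |e| < η₀ := he.trans_le hη0
  have hbx : ∀ x, |x| < η → _ := fun x hx => hB x e (hx.trans_le hη1) (he.trans_le hη1)
  have hs0 : |φ₀ e| < η := by linarith
  obtain ⟨hroot, hrec⟩ := hest η e (φ₀ e) (fun x => r₁ (x, e)) (fun x => r₂ (x, e))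
    (fun x => r₃ (x, e)) hpos (by linarith)
    (le_trans (by gcongr) hcC) (le_trans (by gcongr) hcC) hs0
    (fun x hx => by simpa only [hea] using hb1 x e (hx.trans_le hη0) he0)
    (fun x hx => by simpa only [hea] using hb3 x e (hx.trans_le hη0) he0)
    (fun x hx => by simpa only [hea] using hb2 x e (hx.trans_le hη0) he0)
    (fun ν hν => abs_image_sub_le_of_partial_le (e := e) hL
      (r := fun x => r₃ (x, e) - r₁ (x, e))
      (r' := fun x => partialFst (fun q => r₃ q - r₁ q) (x, e))
      (fun x hx => hasDerivAt_partialFst (hbx x hx).2.2) (fun x hx => (hbx x hx).2.1) hs0 hν)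
    (by simpa only [hT] using t.1)
  have hTe : ∀ x, T (x, e) = 4 / 3 * x + 19 / 16 * e ^ 2 + (r₃ (x, e) - r₁ (x, e)) :=
    fun x => by rw [hT]
  have hbe : ∀ x, b (x, e) =
      -(√3 / 6) * x * e ^ 2 - 39 * √3 / 512 * e ^ 4 + r₂ (x, e) := fun x => by rw [hb]
  have hYe : ∀ x, Y (x, e) =
      3 / 4 + 4 / 3 * x - 17 / 32 * e ^ 2 + (r₁ (x, e) + r₃ (x, e)) / 2 := fun x => by rw [hY]
  exact isola_estimates (T := fun x => T (x, e)) (b := fun x => b (x, e))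
    (Y := fun x => Y (x, e)) (h := fun x => h (x, e)) hη2 hK rfl hc1 hcK hpos hce s0 sp sm c0 cp cm
    t.1 t.2.1 t.2.2
    (fun x hx => hasDerivAt_partialFst (hbx x hx).1.1)
    (fun x hx => hasDerivAt_partialFst (hbx x hx).1.2.1)
    (fun x hx => hasDerivAt_partialFst (hbx x hx).1.2.2.1)
    (fun x hx => hasDerivAt_partialFst (hbx x hx).1.2.2.2.1)
    (fun x hx => (hbx x hx).1.2.2.2.2.1) (fun x hx => (hbx x hx).1.2.2.2.2.2.1)
    (fun x hx => (hbx x hx).1.2.2.2.2.2.2.1) (fun x hx => (hbx x hx).1.2.2.2.2.2.2.2.2)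
    (fun x hx => (hbx x hx).1.2.2.2.2.2.2.2.1) hroot
    (fun ν hν => by simpa only [hbe] using (hrec ν hν).1)
    (fun ν hν => by simpa only [hTe] using (hrec ν hν).2.1)
    (fun ν hν => by simpa only [hYe] using (hrec ν hν).2.2)

theorem stmt1 (δ₀ ε₀ : ℝ) (hδ₀ : 0 < δ₀) (hε₀ : 0 < ε₀)
    (r₁ r₂ r₃ : ℝ → ℝ → ℝ)
    (h1an : AnalyticOnNhd ℝ (fun p : ℝ × ℝ => r₁ p.1 p.2) (Ioo (-δ₀) δ₀ ×ˢ Ioo (-ε₀) ε₀))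
    (h2an : AnalyticOnNhd ℝ (fun p : ℝ × ℝ => r₂ p.1 p.2) (Ioo (-δ₀) δ₀ ×ˢ Ioo (-ε₀) ε₀))
    (h3an : AnalyticOnNhd ℝ (fun p : ℝ × ℝ => r₃ p.1 p.2) (Ioo (-δ₀) δ₀ ×ˢ Ioo (-ε₀) ε₀))
    (C : ℝ) (hC : 0 < C)
    (hb1 : ∀ δ ∈ Ioo (-δ₀) δ₀, ∀ ε ∈ Ioo (-ε₀) ε₀,
      |r₁ δ ε| ≤ C * (|ε| ^ 3 + |δ| * ε ^ 2 + δ ^ 2))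
    (hb3 : ∀ δ ∈ Ioo (-δ₀) δ₀, ∀ ε ∈ Ioo (-ε₀) ε₀,
      |r₃ δ ε| ≤ C * (|ε| ^ 3 + |δ| * ε ^ 2 + δ ^ 2))
    (hb2 : ∀ δ ∈ Ioo (-δ₀) δ₀, ∀ ε ∈ Ioo (-ε₀) ε₀,
      |r₂ δ ε| ≤ C * (|ε| ^ 5 + |δ| * ε ^ 4 + δ ^ 2 * ε ^ 2 + δ ^ 4 * |ε|))
    -- the entries α, β, γ of B, where L = J·B :
    -- L₁₁ = i(3/4 + (2/3)δ - (9/8)ε² + r₁) = -iα,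
    -- L₁₂ = L₂₁ = -(√3/6)δε² - (39√3/512)ε⁴ + r₂ = β,
    -- L₂₂ = i(3/4 + 2δ + (1/16)ε² + r₃) = iγ, with δ = μ - 1/4
    (A B G : ℝ → ℝ → ℝ)
    (hA : ∀ μ ε : ℝ, A μ ε =
      -(3 / 4 + 2 / 3 * (μ - 1 / 4) - 9 / 8 * ε ^ 2 + r₁ (μ - 1 / 4) ε))
    (hB : ∀ μ ε : ℝ, B μ ε =
      -(Real.sqrt 3 / 6) * (μ - 1 / 4) * ε ^ 2 - 39 * Real.sqrt 3 / 512 * ε ^ 4 +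
        r₂ (μ - 1 / 4) ε)
    (hG : ∀ μ ε : ℝ, G μ ε =
      3 / 4 + 2 * (μ - 1 / 4) + 1 / 16 * ε ^ 2 + r₃ (μ - 1 / 4) ε)
    (Dfun : ℝ → ℝ → ℝ)
    (hD : ∀ μ ε : ℝ, Dfun μ ε = 4 * B μ ε ^ 2 - (A μ ε + G μ ε) ^ 2) :
    ∃ ε₁ ∈ Ioo (0 : ℝ) ε₀, ∃ δ₀' ∈ Ioc (0 : ℝ) δ₀, ∃ μ₀ μp μm : ℝ → ℝ,
      -- real analytic on [0, ε₁)
      AnalyticOnNhd ℝ μ₀ (Ico 0 ε₁) ∧ AnalyticOnNhd ℝ μp (Ico 0 ε₁) ∧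
      AnalyticOnNhd ℝ μm (Ico 0 ε₁) ∧
      (∀ ε ∈ Ico (0 : ℝ) ε₁,
        μ₀ ε ∈ Ioo (1 / 4 - δ₀') (1 / 4 + δ₀') ∧
        μp ε ∈ Ioo (1 / 4 - δ₀') (1 / 4 + δ₀') ∧
        μm ε ∈ Ioo (1 / 4 - δ₀') (1 / 4 + δ₀') ∧
        μp ε ≤ μ₀ ε ∧ μ₀ ε ≤ μm ε) ∧
      -- expansions of μ₀ and μ±
      (∃ C₀ > (0 : ℝ), ∀ ε ∈ Ico (0 : ℝ) ε₁,
        |μ₀ ε - (1 / 4 - 57 / 64 * ε ^ 2)| ≤ C₀ * |ε| ^ 3 ∧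
        |μp ε - (μ₀ ε - 111 * Real.sqrt 3 / 1024 * ε ^ 4)| ≤ C₀ * |ε| ^ 5 ∧
        |μm ε - (μ₀ ε + 111 * Real.sqrt 3 / 1024 * ε ^ 4)| ≤ C₀ * |ε| ^ 5) ∧
      (∃ C' > (0 : ℝ), ∃ νb > (0 : ℝ), ∃ ρ : ℝ → ℝ → ℝ,
        -- (1) expansion of the discriminant D
        (∀ ε ∈ Ico (0 : ℝ) ε₁, ∀ ν : ℝ, |ν| < νb →
          |Dfun (μ₀ ε + ν) ε -
              (4107 / 65536 * ε ^ 8 - 16 / 9 * ν ^ 2 - 37 / 128 * ν * ε ^ 6)| ≤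
            C' * (|ε| ^ 9 + |ν| * |ε| ^ 7 + ν ^ 2 * ε ^ 2 + |ν| ^ 3)) ∧
        -- bound on the remainder ρ in the imaginary parts
        (∀ ε ∈ Ico (0 : ℝ) ε₁, ∀ ν : ℝ, |ν| < νb →
          |ρ ν ε| ≤ C' * (|ε| ^ 3 + |ν| * ε ^ 2 + ν ^ 2)) ∧
        -- (2) the two eigenvalues of L(μ₀(ε)+ν, ε)
        (∀ ε ∈ Ico (0 : ℝ) ε₁, ∀ ν : ℝ, |ν| < νb →
          (μp ε - μ₀ ε < ν ∧ ν < μm ε - μ₀ ε →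
            {l : ℂ | IsEig (Lmat (A (μ₀ ε + ν) ε) (B (μ₀ ε + ν) ε) (G (μ₀ ε + ν) ε)) l} =
              {Complex.I * ((3 / 4 + 4 / 3 * ν - 55 / 32 * ε ^ 2 + ρ ν ε : ℝ) : ℂ) +
                 ((Real.sqrt (Dfun (μ₀ ε + ν) ε) : ℝ) : ℂ) / 2,
               Complex.I * ((3 / 4 + 4 / 3 * ν - 55 / 32 * ε ^ 2 + ρ ν ε : ℝ) : ℂ) -
                 ((Real.sqrt (Dfun (μ₀ ε + ν) ε) : ℝ) : ℂ) / 2} ∧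
            0 < Real.sqrt (Dfun (μ₀ ε + ν) ε) / 2) ∧
          (ν ≤ μp ε - μ₀ ε ∨ μm ε - μ₀ ε ≤ ν →
            {l : ℂ | IsEig (Lmat (A (μ₀ ε + ν) ε) (B (μ₀ ε + ν) ε) (G (μ₀ ε + ν) ε)) l} =
              {Complex.I * ((3 / 4 + 4 / 3 * ν - 55 / 32 * ε ^ 2 + ρ ν ε : ℝ) : ℂ) +
                 Complex.I * ((Real.sqrt |Dfun (μ₀ ε + ν) ε| : ℝ) : ℂ) / 2,
               Complex.I * ((3 / 4 + 4 / 3 * ν - 55 / 32 * ε ^ 2 + ρ ν ε : ℝ) : ℂ) -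
                 Complex.I * ((Real.sqrt |Dfun (μ₀ ε + ν) ε| : ℝ) : ℂ) / 2} ∧
            ∀ l : ℂ, IsEig (Lmat (A (μ₀ ε + ν) ε) (B (μ₀ ε + ν) ε) (G (μ₀ ε + ν) ε)) l →
              l.re = 0))) ∧
      -- (3) the isola: the eigenvalue curve bounds a compact convex region
      (∀ ε ∈ Ioo (0 : ℝ) ε₁, ∃ K : Set (ℝ × ℝ),
        IsCompact K ∧ Convex ℝ K ∧ (interior K).Nonempty ∧
        frontier K = {p : ℝ × ℝ | ∃ μ ∈ Icc (μp ε) (μm ε), ∃ l : ℂ,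
          IsEig (Lmat (A μ ε) (B μ ε) (G μ ε)) l ∧ p = (l.re, l.im)}) := by
  obtain ⟨η₀, hη₀, hηδ, hηε⟩ : ∃ η₀ > 0, η₀ ≤ δ₀ ∧ η₀ ≤ ε₀ :=
    ⟨min δ₀ ε₀, by positivity, min_le_left _ _, min_le_right _ _⟩
  have h0 : ((0 : ℝ), (0 : ℝ)) ∈ Ioo (-δ₀) δ₀ ×ˢ Ioo (-ε₀) ε₀ :=
    ⟨⟨neg_neg_of_pos hδ₀, hδ₀⟩, ⟨neg_neg_of_pos hε₀, hε₀⟩⟩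
  have hmδ : ∀ x, |x| < η₀ → x ∈ Ioo (-δ₀) δ₀ := fun x hx => abs_lt.1 (hx.trans_le hηδ)
  have hmε : ∀ x, |x| < η₀ → x ∈ Ioo (-ε₀) ε₀ := fun x hx => abs_lt.1 (hx.trans_le hηε)
  obtain ⟨η, ⟨hη, hηη₀⟩, K, hK, φ₀, φp, φm, hφ⟩ := exists_isola_branches hC hη₀
    (h1an _ h0) (h2an _ h0) (h3an _ h0) (fun x e hx he => hb1 x (hmδ x hx) e (hmε e he))
    (fun x e hx he => hb3 x (hmδ x hx) e (hmε e he))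
    (fun x e hx he => hb2 x (hmδ x hx) e (hmε e he)) rfl rfl rfl
  obtain ⟨ε₂, hε₂, hφ⟩ := Metric.eventually_nhds_iff.1 hφ
  have hφ' : ∀ e ∈ Ico (0 : ℝ) (min ε₂ (ε₀ / 2)), _ := fun e he =>
    hφ (y := e) (by
      rw [Real.dist_eq, sub_zero, abs_of_nonneg he.1]
      exact he.2.trans_le (min_le_left _ _))
  have hAG : ∀ x e, A (1 / 4 + x) e + G (1 / 4 + x) e =
      4 / 3 * x + 19 / 16 * e ^ 2 + (r₃ x e - r₁ x e) := fun x e => by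
    rw [hA, hG, add_sub_cancel_left]
    ring
  have hGA : ∀ x e, (G (1 / 4 + x) e - A (1 / 4 + x) e) / 2 =
      3 / 4 + 4 / 3 * x - 17 / 32 * e ^ 2 + (r₁ x e + r₃ x e) / 2 := fun x e => by
    rw [hA, hG, add_sub_cancel_left]
    ring
  have hB' : ∀ x e, B (1 / 4 + x) e =
      -(√3 / 6) * x * e ^ 2 - 39 * √3 / 512 * e ^ 4 + r₂ x e := fun x e => by
    rw [hB, add_sub_cancel_left]
  simp only [← hAG, ← hGA, ← hB'] at hφ'
  refine ⟨min ε₂ (ε₀ / 2), ⟨by positivity, (min_le_right _ _).trans_lt (half_lt_self hε₀)⟩,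
    δ₀, ⟨hδ₀, le_rfl⟩, fun e => 1 / 4 + φ₀ e, fun e => 1 / 4 + φp e, fun e => 1 / 4 + φm e,
    fun e he => analyticAt_const.add (hφ' e he).1.1,
    fun e he => analyticAt_const.add (hφ' e he).1.2.1,
    fun e he => analyticAt_const.add (hφ' e he).1.2.2, fun e he => ?_,
    ⟨K, hK, fun e he => ?_⟩,
    ⟨K, hK, η / 2, half_pos hη, fun ν e => (G (1 / 4 + (φ₀ e + ν)) e -
      A (1 / 4 + (φ₀ e + ν)) e) / 2 - (3 / 4 + 4 / 3 * ν - 55 / 32 * e ^ 2),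
      fun e he ν hν => ?_, fun e he ν hν => ?_, fun e he ν hν => ?_⟩, fun e he => ?_⟩
  · obtain ⟨-, ⟨s0, sp, sm⟩, hpos⟩ := hφ' e he
    obtain ⟨⟨o1, o2⟩, -⟩ := hpos he.1
    have hmem : ∀ x, |x| < η / 2 → 1 / 4 + x ∈ Ioo (1 / 4 - δ₀) (1 / 4 + δ₀) := fun x hx => by
      obtain ⟨hl, hu⟩ := abs_lt.1 hx
      exact ⟨by linarith, by linarith⟩
    exact ⟨hmem _ s0, hmem _ sp, hmem _ sm, by linarith, by linarith⟩
  · obtain ⟨-, ⟨k0, kp, km⟩, -⟩ := (hφ' e he).2.2 he.1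
    rw [abs_of_nonneg he.1]
    refine ⟨?_, ?_, ?_⟩
    · convert k0 using 2
      ring
    · convert kp using 2
      ring
    · convert km using 2
      ring
  · rw [hD, add_assoc, abs_of_nonneg he.1]
    exact (((hφ' e he).2.2 he.1).2.2.1 ν hν).1
  · rw [abs_of_nonneg he.1]
    exact (((hφ' e he).2.2 he.1).2.2.1 ν hν).2.1
  · obtain ⟨-, -, hin, hout⟩ := ((hφ' e he).2.2 he.1).2.2.1 ν hν
    simp only [add_sub_add_left_eq_sub, add_sub_cancel, hD, add_assoc]
    refine ⟨fun h => ?_, fun h => ?_⟩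
    · have hpos := hin h.1 h.2
      exact ⟨setOf_isEig_of_nonneg hpos.le, half_pos (Real.sqrt_pos.2 hpos)⟩
    · have hneg := hout h
      exact ⟨setOf_isEig_of_nonpos hneg, fun l hl => re_eq_zero_of_isEig hneg hl⟩
  · obtain ⟨-, -, -, hnn, hS⟩ := (hφ' e ⟨he.1.le, he.2⟩).2.2 he.1.le
    obtain ⟨S, hS1, hS2, hS3, hS4⟩ := hS he.1
    refine ⟨S, hS1, hS2, hS3, hS4.trans ?_⟩
    ext p
    simp only [Set.mem_ofPred_eq]
    constructor
    · rintro ⟨x, hx, hp⟩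
      exact ⟨1 / 4 + x, ⟨by linarith [hx.1], by linarith [hx.2]⟩,
        (exists_isEig_iff (hnn x hx) p).2 hp⟩
    · rintro ⟨μ, hμ, hl⟩
      obtain ⟨x, rfl⟩ : ∃ x, μ = 1 / 4 + x := ⟨μ - 1 / 4, by ring⟩
      have hx : x ∈ Icc (φp e) (φm e) := ⟨by linarith [hμ.1], by linarith [hμ.2]⟩
      exact ⟨x, hx, (exists_isEig_iff (hnn x hx) p).1 hl⟩
end

section
/- Under Assumption H with β₁ = 0, and with μ₀ as in the context, there exist ε₂ ∈ (0,ε₁], ν̄ > 0 and C > 0 such that for all |ε| < ε₂ and |ν| < ν̄: |D(μ₀(ε)+ν, ε) − 4(β₃ − β₂T₂/T₁)²ε⁸ + T₁²ν² − 8β₂(β₃ − β₂T₂/T₁)νε⁶| ≤ C(|ε|⁹ + |ν||ε|⁷ + ν²ε² + |ν|³). -/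
open Matrix Set

/-- Assumption H: expansions of the real analytic entries `α, β, γ` of the matrix `B(μ,ε)`
around `(μ̄, 0)`, with `T₁ = α₁ + γ₁ > 0`. -/
structure AssumptionH (μb ωs δ₀ ε₀ : ℝ) (α β γ : ℝ → ℝ → ℝ)
    (α₁ α₂ β₁ β₂ β₃ γ₁ γ₂ : ℝ) : Prop where
  hδ₀ : 0 < δ₀
  hε₀ : 0 < ε₀
  hα_an : AnalyticOnNhd ℝ (fun p : ℝ × ℝ => α p.1 p.2)
    (Ioo (μb - δ₀) (μb + δ₀) ×ˢ Ioo (-ε₀) ε₀)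
  hβ_an : AnalyticOnNhd ℝ (fun p : ℝ × ℝ => β p.1 p.2)
    (Ioo (μb - δ₀) (μb + δ₀) ×ˢ Ioo (-ε₀) ε₀)
  hγ_an : AnalyticOnNhd ℝ (fun p : ℝ × ℝ => γ p.1 p.2)
    (Ioo (μb - δ₀) (μb + δ₀) ×ˢ Ioo (-ε₀) ε₀)
  hT₁ : 0 < α₁ + γ₁
  hexp : ∃ α₀ γ₀ : ℝ → ℝ, ∃ d ∈ Ioc (0 : ℝ) δ₀, ∃ e ∈ Ioc (0 : ℝ) ε₀, ∃ C : ℝ, 0 < C ∧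
    AnalyticOnNhd ℝ α₀ (Ioo (-d) d) ∧ AnalyticOnNhd ℝ γ₀ (Ioo (-d) d) ∧
    ∀ δ ε : ℝ, |δ| < d → |ε| < e →
      |α (μb + δ) ε - (-(α₀ δ) + α₂ * ε ^ 2)| ≤ C * (|ε| ^ 3 + |δ| * ε ^ 2 + δ ^ 2 * |ε|) ∧
      |β (μb + δ) ε - (β₁ * ε ^ 2 + β₂ * δ * ε ^ 2 + β₃ * ε ^ 4)| ≤
        C * (|ε| ^ 5 + |δ| * |ε| ^ 3 + δ ^ 2 * ε ^ 2 + |δ| ^ 3 * |ε|) ∧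
      |γ (μb + δ) ε - (γ₀ δ + γ₂ * ε ^ 2)| ≤ C * (|ε| ^ 3 + |δ| * ε ^ 2 + δ ^ 2 * |ε|) ∧
      |α₀ δ - (ωs - α₁ * δ)| ≤ C * δ ^ 2 ∧
      |γ₀ δ - (ωs + γ₁ * δ)| ≤ C * δ ^ 2

/-- The graphs of the real analytic functions `μ₀, μ₊, μ₋` are exactly the zero sets of
`T = α + γ`, `d₊ = T + 2β`, `d₋ = T - 2β` in `(μ̄-δ₀,μ̄+δ₀) × (-ε₁,ε₁)`, with the sign
of these functions positive above the respective graph and negative below it. -/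
structure ZeroCurves (μb δ₀ : ℝ) (α β γ : ℝ → ℝ → ℝ) (ε₁ : ℝ)
    (μ₀ μp μm : ℝ → ℝ) : Prop where
  hμ₀_an : AnalyticOnNhd ℝ μ₀ (Ioo (-ε₁) ε₁)
  hμp_an : AnalyticOnNhd ℝ μp (Ioo (-ε₁) ε₁)
  hμm_an : AnalyticOnNhd ℝ μm (Ioo (-ε₁) ε₁)
  hmaps₀ : ∀ ε ∈ Ioo (-ε₁) ε₁, μ₀ ε ∈ Ioo (μb - δ₀) (μb + δ₀)
  hmapsp : ∀ ε ∈ Ioo (-ε₁) ε₁, μp ε ∈ Ioo (μb - δ₀) (μb + δ₀)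
  hmapsm : ∀ ε ∈ Ioo (-ε₁) ε₁, μm ε ∈ Ioo (μb - δ₀) (μb + δ₀)
  hT : ∀ μ ∈ Ioo (μb - δ₀) (μb + δ₀), ∀ ε ∈ Ioo (-ε₁) ε₁,
    (α μ ε + γ μ ε = 0 ↔ μ = μ₀ ε) ∧
    (μ₀ ε < μ → 0 < α μ ε + γ μ ε) ∧ (μ < μ₀ ε → α μ ε + γ μ ε < 0)
  hdp : ∀ μ ∈ Ioo (μb - δ₀) (μb + δ₀), ∀ ε ∈ Ioo (-ε₁) ε₁,
    (α μ ε + γ μ ε + 2 * β μ ε = 0 ↔ μ = μp ε) ∧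
    (μp ε < μ → 0 < α μ ε + γ μ ε + 2 * β μ ε) ∧ (μ < μp ε → α μ ε + γ μ ε + 2 * β μ ε < 0)
  hdm : ∀ μ ∈ Ioo (μb - δ₀) (μb + δ₀), ∀ ε ∈ Ioo (-ε₁) ε₁,
    (α μ ε + γ μ ε - 2 * β μ ε = 0 ↔ μ = μm ε) ∧
    (μm ε < μ → 0 < α μ ε + γ μ ε - 2 * β μ ε) ∧ (μ < μm ε → α μ ε + γ μ ε - 2 * β μ ε < 0)

/-- A function of two variables, analytic at the origin, has first-variable increments given by
an affine function of the second variable, up to a quadratic-type error. -/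
lemma AnalyticAt.exists_increment_bound {F : ℝ × ℝ → ℝ} (hF : AnalyticAt ℝ F (0, 0)) :
    ∃ a b K r : ℝ, 0 < K ∧ 0 < r ∧ ∀ x y e : ℝ, |x| < r → |y| < r → |e| < r →
      |F (x, e) - F (y, e) - (a + b * e) * (x - y)| ≤ K * (|x| + |y| + e ^ 2) * |x - y| := by
  set G : ℝ × ℝ → ℝ := fun p => fderiv ℝ F p (1, 0) with hGdef
  set H : ℝ × ℝ → ℝ := fun p => fderiv ℝ G p (0, 1) with hHdef
  have hG : AnalyticAt ℝ G (0, 0) :=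
    ((ContinuousLinearMap.apply ℝ ℝ ((1, 0) : ℝ × ℝ)).analyticAt _).comp hF.fderiv
  have hH : AnalyticAt ℝ H (0, 0) :=
    ((ContinuousLinearMap.apply ℝ ℝ ((0, 1) : ℝ × ℝ)).analyticAt _).comp hG.fderiv
  obtain ⟨KG, sG, hsG, hLG⟩ := hG.contDiffAt (n := 1) |>.exists_lipschitzOnWith
  obtain ⟨KH, sH, hsH, hLH⟩ := hH.contDiffAt (n := 1) |>.exists_lipschitzOnWith
  obtain ⟨r, hr, hball⟩ := Metric.eventually_nhds_iff.1
    (((hF.eventually_analyticAt.and hG.eventually_analyticAt).and hsG).and hsH)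
  have hmem : ∀ x e : ℝ, |x| < r → |e| < r → dist (x, e) ((0 : ℝ), (0 : ℝ)) < r := by
    intro x e hx he
    simpa [Prod.dist_eq, Real.dist_eq] using ⟨hx, he⟩
  have hdF : ∀ x e : ℝ, |x| < r → |e| < r → HasDerivAt (fun t => F (t, e)) (G (x, e)) x := by
    intro x e hx he
    have h1 := (hball (hmem x e hx he)).1.1.1.differentiableAt.hasFDerivAt
    exact h1.comp_hasDerivAt x ((hasDerivAt_id x).prodMk (hasDerivAt_const x e))
  have hdG : ∀ e : ℝ, |e| < r → HasDerivAt (fun t => G (0, t)) (H (0, e)) e := by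
    intro e he
    have h1 := (hball (hmem 0 e (by simpa using hr) he)).1.1.2.differentiableAt.hasFDerivAt
    exact h1.comp_hasDerivAt e ((hasDerivAt_const e (0 : ℝ)).prodMk (hasDerivAt_id e))
  have hLipG : ∀ x e : ℝ, |x| < r → |e| < r → |G (x, e) - G (0, e)| ≤ KG * |x| := by
    intro x e hx he
    have := hLG.dist_le_mul _ (hball (hmem x e hx he)).1.2 _
      (hball (hmem 0 e (by simpa using hr) he)).1.2
    simpa [Prod.dist_eq, Real.dist_eq] using this
  have hLipH : ∀ e : ℝ, |e| < r → |H (0, e) - H (0, 0)| ≤ KH * |e| := by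
    intro e he
    have := hLH.dist_le_mul _ (hball (hmem 0 e (by simpa using hr) he)).2 _
      (hball (hmem 0 0 (by simpa using hr) (by simpa using hr))).2
    simpa [Prod.dist_eq, Real.dist_eq] using this
  have hG0 : ∀ e : ℝ, |e| < r → |G (0, e) - (G (0, 0) + H (0, 0) * e)| ≤ KH * e ^ 2 := by
    intro e he
    have h := Convex.norm_image_sub_le_of_norm_hasDerivWithin_le
      (f := fun t => G (0, t) - H (0, 0) * t) (f' := fun t => H (0, t) - H (0, 0))
      (s := Icc (-|e|) |e|) (C := KH * |e|) (x := 0) (y := e)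
      (fun t ht => by
        have ht' : |t| < r := (abs_le.2 ht).trans_lt he
        have := (hdG t ht').fun_sub ((hasDerivAt_id t).const_mul (H (0, 0)))
        simpa using this.hasDerivWithinAt)
      (fun t ht => by
        have ht' : |t| ≤ |e| := abs_le.2 ht
        exact (hLipH t (ht'.trans_lt he)).trans (by gcongr))
      (convex_Icc _ _) (by simp) (abs_le.1 le_rfl)
    simp only [Real.norm_eq_abs, mul_zero, sub_zero] at h
    rw [mul_assoc, abs_mul_abs_self, ← sq] at h
    convert h using 2
    ring
  refine ⟨G (0, 0), H (0, 0), KG + KH + 1, r, by positivity, hr, ?_⟩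
  intro x y e hx hy he
  have hm : max |x| |y| < r := max_lt hx hy
  have h := Convex.norm_image_sub_le_of_norm_hasDerivWithin_le
    (f := fun t => F (t, e) - (G (0, 0) + H (0, 0) * e) * t)
    (f' := fun t => G (t, e) - (G (0, 0) + H (0, 0) * e))
    (s := Icc (-(max |x| |y|)) (max |x| |y|)) (C := KG * max |x| |y| + KH * e ^ 2)
    (x := y) (y := x)
    (fun t ht => by
      have ht' : |t| < r := (abs_le.2 ht).trans_lt hm
      have := (hdF t e ht' he).fun_sub
        ((hasDerivAt_id t).const_mul (G (0, 0) + H (0, 0) * e))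
      simpa using this.hasDerivWithinAt)
    (fun t ht => by
      have ht' : |t| ≤ max |x| |y| := abs_le.2 ht
      have h1 := hLipG t e (ht'.trans_lt hm) he
      have h2 := hG0 e he
      have h3 : (KG : ℝ) * |t| ≤ KG * max |x| |y| := by gcongr
      rw [Real.norm_eq_abs]
      have := abs_sub_le (G (t, e)) (G (0, e)) (G (0, 0) + H (0, 0) * e)
      linarith)
    (convex_Icc _ _) (abs_le.1 (le_max_right _ _)) (abs_le.1 (le_max_left _ _))
  simp only [Real.norm_eq_abs] at h
  have hmax : max |x| |y| ≤ |x| + |y| :=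
    max_le (by linarith [abs_nonneg y]) (by linarith [abs_nonneg x])
  calc |F (x, e) - F (y, e) - (G (0, 0) + H (0, 0) * e) * (x - y)|
      = |F (x, e) - (G (0, 0) + H (0, 0) * e) * x
          - (F (y, e) - (G (0, 0) + H (0, 0) * e) * y)| := by congr 1; ring
    _ ≤ (KG * max |x| |y| + KH * e ^ 2) * |x - y| := h
    _ ≤ _ := by
      gcongr
      have hKG : (0 : ℝ) ≤ KG := KG.2
      have hKH : (0 : ℝ) ≤ KH := KH.2
      have h1 : KG * max |x| |y| ≤ KG * (|x| + |y|) := by gcongr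
      nlinarith [mul_nonneg hKH (add_nonneg (abs_nonneg x) (abs_nonneg y)),
        mul_nonneg hKG (sq_nonneg e), sq_nonneg e, abs_nonneg x, abs_nonneg y]

lemma eq_zero_of_abs_add_mul_sq_le_cube {u b M r : ℝ} (hr : 0 < r)
    (h : ∀ t, 0 < t → t < r → |u + b * t ^ 2| ≤ M * t ^ 3) : u = 0 ∧ b = 0 := by
  have hev : ∀ᶠ t : ℝ in nhdsWithin 0 (Ioi 0), 0 < t ∧ t < r := by
    filter_upwards [Ioo_mem_nhdsGT hr] with t ht using ht
  have hlim : ∀ f : ℝ → ℝ, Continuous f →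
      Filter.Tendsto f (nhdsWithin 0 (Ioi 0)) (nhds (f 0)) := fun f hf =>
    (hf.tendsto 0).mono_left nhdsWithin_le_nhds
  have hu : u = 0 := by
    have h1 := le_of_tendsto_of_tendsto (hlim (fun t => |u + b * t ^ 2|) (by fun_prop))
      (hlim (fun t => M * t ^ 3) (by fun_prop)) (hev.mono fun t ht => h t ht.1 ht.2)
    simpa using h1
  subst hu
  refine ⟨rfl, ?_⟩
  have h1 := le_of_tendsto_of_tendsto (hlim (fun _ => |b|) (by fun_prop))
      (hlim (fun t => M * t) (by fun_prop)) (hev.mono fun t ht => by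
        have h2 := h t ht.1 ht.2
        have h3 : 0 < t ^ 2 := by have := ht.1; positivity
        rw [zero_add, abs_mul, abs_of_pos h3] at h2
        exact le_of_mul_le_mul_right (by linarith) h3)
  simpa using h1

/-- If an analytic function has a prescribed expansion with no `x * e` term, its first-variable
increments are linear up to an error controlled by `|x| + |y| + e ^ 2`. -/
lemma AnalyticAt.increment_bound_of_expansion {F : ℝ × ℝ → ℝ} (hF : AnalyticAt ℝ F (0, 0))
    {T₁ T₂ C d : ℝ} (hd : 0 < d) (hexp : ∀ x e : ℝ, |x| < d → |e| < d →
      |F (x, e) - (T₁ * x + T₂ * e ^ 2)| ≤ C * (|e| ^ 3 + |x| * e ^ 2 + x ^ 2)) :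
    ∃ K r : ℝ, 0 < K ∧ 0 < r ∧ ∀ x y e : ℝ, |x| < r → |y| < r → |e| < r →
      |F (x, e) - F (y, e) - T₁ * (x - y)| ≤ K * (|x| + |y| + e ^ 2) * |x - y| := by
  obtain ⟨a, b, K, r, hK, hr, h⟩ := hF.exists_increment_bound
  have hC : 0 ≤ C := by
    have h1 := (abs_nonneg _).trans
      (hexp 0 (d / 2) (by simpa using hd) (by rw [abs_of_pos (by positivity)]; linarith))
    have h2 : 0 < |d / 2| ^ 3 + |(0 : ℝ)| * (d / 2) ^ 2 + 0 ^ 2 := by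
      have : 0 < |d / 2| := by positivity
      have : 0 < |d / 2| ^ 3 := by positivity
      simpa using this
    exact nonneg_of_mul_nonneg_left h1 h2
  have key : a - T₁ = 0 ∧ b = 0 := by
    refine eq_zero_of_abs_add_mul_sq_le_cube (r := min 1 (min r d)) (M := 2 * K + 4 * C)
      (by positivity) fun t ht htr => ?_
    have ht1 : t < 1 := htr.trans_le (min_le_left _ _)
    have htr' : t < r := htr.trans_le ((min_le_right _ _).trans (min_le_left _ _))
    have htd : t < d := htr.trans_le ((min_le_right _ _).trans (min_le_right _ _))
    have ht2 : t ^ 2 ≤ t := pow_le_of_le_one ht.le ht1.le (by norm_num)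
    have ht3 : t ^ 3 ≤ t := pow_le_of_le_one ht.le ht1.le (by norm_num)
    have a2 : |t ^ 2| = t ^ 2 := abs_of_pos (by positivity)
    have a3 : |t ^ 3| = t ^ 3 := abs_of_pos (by positivity)
    have h1 := h (t ^ 3) 0 (t ^ 2) (by rw [a3]; linarith) (by simpa using hr)
      (by rw [a2]; linarith)
    have h2 := hexp (t ^ 3) (t ^ 2) (by rw [a3]; linarith) (by rw [a2]; linarith)
    have h3 := hexp 0 (t ^ 2) (by simpa using hd) (by rw [a2]; linarith)
    simp only [a2, a3, abs_zero, sub_zero, add_zero, mul_zero, zero_mul, zero_add] at h1 h2 h3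
    have t3 : 0 < t ^ 3 := by positivity
    have h76 : t ^ 7 ≤ t ^ 6 := pow_le_pow_of_le_one ht.le ht1.le (by norm_num)
    have b1 : K * (t ^ 3 + (t ^ 2) ^ 2) * t ^ 3 ≤ 2 * K * t ^ 6 := by
      nlinarith [mul_le_mul_of_nonneg_left h76 hK.le]
    have b2 : C * ((t ^ 2) ^ 3 + t ^ 3 * (t ^ 2) ^ 2 + (t ^ 3) ^ 2) ≤ 3 * C * t ^ 6 := by
      nlinarith [mul_le_mul_of_nonneg_left h76 hC]
    have b3 : C * ((t ^ 2) ^ 3 + 0 ^ 2) = C * t ^ 6 := by ring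
    have hfin : |(a - T₁ + b * t ^ 2) * t ^ 3| ≤ (2 * K + 4 * C) * t ^ 6 := by
      rw [b3] at h3
      have h1' := abs_le.1 (h1.trans b1)
      have h2' := abs_le.1 (h2.trans b2)
      have h3' := abs_le.1 h3
      rw [abs_le]
      constructor <;> linarith [h1'.1, h1'.2, h2'.1, h2'.2, h3'.1, h3'.2]
    rw [abs_mul, a3] at hfin
    refine le_of_mul_le_mul_right (hfin.trans_eq ?_) t3
    ring
  obtain ⟨ha, rfl⟩ := key
  obtain rfl : a = T₁ := by linarith
  exact ⟨K, r, hK, hr, fun x y e hx hy he => by simpa using h x y e hx hy he⟩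

/-- A small approximate zero `m` of `T₁ x + T₂ e² + …` satisfies `m = -(T₂ / T₁) e² + O(|e|³)`. -/
lemma root_expansion {T₁ T₂ C : ℝ} (hT₁ : 0 < T₁) (hC : 0 < C) :
    ∃ M η : ℝ, 0 < M ∧ 0 < η ∧ ∀ m e : ℝ, |m| < η → |e| < η →
      |T₁ * m + T₂ * e ^ 2| ≤ C * (|e| ^ 3 + |m| * e ^ 2 + m ^ 2) →
      |m| ≤ M * e ^ 2 ∧ |m + T₂ / T₁ * e ^ 2| ≤ M * |e| ^ 3 := by
  set A := 2 * (|T₂| + 2 * C) / T₁ with hA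
  have hA0 : 0 < A := by positivity
  set B := C * (1 + A + A ^ 2) / T₁ with hB
  have hB0 : 0 < B := by positivity
  refine ⟨A + B, min 1 (T₁ / (2 * C)), by positivity, by positivity, ?_⟩
  intro m e hm he h
  have hm1 : |m| ≤ 1 := (hm.trans_le (min_le_left _ _)).le
  have he1 : |e| ≤ 1 := (he.trans_le (min_le_left _ _)).le
  have hmC : C * |m| ≤ T₁ / 2 := by
    have := (hm.trans_le (min_le_right _ _)).le
    rw [le_div_iff₀ (by positivity)] at this
    linarith
  have e0 := abs_nonneg e
  have m0 := abs_nonneg m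
  rw [← sq_abs e] at h ⊢
  rw [← sq_abs m] at h
  have e32 : |e| ^ 3 ≤ |e| ^ 2 := pow_le_pow_of_le_one e0 he1 (by norm_num)
  have e43 : |e| ^ 4 ≤ |e| ^ 3 := pow_le_pow_of_le_one e0 he1 (by norm_num)
  have hmA : |m| ≤ A * |e| ^ 2 := by
    have h1 : T₁ * |m| ≤ |T₁ * m + T₂ * |e| ^ 2| + |T₂| * |e| ^ 2 := by
      have := abs_sub (T₁ * m + T₂ * |e| ^ 2) (T₂ * |e| ^ 2)
      rw [add_sub_cancel_right, abs_mul, abs_mul T₂, abs_of_pos hT₁,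
        abs_of_nonneg (sq_nonneg |e|)] at this
      exact this
    have h2 : C * (|m| * |e| ^ 2) ≤ C * |e| ^ 2 := by
      have : |m| * |e| ^ 2 ≤ |e| ^ 2 := mul_le_of_le_one_left (by positivity) hm1
      gcongr
    have h3 : C * |m| ^ 2 ≤ T₁ / 2 * |m| := by nlinarith
    have h4 : C * |e| ^ 3 ≤ C * |e| ^ 2 := by gcongr
    rw [hA, div_mul_eq_mul_div, le_div_iff₀ hT₁]
    linarith
  have hmB : |m + T₂ / T₁ * |e| ^ 2| ≤ B * |e| ^ 3 := by
    have h1 : |m| * |e| ^ 2 ≤ A * |e| ^ 3 := by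
      calc |m| * |e| ^ 2 ≤ A * |e| ^ 2 * |e| ^ 2 := by gcongr
        _ = A * |e| ^ 4 := by ring
        _ ≤ _ := by gcongr
    have h2 : |m| ^ 2 ≤ A ^ 2 * |e| ^ 3 := by
      calc |m| ^ 2 ≤ (A * |e| ^ 2) ^ 2 := by gcongr
        _ = A ^ 2 * |e| ^ 4 := by ring
        _ ≤ _ := by gcongr
    have h3 : m + T₂ / T₁ * |e| ^ 2 = (T₁ * m + T₂ * |e| ^ 2) / T₁ := by field_simp
    rw [h3, abs_div, abs_of_pos hT₁, hB, div_mul_eq_mul_div]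
    gcongr
    refine h.trans ?_
    have : C * (|e| ^ 3 + |m| * |e| ^ 2 + |m| ^ 2)
        ≤ C * (|e| ^ 3 + A * |e| ^ 3 + A ^ 2 * |e| ^ 3) := by gcongr
    linarith
  refine ⟨hmA.trans ?_, hmB.trans ?_⟩ <;> gcongr <;> linarith

/-- Shift of the expansion of `β` along `m = c e² + O(|e|³)`. -/
lemma shifted_expansion {b β₂ β₃ c C M m ν e : ℝ} (hC : 0 ≤ C) (hM : 0 ≤ M) (he1 : |e| ≤ 1)
    (hm : |m| ≤ M * e ^ 2) (hm' : |m - c * e ^ 2| ≤ M * |e| ^ 3)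
    (hb : |b - (β₂ * (m + ν) * e ^ 2 + β₃ * e ^ 4)| ≤
      C * (|e| ^ 5 + |m + ν| * |e| ^ 3 + (m + ν) ^ 2 * e ^ 2 + |m + ν| ^ 3 * |e|)) :
    |b - ((β₃ + β₂ * c) * e ^ 4 + β₂ * ν * e ^ 2)| ≤
      (C * (4 + M + 2 * M ^ 2 + 4 * M ^ 3) + |β₂| * M) *
        (|e| ^ 5 + |ν| * |e| ^ 3 + ν ^ 2 * e ^ 2 + |ν| ^ 3 * |e|) := by
  have e0 := abs_nonneg e
  have n0 := abs_nonneg ν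
  have hx : |m + ν| ≤ M * |e| ^ 2 + |ν| := by
    rw [sq_abs]; exact (abs_add_le _ _).trans (by linarith)
  have h65 : |e| ^ 6 ≤ |e| ^ 5 := pow_le_pow_of_le_one e0 he1 (by norm_num)
  have h75 : |e| ^ 7 ≤ |e| ^ 5 := pow_le_pow_of_le_one e0 he1 (by norm_num)
  have x0 := abs_nonneg (m + ν)
  have c1 : |m + ν| * |e| ^ 3 ≤ M * |e| ^ 5 + |ν| * |e| ^ 3 := by
    calc |m + ν| * |e| ^ 3 ≤ (M * |e| ^ 2 + |ν|) * |e| ^ 3 := by gcongr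
      _ = _ := by ring
  have c2 : |m + ν| ^ 2 * |e| ^ 2 ≤ 2 * M ^ 2 * |e| ^ 5 + 2 * (|ν| ^ 2 * |e| ^ 2) := by
    calc |m + ν| ^ 2 * |e| ^ 2 ≤ (M * |e| ^ 2 + |ν|) ^ 2 * |e| ^ 2 := by gcongr
      _ ≤ (2 * ((M * |e| ^ 2) ^ 2 + |ν| ^ 2)) * |e| ^ 2 := by gcongr; exact add_sq_le
      _ = 2 * M ^ 2 * |e| ^ 6 + 2 * (|ν| ^ 2 * |e| ^ 2) := by ring
      _ ≤ _ := by gcongr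
  have c3 : |m + ν| ^ 3 * |e| ≤ 4 * M ^ 3 * |e| ^ 5 + 4 * (|ν| ^ 3 * |e|) := by
    calc |m + ν| ^ 3 * |e| ≤ (M * |e| ^ 2 + |ν|) ^ 3 * |e| := by gcongr
      _ ≤ (2 ^ (3 - 1) * ((M * |e| ^ 2) ^ 3 + |ν| ^ 3)) * |e| := by
        gcongr; exact add_pow_le (by positivity) n0 3
      _ = 4 * M ^ 3 * |e| ^ 7 + 4 * (|ν| ^ 3 * |e|) := by ring
      _ ≤ _ := by gcongr
  have c4 : |β₂ * (m - c * e ^ 2) * e ^ 2| ≤ |β₂| * M * |e| ^ 5 := by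
    rw [abs_mul, abs_mul, abs_of_nonneg (sq_nonneg e), ← sq_abs e]
    calc |β₂| * |m - c * |e| ^ 2| * |e| ^ 2 ≤ |β₂| * (M * |e| ^ 3) * |e| ^ 2 := by
          rw [sq_abs]; gcongr
      _ = _ := by ring
  have key : |b - ((β₃ + β₂ * c) * e ^ 4 + β₂ * ν * e ^ 2)| ≤
      |b - (β₂ * (m + ν) * e ^ 2 + β₃ * e ^ 4)| + |β₂ * (m - c * e ^ 2) * e ^ 2| := by
    refine le_trans (le_of_eq ?_) (abs_add_le _ _)
    congr 1; ring
  rw [← sq_abs (m + ν), ← sq_abs e] at hb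
  rw [← sq_abs e] at c4
  rw [← sq_abs ν, ← sq_abs e]
  rw [← sq_abs e] at key
  have hb' : C * (|e| ^ 5 + |m + ν| * |e| ^ 3 + |m + ν| ^ 2 * |e| ^ 2 + |m + ν| ^ 3 * |e|) ≤
      C * ((4 + M + 2 * M ^ 2 + 4 * M ^ 3) *
        (|e| ^ 5 + |ν| * |e| ^ 3 + |ν| ^ 2 * |e| ^ 2 + |ν| ^ 3 * |e|)) := by
    refine mul_le_mul_of_nonneg_left ?_ hC
    have p0 : 0 ≤ M + 2 * M ^ 2 + 4 * M ^ 3 := by positivity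
    have p1 : 0 ≤ (M + 2 * M ^ 2 + 4 * M ^ 3) *
      (|ν| * |e| ^ 3 + |ν| ^ 2 * |e| ^ 2 + |ν| ^ 3 * |e|) := by positivity
    have p2 : 0 ≤ |e| ^ 5 := by positivity
    have p3 : 0 ≤ |ν| * |e| ^ 3 := by positivity
    have p4 : 0 ≤ |ν| ^ 2 * |e| ^ 2 := by positivity
    linarith
  have hb'' : |β₂| * M * |e| ^ 5 ≤ |β₂| * M *
      (|e| ^ 5 + |ν| * |e| ^ 3 + |ν| ^ 2 * |e| ^ 2 + |ν| ^ 3 * |e|) := by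
    gcongr
    have : 0 ≤ |ν| * |e| ^ 3 + |ν| ^ 2 * |e| ^ 2 + |ν| ^ 3 * |e| := by positivity
    linarith
  have hsum := hb.trans hb'
  linarith

/-- Squaring the shifted expansion of `β`. -/
lemma sq_expansion {b k β₂ K ν e : ℝ} (hK : 0 ≤ K) (he1 : |e| ≤ 1) (hn1 : |ν| ≤ 1)
    (hb : |b - (k * e ^ 4 + β₂ * ν * e ^ 2)| ≤
      K * (|e| ^ 5 + |ν| * |e| ^ 3 + ν ^ 2 * e ^ 2 + |ν| ^ 3 * |e|)) :
    |b ^ 2 - (k ^ 2 * e ^ 8 + 2 * β₂ * k * ν * e ^ 6)| ≤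
      (β₂ ^ 2 + 2 * |k| * K + 4 * |β₂| * K + 8 * K ^ 2) *
        (|e| ^ 9 + |ν| * |e| ^ 7 + ν ^ 2 * e ^ 2 + |ν| ^ 3) := by
  set E := b - (k * e ^ 4 + β₂ * ν * e ^ 2) with hE
  have hbE : b ^ 2 - (k ^ 2 * e ^ 8 + 2 * β₂ * k * ν * e ^ 6) =
      β₂ ^ 2 * (ν ^ 2 * e ^ 4) + 2 * k * (e ^ 4 * E) + 2 * β₂ * (ν * e ^ 2 * E) + E ^ 2 := by
    rw [hE]; ring
  rw [hbE]
  rw [← sq_abs ν, ← sq_abs e] at hb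
  have habs : |β₂ ^ 2 * (ν ^ 2 * e ^ 4) + 2 * k * (e ^ 4 * E) + 2 * β₂ * (ν * e ^ 2 * E) + E ^ 2|
      ≤ β₂ ^ 2 * (|ν| ^ 2 * |e| ^ 4) + 2 * |k| * (|e| ^ 4 * |E|)
        + 2 * |β₂| * (|ν| * |e| ^ 2 * |E|) + |E| ^ 2 := by
    refine (abs_add_le _ _).trans (add_le_add ((abs_add_le _ _).trans
      (add_le_add ((abs_add_le _ _).trans (add_le_add ?_ ?_)) ?_)) ?_) <;>
    simp [abs_mul, abs_pow]
  refine habs.trans ?_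
  rw [← sq_abs ν, ← sq_abs e]
  have e0 := abs_nonneg e
  have n0 := abs_nonneg ν
  have E0 := abs_nonneg E
  generalize |e| = x at *
  generalize |ν| = n at *
  generalize |E| = y at *
  have hx : ∀ j, x ^ j ≤ 1 := fun j => pow_le_one₀ e0 he1
  have hn : ∀ j, n ^ j ≤ 1 := fun j => pow_le_one₀ n0 hn1
  set P := x ^ 9 + n * x ^ 7 + n ^ 2 * x ^ 2 + n ^ 3 with hP
  set S := x ^ 5 + n * x ^ 3 + n ^ 2 * x ^ 2 + n ^ 3 * x with hS
  have P0 : 0 ≤ P := by positivity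
  have S0 : 0 ≤ S := by positivity
  have p9 : 0 ≤ x ^ 9 := by positivity
  have p7 : 0 ≤ n * x ^ 7 := by positivity
  have p2 : 0 ≤ n ^ 2 * x ^ 2 := by positivity
  have p3 : 0 ≤ n ^ 3 := by positivity
  have q2 : ∀ j, n ^ 2 * x ^ 2 * x ^ j ≤ n ^ 2 * x ^ 2 := fun j =>
    mul_le_of_le_one_right p2 (hx j)
  have q3 : ∀ i j, n ^ 3 * (n ^ i * x ^ j) ≤ n ^ 3 := fun i j =>
    mul_le_of_le_one_right p3 (mul_le_one₀ (hn i) (by positivity) (hx j))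
  have t1 : n ^ 2 * x ^ 4 ≤ P := by linarith [q2 2]
  have t2 : x ^ 4 * S ≤ P := by linarith [q2 4, q3 0 5]
  have t3 : n * x ^ 2 * S ≤ 2 * P := by linarith [q2 3, q3 0 4, q3 1 3]
  have t4 : S ^ 2 ≤ 8 * P := by
    have h1 : S ^ 2 ≤ 4 * ((x ^ 5) ^ 2 + (n * x ^ 3) ^ 2 + (n ^ 2 * x ^ 2) ^ 2
        + (n ^ 3 * x) ^ 2) := by
      nlinarith [sq_nonneg (x ^ 5 - n * x ^ 3), sq_nonneg (x ^ 5 - n ^ 2 * x ^ 2),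
        sq_nonneg (x ^ 5 - n ^ 3 * x), sq_nonneg (n * x ^ 3 - n ^ 2 * x ^ 2),
        sq_nonneg (n * x ^ 3 - n ^ 3 * x), sq_nonneg (n ^ 2 * x ^ 2 - n ^ 3 * x)]
    have h2 : x ^ 9 * x ≤ x ^ 9 := mul_le_of_le_one_right p9 he1
    linarith [q2 4, q3 1 4, q3 3 2]
  have u2 : x ^ 4 * y ≤ K * P := by
    calc x ^ 4 * y ≤ x ^ 4 * (K * S) := by gcongr
      _ = K * (x ^ 4 * S) := by ring
      _ ≤ _ := by gcongr
  have u3 : n * x ^ 2 * y ≤ K * (2 * P) := by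
    calc n * x ^ 2 * y ≤ n * x ^ 2 * (K * S) := by gcongr
      _ = K * (n * x ^ 2 * S) := by ring
      _ ≤ _ := by gcongr
  have u4 : y ^ 2 ≤ K ^ 2 * (8 * P) := by
    calc y ^ 2 ≤ (K * S) ^ 2 := by gcongr
      _ = K ^ 2 * S ^ 2 := by ring
      _ ≤ _ := by gcongr
  calc β₂ ^ 2 * (n ^ 2 * x ^ 4) + 2 * |k| * (x ^ 4 * y) + 2 * |β₂| * (n * x ^ 2 * y) + y ^ 2
      ≤ β₂ ^ 2 * P + 2 * |k| * (K * P) + 2 * |β₂| * (K * (2 * P)) + K ^ 2 * (8 * P) := by gcongr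
    _ = _ := by ring

lemma sq_sub_sq_le_of_linear {t T K ν e : ℝ} (hK : 0 ≤ K) (he1 : |e| ≤ 1)
    (hn1 : |ν| ≤ 1) (h : |t - T * ν| ≤ K * (e ^ 2 + |ν|) * |ν|) :
    |t ^ 2 - T ^ 2 * ν ^ 2| ≤ K * (2 * K + 2 * |T|) * (ν ^ 2 * e ^ 2 + |ν| ^ 3) := by
  have he2 : e ^ 2 ≤ 1 := (sq_le_one_iff_abs_le_one e).2 he1
  have n0 := abs_nonneg ν
  have hs : |t + T * ν| ≤ (2 * K + 2 * |T|) * |ν| := by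
    have h1 : |t + T * ν| ≤ |t - T * ν| + 2 * (|T| * |ν|) := by
      have := abs_add_le (t - T * ν) (2 * (T * ν))
      rw [abs_mul 2, abs_mul T, abs_two] at this
      refine le_trans (le_of_eq ?_) this
      congr 1; ring
    have h2 : K * (e ^ 2 + |ν|) * |ν| ≤ K * (1 + 1) * |ν| := by gcongr
    linarith
  calc |t ^ 2 - T ^ 2 * ν ^ 2| = |t - T * ν| * |t + T * ν| := by
        rw [← abs_mul]; congr 1; ring
    _ ≤ (K * (e ^ 2 + |ν|) * |ν|) * ((2 * K + 2 * |T|) * |ν|) := by gcongr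
    _ = _ := by rw [← sq_abs ν]; ring

lemma AssumptionH.analyticAt_trace {μb ωs δ₀ ε₀ : ℝ} {α β γ : ℝ → ℝ → ℝ}
    {α₁ α₂ β₁ β₂ β₃ γ₁ γ₂ : ℝ}
    (hH : AssumptionH μb ωs δ₀ ε₀ α β γ α₁ α₂ β₁ β₂ β₃ γ₁ γ₂) :
    AnalyticAt ℝ (fun p : ℝ × ℝ => α (μb + p.1) p.2 + γ (μb + p.1) p.2) (0, 0) := by
  have hmem : (μb, (0 : ℝ)) ∈ Ioo (μb - δ₀) (μb + δ₀) ×ˢ Ioo (-ε₀) ε₀ := by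
    have := hH.hδ₀
    have := hH.hε₀
    refine ⟨⟨?_, ?_⟩, ⟨?_, ?_⟩⟩ <;> simp <;> assumption
  have h1 := (hH.hα_an _ hmem).add (hH.hγ_an _ hmem)
  refine AnalyticAt.comp_of_eq (f := fun p : ℝ × ℝ => (μb + p.1, p.2)) h1 ?_ (by simp)
  exact (analyticAt_const.add analyticAt_fst).prod analyticAt_snd

/-- Expansion of the trace, from those of its two summands at one point. -/
lemma trace_expansion {a c α₀ γ₀ ωs α₁ α₂ γ₁ γ₂ C x e : ℝ} (hC : 0 < C) (he : |e| ≤ 1)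
    (h1 : |a - (-α₀ + α₂ * e ^ 2)| ≤ C * (|e| ^ 3 + |x| * e ^ 2 + x ^ 2 * |e|))
    (h2 : |c - (γ₀ + γ₂ * e ^ 2)| ≤ C * (|e| ^ 3 + |x| * e ^ 2 + x ^ 2 * |e|))
    (h3 : |α₀ - (ωs - α₁ * x)| ≤ C * x ^ 2) (h4 : |γ₀ - (ωs + γ₁ * x)| ≤ C * x ^ 2) :
    |a + c - ((α₁ + γ₁) * x + (α₂ + γ₂) * e ^ 2)| ≤
      4 * C * (|e| ^ 3 + |x| * e ^ 2 + x ^ 2) := by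
  have h5 : x ^ 2 * |e| ≤ x ^ 2 := mul_le_of_le_one_right (sq_nonneg x) he
  have h6 : C * (|e| ^ 3 + |x| * e ^ 2 + x ^ 2 * |e|) ≤
      C * (|e| ^ 3 + |x| * e ^ 2 + x ^ 2) := by gcongr
  have h7 : 0 ≤ C * (|e| ^ 3 + |x| * e ^ 2) := by positivity
  have h1' := abs_le.1 (h1.trans h6)
  have h2' := abs_le.1 (h2.trans h6)
  have h3' := abs_le.1 h3
  have h4' := abs_le.1 h4
  rw [abs_le]
  constructor <;> linarith [h1'.1, h1'.2, h2'.1, h2'.2, h3'.1, h3'.2, h4'.1, h4'.2]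

/-- The expansion of `4 b ^ 2 - t ^ 2` from the expansions of `b` and `t`. -/
lemma discriminant_expansion {b t T β₂ β₃ c C K M m ν e : ℝ} (hC : 0 ≤ C) (hM : 0 ≤ M)
    (hK : 0 ≤ K) (he1 : |e| ≤ 1) (hn1 : |ν| ≤ 1)
    (hm : |m| ≤ M * e ^ 2) (hm' : |m - c * e ^ 2| ≤ M * |e| ^ 3)
    (hb : |b - (β₂ * (m + ν) * e ^ 2 + β₃ * e ^ 4)| ≤
      C * (|e| ^ 5 + |m + ν| * |e| ^ 3 + (m + ν) ^ 2 * e ^ 2 + |m + ν| ^ 3 * |e|))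
    (ht : |t - T * ν| ≤ K * (|m + ν| + |m| + e ^ 2) * |ν|) {k K₁ K₂ : ℝ}
    (hk : k = β₃ + β₂ * c)
    (hK₁ : K₁ = C * (4 + M + 2 * M ^ 2 + 4 * M ^ 3) + |β₂| * M)
    (hK₂ : K₂ = K * (2 * M + 2)) :
    |4 * b ^ 2 - t ^ 2 - (4 * k ^ 2 * e ^ 8 - T ^ 2 * ν ^ 2 + 8 * β₂ * k * ν * e ^ 6)| ≤
      (4 * (β₂ ^ 2 + 2 * |k| * K₁ + 4 * |β₂| * K₁ + 8 * K₁ ^ 2) + K₂ * (2 * K₂ + 2 * |T|)) *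
        (|e| ^ 9 + |ν| * |e| ^ 7 + ν ^ 2 * e ^ 2 + |ν| ^ 3) := by
  have hK₁0 : 0 ≤ K₁ := by rw [hK₁]; positivity
  have hK₂0 : 0 ≤ K₂ := by rw [hK₂]; positivity
  have hb1 := shifted_expansion hC hM he1 hm hm' hb
  rw [← hk, ← hK₁] at hb1
  have hb2 := abs_le.1 (sq_expansion hK₁0 he1 hn1 hb1)
  have hmν : |m + ν| ≤ |m| + |ν| := abs_add_le _ _
  have ht1 : |t - T * ν| ≤ K₂ * (e ^ 2 + |ν|) * |ν| := ht.trans (by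
    rw [hK₂, mul_assoc K (2 * M + 2)]
    gcongr
    nlinarith [abs_nonneg ν, sq_nonneg e, mul_nonneg hM (abs_nonneg ν)])
  have ht2 : K₂ * (2 * K₂ + 2 * |T|) * (ν ^ 2 * e ^ 2 + |ν| ^ 3) ≤
      K₂ * (2 * K₂ + 2 * |T|) *
        (|e| ^ 9 + |ν| * |e| ^ 7 + ν ^ 2 * e ^ 2 + |ν| ^ 3) := by
    gcongr
    have : 0 ≤ |e| ^ 9 + |ν| * |e| ^ 7 := by positivity
    linarith
  have ht3 := abs_le.1 ((sq_sub_sq_le_of_linear hK₂0 he1 hn1 ht1).trans ht2)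
  rw [abs_le]
  constructor <;> linarith [hb2.1, hb2.2, ht3.1, ht3.2]

theorem stmt8 (μb ωs δ₀ ε₀ : ℝ) (α β γ : ℝ → ℝ → ℝ) (α₁ α₂ β₁ β₂ β₃ γ₁ γ₂ : ℝ)
    (hH : AssumptionH μb ωs δ₀ ε₀ α β γ α₁ α₂ β₁ β₂ β₃ γ₁ γ₂)
    (hβ₁ : β₁ = 0)
    (ε₁ : ℝ) (hε₁ : ε₁ ∈ Ioc (0 : ℝ) ε₀) (μ₀ μp μm : ℝ → ℝ)
    (hZ : ZeroCurves μb δ₀ α β γ ε₁ μ₀ μp μm) :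
    ∃ ε₂ ∈ Ioc (0 : ℝ) ε₁, ∃ νb > (0 : ℝ), ∃ C > (0 : ℝ),
      ∀ ε ν : ℝ, |ε| < ε₂ → |ν| < νb →
        |(4 * β (μ₀ ε + ν) ε ^ 2 - (α (μ₀ ε + ν) ε + γ (μ₀ ε + ν) ε) ^ 2) -
            (4 * (β₃ - β₂ * (α₂ + γ₂) / (α₁ + γ₁)) ^ 2 * ε ^ 8 -
              (α₁ + γ₁) ^ 2 * ν ^ 2 +
              8 * β₂ * (β₃ - β₂ * (α₂ + γ₂) / (α₁ + γ₁)) * ν * ε ^ 6)| ≤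
          C * (|ε| ^ 9 + |ν| * |ε| ^ 7 + ν ^ 2 * ε ^ 2 + |ν| ^ 3) := by
  subst hβ₁
  obtain ⟨α₀, γ₀, d, hd, e₀, he₀, C, hC, -, -, hexp⟩ := hH.hexp
  have hT₁ := hH.hT₁
  have hmemμ : ∀ δ : ℝ, |δ| < δ₀ → μb + δ ∈ Ioo (μb - δ₀) (μb + δ₀) := fun δ hδ => by
    have := abs_lt.1 hδ
    constructor <;> linarith
  set T₁ := α₁ + γ₁
  set T₂ := α₂ + γ₂
  set F : ℝ × ℝ → ℝ := fun p => α (μb + p.1) p.2 + γ (μb + p.1) p.2 with hFdef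
  have hF : AnalyticAt ℝ F (0, 0) := hH.analyticAt_trace
  have hde : 0 < min 1 (min d e₀) := lt_min one_pos (lt_min hd.1 he₀.1)
  have hFexp : ∀ x e : ℝ, |x| < min 1 (min d e₀) → |e| < min 1 (min d e₀) →
      |F (x, e) - (T₁ * x + T₂ * e ^ 2)| ≤ 4 * C * (|e| ^ 3 + |x| * e ^ 2 + x ^ 2) := by
    intro x e hx he
    simp only [lt_min_iff] at hx he
    obtain ⟨h1, -, h2, h3, h4⟩ := hexp x e hx.2.1 he.2.2
    exact trace_expansion hC he.1.le h1 h2 h3 h4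
  obtain ⟨K, r, hK, hr, hinc⟩ := hF.increment_bound_of_expansion hde hFexp
  obtain ⟨M, η, hM, hη, hroot⟩ := root_expansion (T₂ := T₂) hT₁ (C := 4 * C) (by positivity)
  have hε₁0 : (0 : ℝ) ∈ Ioo (-ε₁) ε₁ := ⟨by linarith [hε₁.1], hε₁.1⟩
  have hμ₀0 : μ₀ 0 = μb := by
    have h1 := hFexp 0 0 (by simpa using hde) (by simpa using hde)
    have h2 : F (0, 0) = 0 := by simpa using h1
    simp only [hFdef, add_zero] at h2
    have h3 := hmemμ 0 (by simpa using hH.hδ₀)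
    rw [add_zero] at h3
    exact (((hZ.hT μb h3 0 hε₁0).1).1 h2).symm
  set ρ := min η (min (1 / 2) (min (d / 2) (min (e₀ / 2) (r / 2)))) with hρdef
  have hρ : 0 < ρ := by
    have := hd.1
    have := he₀.1
    positivity
  have hcont : Filter.Tendsto μ₀ (nhds 0) (nhds μb) := by
    have := (hZ.hμ₀_an 0 hε₁0).continuousAt.tendsto
    rwa [hμ₀0] at this
  obtain ⟨s, hs, hsμ⟩ := Metric.tendsto_nhds_nhds.1 hcont ρ hρ
  set k := β₃ - β₂ * T₂ / T₁ with hk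
  set K₁ := C * (4 + M + 2 * M ^ 2 + 4 * M ^ 3) + |β₂| * M with hK₁
  have hK₁0 : 0 ≤ K₁ := by positivity
  set K₂ := K * (2 * M + 2) with hK₂
  have hK₂0 : 0 < K₂ := by positivity
  refine ⟨min ε₁ (min s ρ), ⟨lt_min hε₁.1 (lt_min hs hρ), min_le_left _ _⟩, ρ, hρ,
    4 * (β₂ ^ 2 + 2 * |k| * K₁ + 4 * |β₂| * K₁ + 8 * K₁ ^ 2) + K₂ * (2 * K₂ + 2 * |T₁|),
    by positivity, ?_⟩
  intro ε ν hε hν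
  obtain ⟨hεε₁, hεs, hερ⟩ : |ε| < ε₁ ∧ |ε| < s ∧ |ε| < ρ := by simpa [lt_min_iff] using hε
  obtain ⟨m, hm⟩ : ∃ m, m = μ₀ ε - μb := ⟨_, rfl⟩
  have hμm : μ₀ ε = μb + m := by linarith
  have hmρ : |m| < ρ := by
    have := hsμ (x := ε) (by simpa [Real.dist_eq] using hεs)
    rwa [Real.dist_eq, ← hm] at this
  have hmν : |m + ν| ≤ |m| + |ν| := abs_add_le _ _
  simp only [hρdef, lt_min_iff] at hερ hmρ hν
  obtain ⟨a1, a2, a3, a4, a5⟩ := hερ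
  obtain ⟨b1, b2, b3, b4, b5⟩ := hmρ
  obtain ⟨c1, c2, c3, c4, c5⟩ := hν
  have hd1 := hd.1
  have he1 := he₀.1
  have hεmem : ε ∈ Ioo (-ε₁) ε₁ := abs_lt.1 hεε₁
  have hFm : F (m, ε) = 0 := by
    have h1 := (hZ.hT (μ₀ ε) (hZ.hmaps₀ ε hεmem) ε hεmem).1.2 rfl
    simpa only [hFdef, ← hμm] using h1
  have hmexp := hFexp m ε (lt_min (by linarith) (lt_min (by linarith) (by linarith)))
    (lt_min (by linarith) (lt_min (by linarith) (by linarith)))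
  rw [hFm, zero_sub, abs_neg] at hmexp
  obtain ⟨hm1, hm2⟩ := hroot m ε b1 a1 hmexp
  have hβ := (hexp (m + ν) ε (by linarith) (by linarith)).2.1
  rw [zero_mul, zero_add] at hβ
  have hinc1 := hinc (m + ν) m ε (by linarith) (by linarith) (by linarith)
  rw [hFm, sub_zero, add_sub_cancel_left] at hinc1
  have hfin := discriminant_expansion (c := -(T₂ / T₁)) (k := k) hC.le hM.le hK.le
    (by linarith) (by linarith) hm1 (by simpa [sub_eq_add_neg] using hm2) hβ hinc1
    (by rw [hk]; ring) hK₁ hK₂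
  have hFν : F (m + ν, ε) = α (μ₀ ε + ν) ε + γ (μ₀ ε + ν) ε := by
    simp only [hFdef, hμm, add_assoc]
  rwa [hFν, ← add_assoc, ← hμm] at hfin
end

section
/- Under Assumption H, and with μ₀ as in the context, there exist ε₂ ∈ (0,ε₁], ν̄ > 0 and C > 0 such that for all |ε| < ε₂ and |ν| < ν̄: |S(μ₀(ε)+ν, ε) − 2ω* − (γ₁−α₁)ν − (γ₂ − α₂ − (γ₁−α₁)T₂/T₁)ε²| ≤ C(|ε|³ + |ν|ε² + ν²). -/
open Matrix Set

/-- A remainder bound for `T x ε = T₁ x + T₂ ε² + R` at a zero `k` of `T` of size at most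
`T₁ / (12 C)` forces `k = O(ε²)`. -/
lemma abs_zero_le_mul_sq {T₁ T₂ C k a : ℝ} (hT₁ : 0 < T₁) (hC : 0 < C) (ha : 0 ≤ a) (ha1 : a ≤ 1)
    (haη : a ≤ T₁ / (12 * C)) (hk : |k| ≤ T₁ / (12 * C))
    (h : |T₁ * k + T₂ * a ^ 2| ≤ 2 * C * (a ^ 3 + |k| * a ^ 2 + 2 * k ^ 2)) :
    |k| ≤ 2 * (|T₂| + 2 * C) / T₁ * a ^ 2 := by
  have hk0 := abs_nonneg k
  rw [le_div_iff₀ (by positivity)] at haη hk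
  have h1 : T₁ * |k| ≤ |T₁ * k + T₂ * a ^ 2| + |T₂| * a ^ 2 := by
    have := abs_sub (T₁ * k + T₂ * a ^ 2) (T₂ * a ^ 2)
    rwa [add_sub_cancel_right, abs_mul, abs_mul, abs_of_pos hT₁, abs_of_nonneg (sq_nonneg a)]
      at this
  have ha2 : a ^ 2 ≤ a := by nlinarith
  have ha3 : a ^ 3 ≤ a ^ 2 := by nlinarith [sq_nonneg a]
  have h2 : |k| * (C * a ^ 2) ≤ |k| * (T₁ / 12) := by
    gcongr
    nlinarith
  have h3 : |k| * (C * |k|) ≤ |k| * (T₁ / 12) := by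
    gcongr
    linarith
  have h4 : C * a ^ 3 ≤ C * a ^ 2 := by gcongr
  rw [div_mul_eq_mul_div, le_div_iff₀ hT₁]
  nlinarith [sq_abs k]

theorem stmt9 (μb ωs δ₀ ε₀ : ℝ) (α β γ : ℝ → ℝ → ℝ) (α₁ α₂ β₁ β₂ β₃ γ₁ γ₂ : ℝ)
    (hH : AssumptionH μb ωs δ₀ ε₀ α β γ α₁ α₂ β₁ β₂ β₃ γ₁ γ₂)
    (ε₁ : ℝ) (hε₁ : ε₁ ∈ Ioc (0 : ℝ) ε₀) (μ₀ μp μm : ℝ → ℝ)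
    (hZ : ZeroCurves μb δ₀ α β γ ε₁ μ₀ μp μm) :
    ∃ ε₂ ∈ Ioc (0 : ℝ) ε₁, ∃ νb > (0 : ℝ), ∃ C > (0 : ℝ),
      ∀ ε ν : ℝ, |ε| < ε₂ → |ν| < νb →
        |(γ (μ₀ ε + ν) ε - α (μ₀ ε + ν) ε) -
            (2 * ωs + (γ₁ - α₁) * ν +
              (γ₂ - α₂ - (γ₁ - α₁) * (α₂ + γ₂) / (α₁ + γ₁)) * ε ^ 2)| ≤
          C * (|ε| ^ 3 + |ν| * ε ^ 2 + ν ^ 2) := by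
  obtain ⟨α₀, γ₀, d, ⟨hd, hdδ⟩, e, ⟨he, -⟩, C, hC, -, -, hexp⟩ := hH.hexp
  have hT₁ := hH.hT₁
  have hδ₀ := hH.hδ₀
  obtain ⟨hε₁, -⟩ := hε₁
  -- The two expansions of `T` and `S` with a common remainder.
  have hTS : ∀ δ ε : ℝ, |δ| < d → |ε| < e → |ε| ≤ 1 →
      |(α (μb + δ) ε + γ (μb + δ) ε) - ((α₁ + γ₁) * δ + (α₂ + γ₂) * |ε| ^ 2)| ≤
        2 * C * (|ε| ^ 3 + |δ| * |ε| ^ 2 + 2 * δ ^ 2) ∧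
      |(γ (μb + δ) ε - α (μb + δ) ε) - (2 * ωs + (γ₁ - α₁) * δ + (γ₂ - α₂) * |ε| ^ 2)| ≤
        2 * C * (|ε| ^ 3 + |δ| * |ε| ^ 2 + 2 * δ ^ 2) := by
    intro δ ε hδ hε hε1
    obtain ⟨hα, -, hγ, hα₀, hγ₀⟩ := hexp δ ε hδ hε
    have hC' : C * (δ ^ 2 * |ε|) ≤ C * δ ^ 2 := by
      gcongr
      exact mul_le_of_le_one_right (sq_nonneg δ) hε1
    rw [← sq_abs ε] at hα hγ
    rw [abs_le] at hα hγ hα₀ hγ₀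
    constructor <;> rw [abs_le] <;> constructor <;> linarith
  have hzero : (0 : ℝ) ∈ Ioo (-ε₁) ε₁ := ⟨by linarith, hε₁⟩
  have hμ₀0 : μ₀ 0 = μb := by
    have h := (hTS 0 0 (by simpa) (by simpa) (by simp)).1
    simp only [add_zero, abs_zero, mul_zero, zero_pow, ne_eq, OfNat.ofNat_ne_zero,
      not_false_eq_true, sub_zero, abs_nonpos_iff] at h
    exact (((hZ.hT μb ⟨by linarith, by linarith⟩ 0 hzero).1).1 h).symm
  set T₁ := α₁ + γ₁
  set T₂ := α₂ + γ₂
  set η := T₁ / (12 * C)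
  have hη : 0 < η := by positivity
  obtain ⟨r, hr, hcont⟩ := Metric.continuousAt_iff.1 (hZ.hμ₀_an 0 hzero).continuousAt
    (min (d / 2) η) (by positivity)
  set K := 2 * (|T₂| + 2 * C) / T₁
  have hK : 0 < K := by positivity
  set M := 2 * C * (1 + K + 2 * K ^ 2) with hM_def
  have hμ₀ : ∀ ε : ℝ, |ε| < ε₁ → |ε| < e → |ε| ≤ 1 → |ε| ≤ η → |ε| < r →
      |μ₀ ε - μb| < d / 2 ∧ |μ₀ ε - μb| ≤ K * |ε| ^ 2 ∧
        |T₁ * (μ₀ ε - μb) + T₂ * |ε| ^ 2| ≤ M * |ε| ^ 3 := by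
    intro ε h1 h2 h3 h4 h5
    have ha := abs_nonneg ε
    have hk : |μ₀ ε - μb| < min (d / 2) η := by
      have := hcont (x := ε) (by simpa using h5)
      rwa [hμ₀0, Real.dist_eq] at this
    obtain ⟨hkd, hkη⟩ := lt_min_iff.1 hk
    have hmem : ε ∈ Ioo (-ε₁) ε₁ := abs_lt.1 h1
    have hT0 := (hZ.hT (μ₀ ε) (hZ.hmaps₀ ε hmem) ε hmem).1.2 rfl
    have h := (hTS (μ₀ ε - μb) ε (by linarith) h2 h3).1
    rw [add_sub_cancel, hT0, zero_sub, abs_neg] at h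
    have hkK := abs_zero_le_mul_sq hT₁ hC ha h3 h4 hkη.le h
    refine ⟨hkd, hkK, h.trans ?_⟩
    have hsq : (μ₀ ε - μb) ^ 2 ≤ (K * |ε| ^ 2) ^ 2 := by
      rw [← sq_abs]
      gcongr
    have h43 : |ε| ^ 4 ≤ |ε| ^ 3 := pow_le_pow_of_le_one ha h3 (by norm_num)
    calc 2 * C * (|ε| ^ 3 + |μ₀ ε - μb| * |ε| ^ 2 + 2 * (μ₀ ε - μb) ^ 2)
        ≤ 2 * C * (|ε| ^ 3 + K * |ε| ^ 2 * |ε| ^ 2 + 2 * (K * |ε| ^ 2) ^ 2) := by gcongr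
      _ = 2 * C * (|ε| ^ 3 + K * |ε| ^ 4 + 2 * K ^ 2 * |ε| ^ 4) := by ring
      _ ≤ 2 * C * (|ε| ^ 3 + K * |ε| ^ 3 + 2 * K ^ 2 * |ε| ^ 3) := by gcongr
      _ = M * |ε| ^ 3 := by rw [hM_def]; ring
  refine ⟨min ε₁ (min e (min 1 (min η r))), ⟨by positivity, min_le_left _ _⟩, d / 2, by positivity,
    |γ₁ - α₁| * M / T₁ + 2 * C * (4 + K + 4 * K ^ 2), by positivity, fun ε ν hε hν => ?_⟩
  simp only [lt_min_iff] at hε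
  obtain ⟨h1, h2, h3, h4, h5⟩ := hε
  obtain ⟨hkd, hkK, hkM⟩ := hμ₀ ε h1 h2 h3.le h4.le h5
  have ha := abs_nonneg ε
  have hν0 := abs_nonneg ν
  rw [← sq_abs ε]
  set k := μ₀ ε - μb with hk_def
  have hadd : |k + ν| ≤ K * |ε| ^ 2 + |ν| := (abs_add_le k ν).trans (by linarith)
  have hS := (hTS (k + ν) ε ((abs_add_le k ν).trans_lt (by linarith)) h2 h3.le).2
  rw [show μb + (k + ν) = μ₀ ε + ν by rw [hk_def]; ring] at hS
  have hrem : 2 * C * (|ε| ^ 3 + |k + ν| * |ε| ^ 2 + 2 * (k + ν) ^ 2) ≤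
      2 * C * (4 + K + 4 * K ^ 2) * (|ε| ^ 3 + |ν| * |ε| ^ 2 + ν ^ 2) := by
    have h43 : |ε| ^ 4 ≤ |ε| ^ 3 := pow_le_pow_of_le_one ha h3.le (by norm_num)
    have hsq : (k + ν) ^ 2 ≤ 2 * (K ^ 2 * |ε| ^ 4) + 2 * ν ^ 2 := by
      have : (k + ν) ^ 2 ≤ (K * |ε| ^ 2 + |ν|) ^ 2 := by
        rw [← sq_abs]
        gcongr
      nlinarith [sq_nonneg (K * |ε| ^ 2 - |ν|), sq_abs ν]
    rw [mul_assoc (2 * C)]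
    gcongr 2 * C * ?_
    calc |ε| ^ 3 + |k + ν| * |ε| ^ 2 + 2 * (k + ν) ^ 2
        ≤ |ε| ^ 3 + (K * |ε| ^ 2 + |ν|) * |ε| ^ 2 + 2 * (2 * (K ^ 2 * |ε| ^ 4) + 2 * ν ^ 2) := by
          gcongr
      _ = |ε| ^ 3 + K * |ε| ^ 4 + 4 * K ^ 2 * |ε| ^ 4 + |ν| * |ε| ^ 2 + 4 * ν ^ 2 := by ring
      _ ≤ |ε| ^ 3 + K * |ε| ^ 3 + 4 * K ^ 2 * |ε| ^ 3 + |ν| * |ε| ^ 2 + 4 * ν ^ 2 := by gcongr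
      _ ≤ (4 + K + 4 * K ^ 2) * (|ε| ^ 3 + |ν| * |ε| ^ 2 + ν ^ 2) := by
          have p1 : 0 ≤ |ε| ^ 3 := by positivity
          have p2 : 0 ≤ (3 + K + 4 * K ^ 2) * (|ν| * |ε| ^ 2) := by positivity
          have p3 : 0 ≤ (K + 4 * K ^ 2) * ν ^ 2 := by positivity
          linarith
  have hlin : |(γ₁ - α₁) / T₁ * (T₁ * k + T₂ * |ε| ^ 2)| ≤
      |γ₁ - α₁| * M / T₁ * (|ε| ^ 3 + |ν| * |ε| ^ 2 + ν ^ 2) := by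
    rw [abs_mul, abs_div, abs_of_pos hT₁]
    calc |γ₁ - α₁| / T₁ * |T₁ * k + T₂ * |ε| ^ 2| ≤ |γ₁ - α₁| / T₁ * (M * |ε| ^ 3) := by gcongr
      _ = |γ₁ - α₁| * M / T₁ * |ε| ^ 3 := by ring
      _ ≤ _ := by
          gcongr
          have : 0 ≤ |ν| * |ε| ^ 2 := by positivity
          linarith [sq_nonneg ν]
  have hsplit : (γ (μ₀ ε + ν) ε - α (μ₀ ε + ν) ε) - (2 * ωs + (γ₁ - α₁) * ν +
        (γ₂ - α₂ - (γ₁ - α₁) * T₂ / T₁) * |ε| ^ 2) =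
      ((γ (μ₀ ε + ν) ε - α (μ₀ ε + ν) ε) -
        (2 * ωs + (γ₁ - α₁) * (k + ν) + (γ₂ - α₂) * |ε| ^ 2)) +
      (γ₁ - α₁) / T₁ * (T₁ * k + T₂ * |ε| ^ 2) := by
    field_simp
    ring
  rw [hsplit]
  refine (abs_add_le _ _).trans ?_
  linarith
end
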